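/- arXiv:1711.09741 — 3 statements merged into one kernel-verified Lean document; each statement's English description precedes it below -/
import Mathlib

section
/- Fix ε > 0. Let k = k(n) satisfy εn ≤ k ≤ n, let f(n) → ∞ with p = f(n)·log(n)/n ≤ 1, set δ = δ(n) = max(f(n)^{−1/3}, 1/n) and L = ⌊(1−δ)kp⌋. Let G = G_n be any k-regular δ^{1/3}-pseudorandom bipartite graph with parts of size n, and let H be the random subgraph of G in which each edge of G is retained independently with probability p. Then H contains an L-factor with probability 1 − n^{−ω(1)}; i.e., for every constant C > 0, for all sufficiently large n the probability that H has no L-factor is at most n^{−C}. -/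
attribute [local instance] Classical.propDecidable

noncomputable section

/-- The number of ones in an `m × n × k` 0-1 array. -/
def numOnes {m n k : ℕ} (M : Fin m → Fin n → Fin k → Bool) : ℕ :=
  (Finset.univ.filter (fun x : Fin m × Fin n × Fin k => M x.1 x.2.1 x.2.2 = true)).card

/-- An `m × n × k` 0-1 array is a Latin box if it has exactly `m * n` ones and
every line (fixing two coordinates, varying the third) has at most one `1`. -/
def IsLatinBox {m n k : ℕ} (M : Fin m → Fin n → Fin k → Bool) : Prop :=
  numOnes M = m * n ∧
  (∀ i j, (Finset.univ.filter (fun c => M i j c = true)).card ≤ 1) ∧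
  (∀ i c, (Finset.univ.filter (fun j => M i j c = true)).card ≤ 1) ∧
  (∀ j c, (Finset.univ.filter (fun i => M i j c = true)).card ≤ 1)

/-- `M` contains (supports) a Latin box. -/
def ContainsLatinBox {m n k : ℕ} (M : Fin m → Fin n → Fin k → Bool) : Prop :=
  ∃ L : Fin m → Fin n → Fin k → Bool, IsLatinBox L ∧ ∀ i j c, L i j c = true → M i j c = true

/-- The probability that a random `m × n × k` 0-1 array, whose entries are
independently `1` with probability `p`, satisfies the property `P`. -/
def arrProb (m n k : ℕ) (p : ℝ) (P : (Fin m → Fin n → Fin k → Bool) → Prop) : ℝ :=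
  ∑ M : Fin m → Fin n → Fin k → Bool,
    if P M then ∏ i, ∏ j, ∏ c, (if M i j c = true then p else 1 - p) else 0

/-- Degree of left vertex `u` in the bipartite edge set `E`. -/
def rowDeg {n : ℕ} (E : Finset (Fin n × Fin n)) (u : Fin n) : ℕ :=
  (E.filter (fun e => e.1 = u)).card

/-- Degree of right vertex `v` in the bipartite edge set `E`. -/
def colDeg {n : ℕ} (E : Finset (Fin n × Fin n)) (v : Fin n) : ℕ :=
  (E.filter (fun e => e.2 = v)).card

/-- A bipartite graph (edge set on parts of size `n`) is `d`-regular. -/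
def IsBiRegular {n : ℕ} (E : Finset (Fin n × Fin n)) (d : ℕ) : Prop :=
  (∀ u, rowDeg E u = d) ∧ (∀ v, colDeg E v = d)

/-- The number of edges of `E` between `X` (left) and `Y` (right). -/
def edgesBetween {n : ℕ} (E : Finset (Fin n × Fin n)) (X Y : Finset (Fin n)) : ℕ :=
  (E.filter (fun e => e.1 ∈ X ∧ e.2 ∈ Y)).card

/-- A `k`-regular bipartite graph with parts of size `n` is `c`-pseudorandom if every
pair of sets `X`, `Y` with `|X|,|Y| ≥ (ε/10)n` spans at least `(1−c)|X||Y|k/n` edges. -/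
def Pseudorandom {n : ℕ} (ε : ℝ) (E : Finset (Fin n × Fin n)) (k : ℕ) (c : ℝ) : Prop :=
  ∀ X Y : Finset (Fin n), (ε / 10) * n ≤ (X.card : ℝ) → (ε / 10) * n ≤ (Y.card : ℝ) →
    (1 - c) * X.card * Y.card * k / n ≤ (edgesBetween E X Y : ℝ)
/-- Probability that the random subgraph of `G` keeping each edge independently with
probability `p` satisfies `P`. -/
def subProb {n : ℕ} (G : Finset (Fin n × Fin n)) (p : ℝ)
    (P : Finset (Fin n × Fin n) → Prop) : ℝ :=
  ∑ H ∈ G.powerset, if P H then p ^ H.card * (1 - p) ^ (G.card - H.card) else 0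

theorem rowDeg_sum {n : ℕ} (E : Finset (Fin n × Fin n)) (X : Finset (Fin n)) :
    ∑ u ∈ X, rowDeg E u = (E.filter (fun e => e.1 ∈ X)).card := by
  rw [Finset.card_eq_sum_card_fiberwise (f := Prod.fst) (t := X)]
  · refine Finset.sum_congr rfl fun u hu => ?_
    unfold rowDeg
    congr 1
    ext e
    simp only [Finset.mem_filter]
    constructor
    · rintro ⟨h1, rfl⟩
      exact ⟨⟨h1, hu⟩, rfl⟩
    · rintro ⟨⟨h1, -⟩, h2⟩
      exact ⟨h1, h2⟩
  · intro e he
    simpa using (Finset.mem_filter.1 he).2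

theorem colDeg_sum {n : ℕ} (E : Finset (Fin n × Fin n)) (Y : Finset (Fin n)) :
    ∑ v ∈ Y, colDeg E v = (E.filter (fun e => e.2 ∈ Y)).card := by
  rw [Finset.card_eq_sum_card_fiberwise (f := Prod.snd) (t := Y)]
  · refine Finset.sum_congr rfl fun u hu => ?_
    unfold colDeg
    congr 1
    ext e
    simp only [Finset.mem_filter]
    constructor
    · rintro ⟨h1, rfl⟩
      exact ⟨⟨h1, hu⟩, rfl⟩
    · rintro ⟨⟨h1, -⟩, h2⟩
      exact ⟨h1, h2⟩
  · intro e he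
    simpa using (Finset.mem_filter.1 he).2

theorem isBiRegular_of_le_of_ge {n : ℕ} {F : Finset (Fin n × Fin n)} {L : ℕ}
    (hrow : ∀ u, L ≤ rowDeg F u) (hcol : ∀ v, colDeg F v ≤ L) : IsBiRegular F L := by
  have hr : ∑ u, rowDeg F u = F.card := by simp [rowDeg_sum]
  have hc : ∑ v, colDeg F v = F.card := by simp [colDeg_sum]
  have h1 : ∑ _u : Fin n, L ≤ ∑ u, rowDeg F u := Finset.sum_le_sum fun u _ => hrow u
  have h2 : ∑ v, colDeg F v ≤ ∑ _v : Fin n, L := Finset.sum_le_sum fun v _ => hcol v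
  constructor
  · intro u
    exact ((Finset.sum_eq_sum_iff_of_le fun u _ => hrow u).1 (by omega) u (Finset.mem_univ u)).symm
  · intro v
    exact (Finset.sum_eq_sum_iff_of_le fun v _ => hcol v).1 (by omega) v (Finset.mem_univ v)

/-- The Ore–Ryser condition: a cut condition guaranteeing an `L`-factor. -/
theorem exists_factor_of_edgesBetween {n : ℕ} (H : Finset (Fin n × Fin n)) (L : ℕ)
    (h : ∀ X Y : Finset (Fin n), L * (X.card + Y.card) ≤ edgesBetween H X Y + L * n) :
    ∃ F ⊆ H, IsBiRegular F L := by
  -- Copies of left vertices choose incident edges; an edge takes itself unless selected,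
  -- in which case it takes a copy of its right endpoint.
  let t : (Fin n × Fin L) ⊕ (Fin n × Fin n) → Finset ((Fin n × Fin L) ⊕ (Fin n × Fin n)) :=
    Sum.elim (fun a => Finset.disjSum ∅ (H.filter (fun e => e.1 = a.1)))
      (fun e => Finset.disjSum ({e.2} ×ˢ Finset.univ) {e})
  have hall : ∀ s : Finset ((Fin n × Fin L) ⊕ (Fin n × Fin n)), s.card ≤ (s.biUnion t).card := by
    intro s
    set X := s.toLeft.image Prod.fst with hX
    set T := s.toRight with hT
    set Y := T.image Prod.snd with hY
    have h1 : s.card ≤ X.card * L + T.card := by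
      rw [← Finset.card_toLeft_add_card_toRight (u := s)]
      gcongr
      have : s.toLeft ⊆ X ×ˢ Finset.univ := by
        intro a ha
        exact Finset.mem_product.2 ⟨Finset.mem_image_of_mem Prod.fst ha, Finset.mem_univ _⟩
      simpa using Finset.card_le_card this
    have h2 : Finset.disjSum (Y ×ˢ (Finset.univ : Finset (Fin L)))
        (H.filter (fun e => e.1 ∈ X) ∪ T) ⊆ s.biUnion t := by
      rintro (⟨v, j⟩ | e) hb
      · rw [Finset.inl_mem_disjSum] at hb
        obtain ⟨e, he, rfl⟩ := Finset.mem_image.1 (Finset.mem_product.1 hb).1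
        refine Finset.mem_biUnion.2 ⟨Sum.inr e, Finset.mem_toRight.1 he, ?_⟩
        simp [t]
      · rw [Finset.inr_mem_disjSum, Finset.mem_union] at hb
        rcases hb with hb | hb
        · obtain ⟨heH, heX⟩ := Finset.mem_filter.1 hb
          obtain ⟨a, ha, hae⟩ := Finset.mem_image.1 heX
          refine Finset.mem_biUnion.2 ⟨Sum.inl a, Finset.mem_toLeft.1 ha, ?_⟩
          simp [t, heH, hae]
        · refine Finset.mem_biUnion.2 ⟨Sum.inr e, Finset.mem_toRight.1 hb, ?_⟩
          simp [t]
    have h3 := Finset.card_le_card h2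
    have h4 : edgesBetween H X Yᶜ + T.card ≤ (H.filter (fun e => e.1 ∈ X) ∪ T).card := by
      unfold edgesBetween
      rw [← Finset.card_union_of_disjoint]
      · refine Finset.card_le_card (Finset.union_subset_union_left fun e he => ?_)
        simp only [Finset.mem_filter] at he ⊢
        exact ⟨he.1, he.2.1⟩
      · rw [Finset.disjoint_left]
        intro e he heT
        exact Finset.mem_compl.1 (Finset.mem_filter.1 he).2.2 (Finset.mem_image_of_mem _ heT)
    rw [Finset.card_disjSum, Finset.card_product, Finset.card_univ, Fintype.card_fin] at h3
    have h5 := h X Yᶜ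
    have h6 : Y.card + Yᶜ.card = n := by simp
    have h7 : L * n = L * Y.card + L * Yᶜ.card := by
      rw [← mul_add, h6]
    rw [mul_add] at h5
    rw [mul_comm] at h1 h3
    omega
  obtain ⟨g, hg, hgt⟩ := (Finset.all_card_le_biUnion_card_iff_exists_injective t).1 hall
  refine ⟨H.filter (fun e => ∃ a, g (Sum.inr e) = Sum.inl a), Finset.filter_subset _ _,
    isBiRegular_of_le_of_ge ?_ ?_⟩
  · intro u
    have hex : ∀ j : Fin L, ∃ e ∈ H, e.1 = u ∧ g (Sum.inl (u, j)) = Sum.inr e := by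
      intro j
      have := hgt (Sum.inl (u, j))
      rcases hgu : g (Sum.inl (u, j)) with a | e
      · simp [hgu, t] at this
      · rw [hgu] at this
        simp only [t, Sum.elim_inl, Finset.inr_mem_disjSum, Finset.mem_filter] at this
        exact ⟨e, this.1, this.2, rfl⟩
    choose e heH heu hge using hex
    have hinj : Function.Injective e := by
      intro i j hij
      have : g (Sum.inl (u, i)) = g (Sum.inl (u, j)) := by rw [hge, hge, hij]
      simpa using hg this
    have hsub : Finset.univ.image e ⊆ (H.filter (fun e => ∃ a, g (Sum.inr e) = Sum.inl a)).filter
        (fun e => e.1 = u) := by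
      intro d hd
      obtain ⟨j, -, rfl⟩ := Finset.mem_image.1 hd
      refine Finset.mem_filter.2 ⟨Finset.mem_filter.2 ⟨heH j, ?_⟩, heu j⟩
      rcases hgd : g (Sum.inr (e j)) with a | d
      · exact ⟨a, rfl⟩
      · have := hgt (Sum.inr (e j))
        rw [hgd] at this
        simp only [t, Sum.elim_inr, Finset.inr_mem_disjSum, Finset.mem_singleton] at this
        rw [this] at hgd
        exact absurd (hg (hgd.trans (hge j).symm)) Sum.inr_ne_inl
    have := Finset.card_le_card hsub
    rw [Finset.card_image_of_injective _ hinj] at this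
    simpa [rowDeg] using this
  · intro v
    have hex : ∀ e : Fin n × Fin n, e ∈ (H.filter (fun e => ∃ a, g (Sum.inr e) = Sum.inl a)).filter
        (fun e => e.2 = v) → g (Sum.inr e) ∈ (Finset.univ : Finset (Fin L)).image
          (fun j => (Sum.inl (v, j) : (Fin n × Fin L) ⊕ (Fin n × Fin n))) := by
      intro e he
      simp only [Finset.mem_filter] at he
      obtain ⟨⟨-, a, ha⟩, rfl⟩ := he
      have := hgt (Sum.inr e)
      rw [ha] at this ⊢
      simp only [t, Sum.elim_inr, Finset.inl_mem_disjSum, Finset.mem_product,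
        Finset.mem_singleton] at this
      exact Finset.mem_image.2 ⟨a.2, Finset.mem_univ _, by rw [← this.1]⟩
    have := (Finset.card_le_card_of_injOn (fun e => g (Sum.inr e)) hex
      (fun a _ b _ hab => by simpa using hg hab)).trans Finset.card_image_le
    simpa [colDeg] using this

/-- The exponential moment of the number of retained edges in `S`. -/
theorem sum_powerset_weight_mul_pow {α : Type*} [DecidableEq α] (G S : Finset α) (hS : S ⊆ G)
    (p r : ℝ) :
    ∑ H ∈ G.powerset, p ^ H.card * (1 - p) ^ (G.card - H.card) * r ^ (H ∩ S).card
      = (p * r + (1 - p)) ^ S.card := by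
  have h := Finset.prod_add (fun e => p * if e ∈ S then r else 1) (fun _ => 1 - p) G
  have h1 : ∏ e ∈ G, ((p * if e ∈ S then r else 1) + (1 - p)) = (p * r + (1 - p)) ^ S.card := by
    rw [← Finset.prod_subset hS]
    · rw [Finset.prod_congr rfl fun e he => by rw [if_pos he], Finset.prod_const]
    · intro e _ he
      rw [if_neg he]
      ring
  rw [← h1, h]
  refine Finset.sum_congr rfl fun H hH => ?_
  rw [Finset.prod_mul_distrib, Finset.prod_const, Finset.prod_const,
    Finset.card_sdiff_of_subset (Finset.mem_powerset.1 hH), Finset.prod_ite_mem, Finset.prod_const]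
  ring

theorem exp_neg_le_one_sub_add_sq {x : ℝ} (hx : 0 ≤ x) : Real.exp (-x) ≤ 1 - x + x ^ 2 / 2 := by
  have h := Real.quadratic_le_exp_of_nonneg hx
  rw [Real.exp_neg]
  have h0 : 0 < 1 + x + x ^ 2 / 2 := by positivity
  refine (inv_anti₀ h0 h).trans ?_
  rw [inv_le_iff_one_le_mul₀ h0]
  nlinarith [sq_nonneg (x ^ 2)]

theorem weight_nonneg {p : ℝ} (hp0 : 0 ≤ p) (hp1 : p ≤ 1) (a b : ℕ) :
    0 ≤ p ^ a * (1 - p) ^ b :=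
  mul_nonneg (pow_nonneg hp0 _) (pow_nonneg (by linarith) _)

/-- Chernoff's bound for the lower tail. -/
theorem subProb_inter_card_le {n : ℕ} (G S : Finset (Fin n × Fin n)) (hS : S ⊆ G) {p δ : ℝ}
    (hp0 : 0 ≤ p) (hp1 : p ≤ 1) (hδ : 0 ≤ δ) :
    subProb G p (fun H => ((H ∩ S).card : ℝ) ≤ (1 - δ) * (p * S.card))
      ≤ Real.exp (-(δ ^ 2 * p * S.card / 2)) := by
  have key : subProb G p (fun H => ((H ∩ S).card : ℝ) ≤ (1 - δ) * (p * S.card))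
      ≤ Real.exp (δ * ((1 - δ) * (p * S.card))) * (p * Real.exp (-δ) + (1 - p)) ^ S.card := by
    rw [← sum_powerset_weight_mul_pow G S hS p, Finset.mul_sum]
    refine Finset.sum_le_sum fun H _ => ?_
    have hw := weight_nonneg hp0 hp1 H.card (G.card - H.card)
    split_ifs with hH
    · have : 1 ≤ Real.exp (δ * ((1 - δ) * (p * S.card))) * Real.exp (-δ) ^ (H ∩ S).card := by
        rw [← Real.exp_nat_mul, ← Real.exp_add]
        apply Real.one_le_exp
        nlinarith [mul_le_mul_of_nonneg_left hH hδ]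
      nlinarith [mul_le_mul_of_nonneg_left this hw]
    · positivity
  refine key.trans ?_
  have h1 : p * Real.exp (-δ) + (1 - p) ≤ Real.exp (p * (-δ + δ ^ 2 / 2)) := by
    have h2 := exp_neg_le_one_sub_add_sq hδ
    have h3 := Real.add_one_le_exp (p * (-δ + δ ^ 2 / 2))
    nlinarith [mul_le_mul_of_nonneg_left h2 hp0]
  have h0 : 0 ≤ p * Real.exp (-δ) + (1 - p) := by
    have := mul_nonneg hp0 (Real.exp_pos (-δ)).le
    linarith
  calc _ ≤ Real.exp (δ * ((1 - δ) * (p * S.card))) *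
        Real.exp (p * (-δ + δ ^ 2 / 2)) ^ S.card := by gcongr
    _ = _ := by
        rw [← Real.exp_nat_mul, ← Real.exp_add]
        congr 1
        ring

theorem subProb_le_sum {n : ℕ} {ι : Type*} (s : Finset ι) (G : Finset (Fin n × Fin n)) {p : ℝ}
    (hp0 : 0 ≤ p) (hp1 : p ≤ 1) (P : Finset (Fin n × Fin n) → Prop)
    (Q : ι → Finset (Fin n × Fin n) → Prop) (h : ∀ H ⊆ G, P H → ∃ i ∈ s, Q i H) :
    subProb G p P ≤ ∑ i ∈ s, subProb G p (Q i) := by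
  unfold subProb
  rw [Finset.sum_comm]
  refine Finset.sum_le_sum fun H hH => ?_
  have hw := weight_nonneg hp0 hp1 H.card (G.card - H.card)
  have hnn : ∀ i ∈ s, 0 ≤ if Q i H then p ^ H.card * (1 - p) ^ (G.card - H.card) else 0 := by
    intro i _
    split_ifs <;> simp [hw]
  split_ifs with hP
  · obtain ⟨i, hi, hQ⟩ := h H (Finset.mem_powerset.1 hH) hP
    exact (le_of_eq (by rw [if_pos hQ])).trans (Finset.single_le_sum hnn hi)
  · exact Finset.sum_nonneg hnn

theorem subProb_mono {n : ℕ} (G : Finset (Fin n × Fin n)) {p : ℝ}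
    (hp0 : 0 ≤ p) (hp1 : p ≤ 1) {P Q : Finset (Fin n × Fin n) → Prop}
    (h : ∀ H ⊆ G, P H → Q H) : subProb G p P ≤ subProb G p Q := by
  simpa using subProb_le_sum {()} G hp0 hp1 P (fun _ => Q) (by simpa using h)

theorem mul_card_le_edgesBetween_add_left {n k : ℕ} {G : Finset (Fin n × Fin n)}
    (hG : IsBiRegular G k) (X Y : Finset (Fin n)) :
    k * X.card ≤ edgesBetween G X Y + X.card * Yᶜ.card ∧
    k * X.card ≤ edgesBetween G X Y + k * Yᶜ.card := by
  have h1 : k * X.card = (G.filter (fun e => e.1 ∈ X)).card := by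
    rw [← rowDeg_sum, Finset.sum_congr rfl fun u _ => hG.1 u]
    simp [mul_comm]
  have h2 : k * Yᶜ.card = (G.filter (fun e => e.2 ∈ Yᶜ)).card := by
    rw [← colDeg_sum, Finset.sum_congr rfl fun u _ => hG.2 u]
    simp [mul_comm]
  have h3 : (G.filter (fun e => e.1 ∈ X)).card
      = edgesBetween G X Y + edgesBetween G X Yᶜ := by
    unfold edgesBetween
    rw [← Finset.card_filter_add_card_filter_not (s := G.filter (fun e => e.1 ∈ X))
      (fun e => e.2 ∈ Y), Finset.filter_filter, Finset.filter_filter]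
    simp only [Finset.mem_compl]
  have h4 : edgesBetween G X Yᶜ ≤ (G.filter (fun e => e.2 ∈ Yᶜ)).card :=
    Finset.card_le_card (Finset.monotone_filter_right _ fun e _ he => he.2)
  have h5 : edgesBetween G X Yᶜ ≤ X.card * Yᶜ.card := by
    rw [← Finset.card_product]
    refine Finset.card_le_card fun e he => ?_
    exact Finset.mem_product.2 (Finset.mem_filter.1 he).2
  omega

theorem mul_card_le_edgesBetween_add_right {n k : ℕ} {G : Finset (Fin n × Fin n)}
    (hG : IsBiRegular G k) (X Y : Finset (Fin n)) :
    k * Y.card ≤ edgesBetween G X Y + Xᶜ.card * Y.card := by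
  have h1 : k * Y.card = (G.filter (fun e => e.2 ∈ Y)).card := by
    rw [← colDeg_sum, Finset.sum_congr rfl fun u _ => hG.2 u]
    simp [mul_comm]
  have h3 : (G.filter (fun e => e.2 ∈ Y)).card
      = edgesBetween G X Y + edgesBetween G Xᶜ Y := by
    unfold edgesBetween
    rw [← Finset.card_filter_add_card_filter_not (s := G.filter (fun e => e.2 ∈ Y))
      (fun e => e.1 ∈ X), Finset.filter_filter, Finset.filter_filter]
    simp only [Finset.mem_compl, and_comm]
  have h5 : edgesBetween G Xᶜ Y ≤ Xᶜ.card * Y.card := by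
    rw [← Finset.card_product]
    refine Finset.card_le_card fun e he => ?_
    exact Finset.mem_product.2 (Finset.mem_filter.1 he).2
  omega

/-- The expansion of a dense regular pseudorandom bipartite graph. -/
theorem edgesBetween_lower_bound {n k : ℕ} {ε c : ℝ} {G : Finset (Fin n × Fin n)} (hε : 0 < ε)
    (hε1 : ε ≤ 1) (hk : ε * n ≤ k) (hc : c ≤ 1 / 2) (hG : IsBiRegular G k)
    (hps : Pseudorandom ε G k c) (X Y : Finset (Fin n)) (hXY : n < X.card + Y.card) :
    ε ^ 3 / 400 * n * (1 + min X.card (n - X.card) + min Y.card (n - Y.card) : ℕ)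
      ≤ edgesBetween G X Y := by
  have hx : X.card ≤ n := by simpa using X.card_le_univ
  have hy : Y.card ≤ n := by simpa using Y.card_le_univ
  have hn : 0 < n := by omega
  have hn' : (1 : ℝ) ≤ n := by exact_mod_cast hn
  have hX : X.card + Xᶜ.card = n := by simp
  have hY : Y.card + Yᶜ.card = n := by simp
  have hε3 : ε ^ 3 / 400 ≤ ε / 10 := by
    have : ε ^ 3 ≤ ε := by
      calc ε ^ 3 = ε * ε ^ 2 := by ring
        _ ≤ ε * 1 := by gcongr; exact pow_le_one₀ hε.le hε1
        _ = ε := mul_one _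
    linarith
  have small : ∀ x b : ℕ, ∀ N s : ℝ, (x : ℝ) < ε / 10 * n → b ≤ x →
      (k : ℝ) * x ≤ N + x * b → 0 ≤ s → s ≤ 2 * x → ε ^ 3 / 400 * n * s ≤ N := by
    intro x b N s h1 h2 h3 hs h4
    have hb : (b : ℝ) ≤ x := by exact_mod_cast h2
    have hx0 : (0 : ℝ) ≤ x := by positivity
    calc ε ^ 3 / 400 * n * s ≤ ε / 10 * n * (2 * x) := by gcongr
      _ ≤ N := by
        have h5 : 0 ≤ ε * n * x := by positivity
        linarith [mul_le_mul_of_nonneg_right hk hx0, mul_le_mul_of_nonneg_left hb hx0,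
          mul_le_mul_of_nonneg_left h1.le hx0]
  by_cases h1 : (X.card : ℝ) < ε / 10 * n
  · refine small X.card Yᶜ.card _ _ h1 (by omega) ?_ (Nat.cast_nonneg _) ?_
    · exact_mod_cast (mul_card_le_edgesBetween_add_left hG X Y).1
    · have : 1 + min X.card (n - X.card) + min Y.card (n - Y.card) ≤ 2 * X.card := by omega
      exact_mod_cast this
  by_cases h2 : (Y.card : ℝ) < ε / 10 * n
  · refine small Y.card Xᶜ.card _ _ h2 (by omega) ?_ (Nat.cast_nonneg _) ?_
    · rw [mul_comm (Y.card : ℝ) (Xᶜ.card : ℝ)]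
      exact_mod_cast mul_card_le_edgesBetween_add_right hG X Y
    · have : 1 + min X.card (n - X.card) + min Y.card (n - Y.card) ≤ 2 * Y.card := by omega
      exact_mod_cast this
  push Not at h1 h2
  refine le_trans ?_ (hps X Y h1 h2)
  have hs : ((1 + min X.card (n - X.card) + min Y.card (n - Y.card) : ℕ) : ℝ) ≤ 2 * n := by
    have : 1 + min X.card (n - X.card) + min Y.card (n - Y.card) ≤ 2 * n := by omega
    exact_mod_cast this
  calc _ ≤ ε ^ 3 / 400 * n * (2 * n) := by gcongr
    _ = 1 / 2 * (ε / 10 * n) * (ε / 10 * n) * (ε * n) / n := by field_simp; ring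
    _ ≤ _ := by
      have hc' : 1 / 2 ≤ 1 - c := by linarith
      have hc0 : 0 ≤ 1 - c := by linarith
      gcongr

theorem sum_pow_min_card_le {n : ℕ} {q : ℝ} (hq : 0 ≤ q) (hqn : q * n ≤ 1) :
    ∑ X : Finset (Fin n), q ^ min X.card (n - X.card) ≤ 6 := by
  have hexp : (1 + q) ^ n ≤ 3 := by
    calc (1 + q) ^ n ≤ Real.exp q ^ n := by
          gcongr
          linarith [Real.add_one_le_exp q]
      _ = Real.exp (n * q) := (Real.exp_nat_mul _ _).symm
      _ ≤ Real.exp 1 := by gcongr; linarith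
      _ ≤ 3 := by linarith [Real.exp_one_lt_d9]
  have h1 := Fintype.sum_pow_mul_eq_add_pow (Fin n) q 1
  have h2 := Fintype.sum_pow_mul_eq_add_pow (Fin n) 1 q
  simp only [Fintype.card_fin, one_pow, mul_one, one_mul] at h1 h2
  calc ∑ X : Finset (Fin n), q ^ min X.card (n - X.card)
      ≤ ∑ X : Finset (Fin n), (q ^ X.card + q ^ (n - X.card)) := by
        refine Finset.sum_le_sum fun X _ => ?_
        have := pow_nonneg hq X.card
        have := pow_nonneg hq (n - X.card)
        rcases min_choice X.card (n - X.card) with h | h <;> rw [h] <;> linarith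
    _ ≤ 6 := by
        rw [Finset.sum_add_distrib, h1, h2, add_comm q 1]
        linarith

/-- A quantitative bound for the probability that the random subgraph has no large factor. -/
theorem subProb_no_factor_le {n k : ℕ} {ε c p δ q : ℝ} {G : Finset (Fin n × Fin n)} (hε : 0 < ε)
    (hε1 : ε ≤ 1) (hk : ε * n ≤ k) (hc : c ≤ 1 / 2) (hG : IsBiRegular G k)
    (hps : Pseudorandom ε G k c) (hp0 : 0 ≤ p) (hp1 : p ≤ 1) (hδ0 : 0 ≤ δ) (hδ1 : δ ≤ 1)
    (hq : 0 ≤ q) (hqn : q * n ≤ 1)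
    (hqe : Real.exp (-(δ ^ 2 * p * (ε ^ 3 / 400 * n) / 2)) ≤ q) :
    subProb G p (fun H => ¬ ∃ F ⊆ H, IsBiRegular F ⌊(1 - δ) * k * p⌋₊) ≤ 36 * q := by
  set m : Finset (Fin n) → ℕ := fun X => min X.card (n - X.card) with hm
  set L := ⌊(1 - δ) * k * p⌋₊ with hL
  have hLle : (L : ℝ) ≤ (1 - δ) * k * p :=
    Nat.floor_le (mul_nonneg (mul_nonneg (by linarith) (by positivity)) hp0)
  let Q : Finset (Fin n) × Finset (Fin n) → Finset (Fin n × Fin n) → Prop := fun Z H =>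
    edgesBetween H Z.1 Z.2 + L * n < L * (Z.1.card + Z.2.card)
  have hQ : ∀ Z, subProb G p (Q Z) ≤ q * (q ^ m Z.1 * q ^ m Z.2) := by
    rintro ⟨X, Y⟩
    by_cases hXY : n < X.card + Y.card
    · have hY : Y.card + Yᶜ.card = n := by simp
      have hN : (k : ℝ) * X.card ≤ edgesBetween G X Y + k * Yᶜ.card := by
        exact_mod_cast (mul_card_le_edgesBetween_add_left hG X Y).2
      have hYr : (Y.card : ℝ) + Yᶜ.card = n := by exact_mod_cast hY
      set S := G.filter (fun e => e.1 ∈ X ∧ e.2 ∈ Y) with hS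
      have hSc : edgesBetween G X Y = S.card := rfl
      have hmono : ∀ H ⊆ G, Q (X, Y) H → ((H ∩ S).card : ℝ) ≤ (1 - δ) * (p * S.card) := by
        intro H hH hQH
        have hHS : edgesBetween H X Y = (H ∩ S).card := by
          unfold edgesBetween
          congr 1
          ext e
          simp only [hS, Finset.mem_filter, Finset.mem_inter]
          exact ⟨fun h => ⟨h.1, hH h.1, h.2⟩, fun h => ⟨h.1, h.2.2⟩⟩
        have hQ' : ((H ∩ S).card : ℝ) + L * n < L * (X.card + Y.card) := by
          rw [← hHS]
          exact_mod_cast hQH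
        have hXYr : (0 : ℝ) ≤ X.card + Y.card - n := by
          have : (n : ℝ) < X.card + Y.card := by exact_mod_cast hXY
          linarith
        calc ((H ∩ S).card : ℝ) ≤ L * (X.card + Y.card - n) := by linarith
          _ ≤ (1 - δ) * k * p * (X.card + Y.card - n) := by gcongr
          _ = (1 - δ) * (p * (k * (X.card + Y.card - n))) := by ring
          _ ≤ (1 - δ) * (p * S.card) := by
            have : (k : ℝ) * (X.card + Y.card - n) ≤ S.card := by
              rw [← hSc, ← hYr]
              linarith
            have : 0 ≤ 1 - δ := by linarith
            gcongr
      refine (subProb_mono G hp0 hp1 hmono).trans ?_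
      refine (subProb_inter_card_le G S (Finset.filter_subset _ _) hp0 hp1 hδ0).trans ?_
      have hlow := edgesBetween_lower_bound hε hε1 hk hc hG hps X Y hXY
      calc Real.exp (-(δ ^ 2 * p * S.card / 2))
          ≤ Real.exp (-(δ ^ 2 * p * (ε ^ 3 / 400 * n * (1 + m X + m Y : ℕ)) / 2)) := by
            gcongr
            exact hlow
        _ = Real.exp (-(δ ^ 2 * p * (ε ^ 3 / 400 * n) / 2)) ^ (1 + m X + m Y) := by
            rw [← Real.exp_nat_mul]
            congr 1
            ring
        _ ≤ q ^ (1 + m X + m Y) := by gcongr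
        _ = q * (q ^ m X * q ^ m Y) := by ring
    · have : subProb G p (Q (X, Y)) = 0 := by
        refine Finset.sum_eq_zero fun H _ => if_neg ?_
        have := Nat.mul_le_mul_left L (not_lt.1 hXY)
        simp only [Q]
        omega
      rw [this]
      positivity
  calc _ ≤ ∑ Z : Finset (Fin n) × Finset (Fin n), subProb G p (Q Z) := by
        refine subProb_le_sum _ G hp0 hp1 _ _ fun H _ hH => ?_
        by_contra! hcon
        refine hH (exists_factor_of_edgesBetween H L fun X Y => ?_)
        exact not_lt.1 (hcon (X, Y) (Finset.mem_univ _))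
    _ ≤ ∑ Z : Finset (Fin n) × Finset (Fin n), q * (q ^ m Z.1 * q ^ m Z.2) :=
        Finset.sum_le_sum fun Z _ => hQ Z
    _ = q * ((∑ X, q ^ m X) * ∑ Y, q ^ m Y) := by
        rw [← Finset.mul_sum, Fintype.sum_prod_type, Finset.sum_mul_sum]
    _ ≤ q * (6 * 6) := by
        have h6 : ∑ X, q ^ m X ≤ 6 := sum_pow_min_card_le hq hqn
        gcongr
    _ = 36 * q := by ring

/-- If `G = G n` is a `k(n)`-regular `δ(n)^{1/3}`-pseudorandom bipartite graph with
`εn ≤ k(n) ≤ n`, `p = f·log n/n ≤ 1` with `f → ∞`, `δ = max(f^{-1/3}, 1/n)` and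
`L = ⌊(1−δ)kp⌋`, then the random subgraph `H` of `G` contains an `L`-factor with
probability `1 − n^{−ω(1)}`. -/
theorem stmt8 (ε : ℝ) (hε : 0 < ε) (k : ℕ → ℕ)
    (hk : ∀ n : ℕ, ε * n ≤ (k n : ℝ) ∧ k n ≤ n)
    (f : ℕ → ℝ) (hf : Filter.Tendsto f Filter.atTop Filter.atTop)
    (p : ℕ → ℝ) (hp : ∀ n : ℕ, p n = f n * Real.log n / n) (hp1 : ∀ n, p n ≤ 1)
    (δ : ℕ → ℝ) (hδ : ∀ n : ℕ, δ n = max ((f n) ^ (-(1 / 3 : ℝ))) (1 / n))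
    (G : (n : ℕ) → Finset (Fin n × Fin n))
    (hreg : ∀ n, IsBiRegular (G n) (k n))
    (hpseudo : ∀ n, Pseudorandom ε (G n) (k n) ((δ n) ^ ((1 : ℝ) / 3)))
    (C : ℝ) (hC : 0 < C) :
    ∀ᶠ n : ℕ in Filter.atTop,
      subProb (G n) (p n)
          (fun H => ¬ ∃ F ⊆ H, IsBiRegular F ⌊(1 - δ n) * (k n) * p n⌋₊)
        ≤ (n : ℝ) ^ (-C) := by
  have hδ3 : Filter.Tendsto (fun n => δ n ^ ((1 : ℝ) / 3)) Filter.atTop (nhds 0) := by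
    have h1 : Filter.Tendsto δ Filter.atTop (nhds 0) := by
      have := ((tendsto_rpow_neg_atTop (by norm_num : (0 : ℝ) < 1 / 3)).comp hf).max
        tendsto_one_div_atTop_nhds_zero_nat
      simp only [max_self] at this
      exact this.congr fun n => (hδ n).symm
    have := h1.rpow_const (p := (1 : ℝ) / 3) (Or.inr (by norm_num))
    rwa [Real.zero_rpow (by norm_num)] at this
  have hδt : ∀ᶠ n in Filter.atTop, δ n ^ ((1 : ℝ) / 3) ≤ 1 / 2 :=
    hδ3.eventually_le_const (by norm_num)
  have hf3 : Filter.Tendsto (fun n => f n ^ ((1 : ℝ) / 3)) Filter.atTop Filter.atTop :=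
    (tendsto_rpow_atTop (by norm_num)).comp hf
  filter_upwards [hδt, hf3.eventually_ge_atTop (800 * (C + 1) / ε ^ 3),
    hf.eventually_gt_atTop 0, Filter.eventually_ge_atTop 36] with n hc hfn hf0 hn
  have hn36 : (36 : ℝ) ≤ n := by exact_mod_cast hn
  have hn0 : (0 : ℝ) < n := by linarith
  have hlog : 0 ≤ Real.log n := Real.log_nonneg (by linarith)
  have hε1 : ε ≤ 1 := by
    have : ε * n ≤ 1 * n := by
      have : (k n : ℝ) ≤ n := by exact_mod_cast (hk n).2
      linarith [(hk n).1]
    exact le_of_mul_le_mul_right this hn0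
  have hp0 : 0 ≤ p n := by rw [hp]; positivity
  have hδf : f n ^ (-(1 / 3 : ℝ)) ≤ δ n := by rw [hδ]; exact le_max_left _ _
  have hδ0 : 0 ≤ δ n := (Real.rpow_nonneg hf0.le _).trans hδf
  have hδ1 : δ n ≤ 1 := by
    by_contra! h
    have := Real.one_le_rpow h.le (by norm_num : (0 : ℝ) ≤ 1 / 3)
    linarith
  have hexp : f n ^ ((1 : ℝ) / 3) * Real.log n ≤ δ n ^ 2 * p n * n := by
    have h1 : f n ^ ((1 : ℝ) / 3) = (f n ^ (-(1 / 3 : ℝ))) ^ 2 * f n := by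
      rw [← Real.rpow_natCast, ← Real.rpow_mul hf0.le]
      nth_rewrite 3 [← Real.rpow_one (f n)]
      rw [← Real.rpow_add hf0]
      norm_num
    calc f n ^ ((1 : ℝ) / 3) * Real.log n
        = (f n ^ (-(1 / 3 : ℝ))) ^ 2 * (f n * Real.log n) := by rw [h1]; ring
      _ ≤ δ n ^ 2 * (f n * Real.log n) := by gcongr
      _ = δ n ^ 2 * p n * n := by rw [hp]; field_simp
  have hqe : Real.exp (-(δ n ^ 2 * p n * (ε ^ 3 / 400 * n) / 2)) ≤ (n : ℝ) ^ (-(C + 1)) := by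
    rw [Real.rpow_def_of_pos hn0]
    gcongr
    have h1 : 800 * (C + 1) / ε ^ 3 * Real.log n ≤ δ n ^ 2 * p n * n :=
      (by gcongr : _ ≤ f n ^ ((1 : ℝ) / 3) * Real.log n).trans hexp
    have h2 := mul_le_mul_of_nonneg_left h1 (by positivity : 0 ≤ ε ^ 3 / 800)
    have h3 : ε ^ 3 / 800 * (800 * (C + 1) / ε ^ 3 * Real.log n) = (C + 1) * Real.log n := by
      field_simp
    linarith
  have hq : (n : ℝ) ^ (-(C + 1)) = (n : ℝ) ^ (-C) / n := by
    rw [neg_add, Real.rpow_add hn0, Real.rpow_neg_one, div_eq_mul_inv]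
  have hqC : (n : ℝ) ^ (-C) ≤ 1 := Real.rpow_le_one_of_one_le_of_nonpos (by linarith) (by linarith)
  refine (subProb_no_factor_le hε hε1 (hk n).1 hc (hreg n) (hpseudo n) hp0 (hp1 n) hδ0 hδ1
    (by positivity) ?_ hqe).trans ?_
  · rw [hq, div_mul_cancel₀ _ hn0.ne']
    exact hqC
  · rw [hq, mul_div_assoc', div_le_iff₀ hn0, mul_comm]
    gcongr

end
end

section
/- Fix ε > 0. There exist c > 0 and N such that for all n ≥ N, all integers k with εn ≤ k ≤ n, and all δ with 1/n ≤ δ ≤ 1, the number of k-regular bipartite graphs with parts of size n that are not δ^{1/3}-pseudorandom is at most C(n,k)^n · exp(−c·δ^{2/3}·n²), where C(n,k) denotes the binomial coefficient n choose k. -/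
attribute [local instance] Classical.propDecidable

noncomputable section

/-- The neighbourhood of the left vertex `u` in the bipartite edge set `E`. -/
def rightNeighbors {n : ℕ} (E : Finset (Fin n × Fin n)) (u : Fin n) : Finset (Fin n) :=
  Finset.univ.filter (fun v => (u, v) ∈ E)

lemma rightNeighbors_injective {n : ℕ} :
    Function.Injective (rightNeighbors : Finset (Fin n × Fin n) → Fin n → Finset (Fin n)) := by
  intro E F h
  ext ⟨u, v⟩
  have := congrArg (fun S => v ∈ S) (congrFun h u)
  simpa [rightNeighbors] using this

lemma card_rightNeighbors {n : ℕ} (E : Finset (Fin n × Fin n)) (u : Fin n) :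
    (rightNeighbors E u).card = rowDeg E u := by
  unfold rightNeighbors rowDeg
  refine Finset.card_bij (fun v _ => (u, v)) ?_ ?_ ?_
  · simp
  · simp
  · rintro ⟨a, v⟩ h
    simp only [Finset.mem_filter] at h
    obtain ⟨h1, rfl⟩ := h
    exact ⟨v, by simpa using h1, rfl⟩

lemma edgesBetween_eq_sum {n : ℕ} (E : Finset (Fin n × Fin n)) (X Y : Finset (Fin n)) :
    edgesBetween E X Y = ∑ u ∈ X, (rightNeighbors E u ∩ Y).card := by
  unfold edgesBetween
  rw [Finset.card_eq_sum_card_fiberwise (f := Prod.fst) (t := X)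
    (by intro e he; simp at he; exact he.2.1)]
  refine Finset.sum_congr rfl fun u hu => ?_
  symm
  refine Finset.card_bij (fun v _ => (u, v)) ?_ ?_ ?_
  · intro v hv
    simp [rightNeighbors] at hv
    simp [hv, hu]
  · simp
  · rintro ⟨a, v⟩ h
    simp only [Finset.mem_filter] at h
    obtain ⟨⟨h1, -, h2⟩, rfl⟩ := h
    exact ⟨v, by simpa [rightNeighbors] using ⟨h1, h2⟩, rfl⟩

lemma edgesBetween_add_compl {n k : ℕ} {E : Finset (Fin n × Fin n)} (hE : IsBiRegular E k)
    (X Y : Finset (Fin n)) : edgesBetween E X Y + edgesBetween E X Yᶜ = X.card * k := by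
  rw [edgesBetween_eq_sum, edgesBetween_eq_sum, ← Finset.sum_add_distrib]
  have h : ∀ u ∈ X, (rightNeighbors E u ∩ Y).card + (rightNeighbors E u ∩ Yᶜ).card = k := by
    intro u _
    rw [← hE.1 u, ← card_rightNeighbors, ← Finset.sdiff_eq_inter_compl,
      Finset.card_inter_add_card_sdiff]
  rw [Finset.sum_congr rfl h, Finset.sum_const, smul_eq_mul]

lemma choose_sub_mul_pow_le (n k j : ℕ) (hk : k ≤ n) (hj : j ≤ k) :
    (n - j).choose (k - j) * n ^ j ≤ n.choose k * k ^ j := by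
  induction j with
  | zero => simp
  | succ j ih =>
    have ih := ih (by omega)
    obtain ⟨a, rfl⟩ : ∃ a, k = a + j + 1 := ⟨k - (j + 1), by omega⟩
    obtain ⟨m, rfl⟩ : ∃ m, n = m + j + 1 := ⟨n - (j + 1), by omega⟩
    have e1 : m + j + 1 - (j + 1) = m := by omega
    have e2 : a + j + 1 - (j + 1) = a := by omega
    have e3 : m + j + 1 - j = m + 1 := by omega
    have e4 : a + j + 1 - j = a + 1 := by omega
    rw [e1, e2]
    rw [e3, e4] at ih
    have h := Nat.add_one_mul_choose_eq m a
    have hle : (a + 1) * (m + j + 1) ≤ (a + j + 1) * (m + 1) := by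
      have : a * j ≤ j * m := by
        rw [mul_comm]; exact Nat.mul_le_mul_left _ (by omega)
      nlinarith
    refine le_of_mul_le_mul_left (a := m + 1) ?_ (Nat.succ_pos m)
    calc (m + 1) * (m.choose a * (m + j + 1) ^ (j + 1))
        = ((m + 1) * m.choose a) * (m + j + 1) ^ j * (m + j + 1) := by ring
      _ = ((m + 1).choose (a + 1) * (m + j + 1) ^ j) * ((a + 1) * (m + j + 1)) := by
          rw [h]; ring
      _ ≤ ((m + j + 1).choose (a + j + 1) * (a + j + 1) ^ j) * ((a + j + 1) * (m + 1)) :=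
          Nat.mul_le_mul ih hle
      _ = _ := by ring

lemma card_powersetCard_filter_superset_le {n k : ℕ} (hk : k ≤ n) (hn : 0 < n)
    (T : Finset (Fin n)) :
    (((Finset.univ.powersetCard k).filter (fun S => T ⊆ S)).card : ℝ)
      ≤ n.choose k * ((k : ℝ) / n) ^ T.card := by
  rcases lt_or_ge k T.card with h | h
  · have : (Finset.univ.powersetCard k).filter (fun S => T ⊆ S) = ∅ := by
      refine Finset.filter_eq_empty_iff.2 fun S hS hT => ?_
      have := Finset.card_le_card hT
      rw [(Finset.mem_powersetCard.1 hS).2] at this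
      omega
    rw [this]
    simp only [Finset.card_empty, Nat.cast_zero]
    positivity
  · have h1 : ((Finset.univ.powersetCard k).filter (fun S => T ⊆ S)).card
        ≤ (n - T.card).choose (k - T.card) := by
      have : (Tᶜ.powersetCard (k - T.card)).card = (n - T.card).choose (k - T.card) := by
        rw [Finset.card_powersetCard, Finset.card_compl, Fintype.card_fin]
      rw [← this]
      refine Finset.card_le_card_of_injOn (fun S => S \ T) ?_ ?_
      · intro S hS
        simp only [Finset.coe_filter, Finset.mem_powersetCard, Set.mem_ofPred_eq] at hS
        simp only [Finset.mem_coe, Finset.mem_powersetCard]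
        refine ⟨?_, ?_⟩
        · intro v hv
          simpa using (Finset.mem_sdiff.1 hv).2
        · rw [Finset.card_sdiff_of_subset hS.2, hS.1.2]
      · intro S hS S' hS' hSS
        simp only [Finset.coe_filter, Finset.mem_powersetCard, Set.mem_ofPred_eq] at hS hS'
        simp only at hSS
        rw [← Finset.sdiff_union_of_subset hS.2, hSS, Finset.sdiff_union_of_subset hS'.2]
    have h2 := choose_sub_mul_pow_le n k T.card hk h
    have h3 : (((n - T.card).choose (k - T.card) : ℕ) : ℝ) * (n : ℝ) ^ T.card
        ≤ n.choose k * (k : ℝ) ^ T.card := by exact_mod_cast h2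
    have hn' : (0 : ℝ) < (n : ℝ) ^ T.card := by positivity
    rw [div_pow, ← mul_div_assoc, le_div_iff₀ hn']
    refine le_trans ?_ h3
    gcongr

/-- Exponential moment of the hypergeometric distribution, compared with the binomial one. -/
lemma sum_powersetCard_pow_card_inter_le {n k : ℕ} (hk : k ≤ n) (hn : 0 < n)
    (Z : Finset (Fin n)) {b : ℝ} (hb : 0 ≤ b) :
    ∑ S ∈ Finset.univ.powersetCard k, (1 + b) ^ (S ∩ Z).card
      ≤ n.choose k * (1 + b * (k / n)) ^ Z.card := by
  have expand : ∀ (a : ℝ) (A : Finset (Fin n)), (1 + a) ^ A.card = ∑ T ∈ A.powerset, a ^ T.card := by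
    intro a A
    rw [← Finset.prod_const, Finset.prod_one_add]
    simp
  calc ∑ S ∈ Finset.univ.powersetCard k, (1 + b) ^ (S ∩ Z).card
      = ∑ S ∈ Finset.univ.powersetCard k, ∑ T ∈ Z.powerset,
          if T ⊆ S then b ^ T.card else 0 := by
        refine Finset.sum_congr rfl fun S _ => ?_
        rw [expand, ← Finset.sum_filter]
        refine Finset.sum_congr ?_ fun _ _ => rfl
        ext T
        rw [Finset.mem_powerset, Finset.mem_filter, Finset.mem_powerset, Finset.subset_inter_iff,
          and_comm]
    _ = ∑ T ∈ Z.powerset, b ^ T.card *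
          ((Finset.univ.powersetCard k).filter (fun S => T ⊆ S)).card := by
        rw [Finset.sum_comm]
        refine Finset.sum_congr rfl fun T _ => ?_
        rw [← Finset.sum_filter, Finset.sum_const, nsmul_eq_mul, mul_comm]
    _ ≤ ∑ T ∈ Z.powerset, b ^ T.card * (n.choose k * ((k : ℝ) / n) ^ T.card) := by
        refine Finset.sum_le_sum fun T _ => ?_
        have := card_powersetCard_filter_superset_le hk hn T
        gcongr
    _ = _ := by
        rw [expand, Finset.mul_sum]
        refine Finset.sum_congr rfl fun T _ => ?_
        rw [mul_pow]
        ring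

/-- Exponential moment of the number of edges between `X` and `Z`, over all graphs in which every
left vertex has degree `k`. -/
lemma sum_pow_edges_le {n k : ℕ} (hk : k ≤ n) (hn : 0 < n) (X Z : Finset (Fin n)) {b : ℝ}
    (hb : 0 ≤ b) :
    ∑ f ∈ Fintype.piFinset (fun _ : Fin n => Finset.univ.powersetCard k),
        (1 + b) ^ (∑ u ∈ X, (f u ∩ Z).card)
      ≤ (n.choose k : ℝ) ^ n * Real.exp (X.card * (Z.card * (b * (k / n)))) := by
  have hfac : ∀ f : Fin n → Finset (Fin n), (1 + b) ^ (∑ u ∈ X, (f u ∩ Z).card)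
      = ∏ u, if u ∈ X then (1 + b) ^ (f u ∩ Z).card else 1 := by
    intro f
    rw [← Finset.prod_pow_eq_pow_sum, Finset.prod_ite_mem, Finset.univ_inter]
  simp only [hfac]
  have hp := Finset.prod_univ_sum (fun _ : Fin n => Finset.univ.powersetCard k)
    (fun (u : Fin n) (S : Finset (Fin n)) => if u ∈ X then (1 + b) ^ (S ∩ Z).card else 1)
  rw [← hp]
  have hrow : ∀ u : Fin n, ∑ S ∈ Finset.univ.powersetCard k,
        (if u ∈ X then (1 + b) ^ (S ∩ Z).card else 1)
      ≤ n.choose k * if u ∈ X then Real.exp (Z.card * (b * (k / n))) else 1 := by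
    intro u
    split_ifs with hu
    · refine (sum_powersetCard_pow_card_inter_le hk hn Z hb).trans ?_
      rw [Real.exp_nat_mul]
      have := Real.add_one_le_exp (b * ((k : ℝ) / n))
      gcongr
      linarith
    · simp
  refine (Finset.prod_le_prod (fun u _ => ?_) (fun u _ => hrow u)).trans ?_
  · refine Finset.sum_nonneg fun S _ => ?_
    split_ifs <;> positivity
  · rw [Finset.prod_mul_distrib, Finset.prod_ite_mem, Finset.univ_inter, Finset.prod_const,
      Finset.prod_const, Finset.card_univ, Fintype.card_fin, ← Real.exp_nat_mul]

lemma sub_sq_div_two_le_log {b : ℝ} (hb : 0 ≤ b) : b - b ^ 2 / 2 ≤ Real.log (1 + b) := by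
  refine le_trans ?_ (Real.le_log_one_add_of_nonneg hb)
  rw [le_div_iff₀ (by linarith)]
  nlinarith [pow_nonneg hb 3]

/-- Chernoff bound: few `k`-regular graphs have noticeably too few edges between `X` and `Y`. -/
lemma card_filter_edgesBetween_lt_le {n k : ℕ} (hk : k ≤ n) (hn : 0 < n) (X Y : Finset (Fin n))
    {d : ℝ} (hd0 : 0 ≤ d) (hd1 : d ≤ 1) :
    ((Finset.univ.filter (fun E : Finset (Fin n × Fin n) => IsBiRegular E k ∧
        (edgesBetween E X Y : ℝ) < (1 - d) * X.card * Y.card * k / n)).card : ℝ)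
      ≤ (n.choose k : ℝ) ^ n * Real.exp (-(X.card * k * (d * (Y.card / n)) ^ 2 / 2)) := by
  set F := Finset.univ.filter (fun E : Finset (Fin n × Fin n) => IsBiRegular E k ∧
        (edgesBetween E X Y : ℝ) < (1 - d) * X.card * Y.card * k / n) with hF
  have hn' : (0 : ℝ) < n := by exact_mod_cast hn
  have hyn : (Y.card : ℝ) ≤ n := by
    have := Finset.card_le_univ Y
    rw [Fintype.card_fin] at this
    exact_mod_cast this
  set y : ℝ := Y.card / n with hy
  have hy0 : 0 ≤ y := by positivity
  have hy1 : y ≤ 1 := by rw [hy, div_le_one hn']; exact hyn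
  set b : ℝ := d * y with hb
  have hb0 : 0 ≤ b := by positivity
  have hb1 : b ≤ 1 := mul_le_one₀ hd1 hy0 hy1
  set L : ℝ := b - b ^ 2 / 2 with hL
  have hL0 : 0 ≤ L := by nlinarith
  set t : ℝ := X.card * k * (1 - y + d * y) with ht
  have hZ : ((Yᶜ.card : ℕ) : ℝ) = n * (1 - y) := by
    rw [Finset.card_compl, Fintype.card_fin, Nat.cast_sub (by exact_mod_cast hyn), hy]
    field_simp
  have hone : ∀ E ∈ F, 1 ≤ Real.exp (-(t * L)) *
      (1 + b) ^ (∑ u ∈ X, (rightNeighbors E u ∩ Yᶜ).card) := by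
    intro E hE
    rw [hF, Finset.mem_filter] at hE
    obtain ⟨-, hreg, hlt⟩ := hE
    have hsum : ((edgesBetween E X Y : ℕ) : ℝ) + edgesBetween E X Yᶜ = X.card * k := by
      exact_mod_cast edgesBetween_add_compl hreg X Y
    have hlt' : (edgesBetween E X Y : ℝ) < (1 - d) * X.card * y * k := by
      refine hlt.trans_eq ?_
      rw [hy]; ring
    rw [← edgesBetween_eq_sum]
    have hm : t ≤ (edgesBetween E X Yᶜ : ℝ) := by rw [ht]; nlinarith
    have hpow : (1 + b) ^ (edgesBetween E X Yᶜ)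
        = Real.exp (edgesBetween E X Yᶜ * Real.log (1 + b)) := by
      rw [Real.exp_nat_mul, Real.exp_log (by linarith)]
    rw [hpow, ← Real.exp_add, Real.one_le_exp_iff]
    have := mul_le_mul hm (sub_sq_div_two_le_log hb0) hL0 (by positivity)
    rw [← hL] at this
    linarith
  have hcard : (F.card : ℝ) ≤ ∑ E ∈ F, Real.exp (-(t * L)) *
      (1 + b) ^ (∑ u ∈ X, (rightNeighbors E u ∩ Yᶜ).card) := by
    have := Finset.sum_le_sum hone
    simpa using this
  have himage : ∑ E ∈ F, (1 + b) ^ (∑ u ∈ X, (rightNeighbors E u ∩ Yᶜ).card)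
      ≤ ∑ f ∈ Fintype.piFinset (fun _ : Fin n => Finset.univ.powersetCard k),
        (1 + b) ^ (∑ u ∈ X, (f u ∩ Yᶜ).card) := by
    rw [← Finset.sum_image (s := F) (g := rightNeighbors)
      (f := fun f : Fin n → Finset (Fin n) => (1 + b) ^ (∑ u ∈ X, (f u ∩ Yᶜ).card))
      (rightNeighbors_injective.injOn)]
    refine Finset.sum_le_sum_of_subset_of_nonneg ?_ fun f _ _ => by positivity
    intro f hf
    obtain ⟨E, hE, rfl⟩ := Finset.mem_image.1 hf
    rw [hF, Finset.mem_filter] at hE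
    refine Fintype.mem_piFinset.2 fun u => Finset.mem_powersetCard.2 ⟨Finset.subset_univ _, ?_⟩
    rw [card_rightNeighbors]
    exact hE.2.1.1 u
  rw [← Finset.mul_sum] at hcard
  have hall := hcard.trans (mul_le_mul_of_nonneg_left
    (himage.trans (sum_pow_edges_le hk hn X Yᶜ hb0)) (Real.exp_nonneg _))
  refine hall.trans ?_
  rw [mul_left_comm, ← Real.exp_add]
  refine mul_le_mul_of_nonneg_left (Real.exp_le_exp.2 ?_) (by positivity)
  have hxk : (0 : ℝ) ≤ X.card * k := by positivity
  have hexp : (X.card : ℝ) * ((Yᶜ.card : ℕ) * (b * (k / n))) = X.card * k * ((1 - y) * b) := by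
    rw [hZ]
    field_simp
  rw [hexp, ht]
  have hkey : (1 - y) * b - (1 - y + d * y) * L ≤ -(b ^ 2 / 2) := by
    have h1 : 1 - y + b ≤ 1 := by
      have := mul_le_of_le_one_left hy0 hd1
      linarith
    have h2 := mul_le_mul_of_nonneg_right h1 (by positivity : 0 ≤ b ^ 2 / 2)
    rw [← hb, hL]
    nlinarith
  have := mul_le_mul_of_nonneg_left hkey hxk
  linarith

/-- For fixed `ε > 0` there are `c > 0` and `N` such that for all `n ≥ N`, all
`εn ≤ k ≤ n` and all `1/n ≤ δ ≤ 1`, the number of `k`-regular bipartite graphs with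
parts of size `n` that are not `δ^{1/3}`-pseudorandom is at most
`(n choose k)^n · exp(−c·δ^{2/3}·n²)`. -/
theorem stmt9 (ε : ℝ) (hε : 0 < ε) :
    ∃ c > (0 : ℝ), ∃ N : ℕ, ∀ n ≥ N, ∀ k : ℕ, ε * n ≤ (k : ℝ) → k ≤ n →
      ∀ δ : ℝ, 1 / (n : ℝ) ≤ δ → δ ≤ 1 →
        ((Finset.univ.filter (fun E : Finset (Fin n × Fin n) =>
            IsBiRegular E k ∧ ¬ Pseudorandom ε E k (δ ^ ((1 : ℝ) / 3)))).card : ℝ)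
          ≤ (n.choose k : ℝ) ^ n * Real.exp (-c * δ ^ ((2 : ℝ) / 3) * (n : ℝ) ^ 2) := by
  set c : ℝ := ε ^ 4 / 4000 with hc
  have hc0 : 0 < c := by positivity
  refine ⟨c, hc0, max 1 ⌈(2 / c) ^ 3⌉₊, ?_⟩
  intro n hn k hεk hk δ hδ hδ1
  have hnpos : 0 < n := lt_of_lt_of_le one_pos ((le_max_left _ _).trans hn)
  have hn' : (0 : ℝ) < n := by exact_mod_cast hnpos
  have hnc : (2 / c) ^ 3 ≤ (n : ℝ) :=
    (Nat.le_ceil _).trans (by exact_mod_cast (le_max_right _ _).trans hn)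
  have hδ0 : 0 < δ := lt_of_lt_of_le (by positivity) hδ
  set d : ℝ := δ ^ ((1 : ℝ) / 3) with hd
  have hd0 : 0 < d := Real.rpow_pos_of_pos hδ0 _
  have hd1 : d ≤ 1 := Real.rpow_le_one hδ0.le hδ1 (by norm_num)
  have hd2 : δ ^ ((2 : ℝ) / 3) = d ^ 2 := by
    rw [hd, ← Real.rpow_natCast, ← Real.rpow_mul hδ0.le]
    norm_num
  have hd3 : d ^ 3 = δ := by
    rw [hd, ← Real.rpow_natCast, ← Real.rpow_mul hδ0.le]
    norm_num
  have hcd : 2 ≤ c * d ^ 2 * n := by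
    refine le_of_pow_le_pow_left₀ (n := 3) (by norm_num) (by positivity) ?_
    have h1 : 1 ≤ d ^ 3 * n := by
      rw [hd3]
      exact (div_le_iff₀ hn').1 hδ
    have h2 : 2 ^ 3 ≤ n * c ^ 3 := by
      rw [div_pow] at hnc
      exact (div_le_iff₀ (by positivity)).1 hnc
    have h3 : 1 ≤ (d ^ 3 * n) ^ 2 := one_le_pow₀ h1
    calc (2 : ℝ) ^ 3 ≤ n * c ^ 3 := h2
      _ ≤ n * c ^ 3 * (d ^ 3 * n) ^ 2 := le_mul_of_one_le_right (by positivity) h3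
      _ = (c * d ^ 2 * n) ^ 3 := by ring
  rw [hd2]
  set P : Finset (Finset (Fin n) × Finset (Fin n)) := Finset.univ.filter
    (fun p => (ε / 10) * n ≤ (p.1.card : ℝ) ∧ (ε / 10) * n ≤ (p.2.card : ℝ)) with hP
  set B : Finset (Fin n) × Finset (Fin n) → Finset (Finset (Fin n × Fin n)) := fun p =>
    Finset.univ.filter (fun E : Finset (Fin n × Fin n) => IsBiRegular E k ∧
      (edgesBetween E p.1 p.2 : ℝ) < (1 - d) * p.1.card * p.2.card * k / n) with hB
  have hsub : Finset.univ.filter (fun E : Finset (Fin n × Fin n) =>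
      IsBiRegular E k ∧ ¬ Pseudorandom ε E k d) ⊆ P.biUnion B := by
    intro E hE
    rw [Finset.mem_filter] at hE
    obtain ⟨-, hreg, hnot⟩ := hE
    unfold Pseudorandom at hnot
    push Not at hnot
    obtain ⟨X, Y, hX, hY, hlt⟩ := hnot
    refine Finset.mem_biUnion.2 ⟨(X, Y), ?_, ?_⟩
    · exact Finset.mem_filter.2 ⟨Finset.mem_univ _, hX, hY⟩
    · exact Finset.mem_filter.2 ⟨Finset.mem_univ _, hreg, hlt⟩
  have hbound : ∀ p ∈ P, ((B p).card : ℝ)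
      ≤ (n.choose k : ℝ) ^ n * Real.exp (-(2 * c * d ^ 2 * (n : ℝ) ^ 2)) := by
    rintro ⟨X, Y⟩ hp
    obtain ⟨-, hX, hY⟩ := Finset.mem_filter.1 hp
    simp only at hX hY
    refine (card_filter_edgesBetween_lt_le hk hnpos X Y hd0.le hd1).trans ?_
    refine mul_le_mul_of_nonneg_left (Real.exp_le_exp.2 ?_) (by positivity)
    have hy : ε / 10 ≤ (Y.card : ℝ) / n := (le_div_iff₀ hn').2 hY
    have h1 : ε / 10 * n * (ε * n) * (d * (ε / 10)) ^ 2
        ≤ X.card * k * (d * ((Y.card : ℝ) / n)) ^ 2 := by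
      gcongr
    have h2 : 2 * c * d ^ 2 * (n : ℝ) ^ 2
        = ε / 10 * n * (ε * n) * (d * (ε / 10)) ^ 2 / 2 := by
      rw [hc]; ring
    linarith
  have hPcard : (P.card : ℝ) ≤ Real.exp (c * d ^ 2 * (n : ℝ) ^ 2) := by
    have h1 : P.card ≤ 4 ^ n := by
      refine (Finset.card_le_univ P).trans_eq ?_
      rw [Fintype.card_prod, Fintype.card_finset, Fintype.card_fin, ← mul_pow]
      norm_num
    have h2 : (4 : ℝ) ≤ Real.exp 2 := by
      have h3 := Real.add_one_le_exp (1 : ℝ)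
      have h4 : Real.exp 2 = Real.exp 1 * Real.exp 1 := by rw [← Real.exp_add]; norm_num
      nlinarith
    calc (P.card : ℝ) ≤ (4 : ℝ) ^ n := by exact_mod_cast h1
      _ ≤ Real.exp 2 ^ n := by gcongr
      _ = Real.exp (n * 2) := (Real.exp_nat_mul _ _).symm
      _ ≤ Real.exp (c * d ^ 2 * (n : ℝ) ^ 2) := by
          refine Real.exp_le_exp.2 ?_
          nlinarith
  calc ((Finset.univ.filter (fun E : Finset (Fin n × Fin n) =>
        IsBiRegular E k ∧ ¬ Pseudorandom ε E k d)).card : ℝ)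
      ≤ ∑ p ∈ P, ((B p).card : ℝ) := by
        exact_mod_cast (Finset.card_le_card hsub).trans Finset.card_biUnion_le
    _ ≤ P.card * ((n.choose k : ℝ) ^ n * Real.exp (-(2 * c * d ^ 2 * (n : ℝ) ^ 2))) := by
        rw [← nsmul_eq_mul]
        exact Finset.sum_le_card_nsmul _ _ _ hbound
    _ ≤ Real.exp (c * d ^ 2 * (n : ℝ) ^ 2) *
          ((n.choose k : ℝ) ^ n * Real.exp (-(2 * c * d ^ 2 * (n : ℝ) ^ 2))) := by
        gcongr
    _ = (n.choose k : ℝ) ^ n * Real.exp (-c * d ^ 2 * (n : ℝ) ^ 2) := by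
        rw [mul_left_comm, ← Real.exp_add]
        ring_nf

end
end

section
/- In the matching algorithm described in the context, for each 1 ≤ i ≤ m the following holds: conditioned on the event that for every j < i the graph H_j has at least L(j)^n·n!/n^n perfect matchings, the probability that G_i is not δ^{1/3}-pseudorandom is at most exp(−cn) for some constant c > 0 (depending only on ε) and all sufficiently large n. -/
attribute [local instance] Classical.propDecidable

noncomputable section

/-- A fixed enumeration of the permutations of `Fin n`. -/
def permEquiv (n : ℕ) : Equiv.Perm (Fin n) ≃ Fin (Nat.factorial n) :=
  Fintype.equivFinOfCardEq (by simp [Fintype.card_perm, Fintype.card_fin])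

/-- The perfect matchings of the bipartite graph with edge set `H`. -/
def matchings {n : ℕ} (H : Finset (Fin n × Fin n)) : Finset (Equiv.Perm (Fin n)) :=
  Finset.univ.filter (fun σ => ∀ x, (x, σ x) ∈ H)

/-- Given a uniformly random permutation `r` of `Fin n!`, the element of the nonempty set
`S` of matchings whose `r`-key is minimal; this is a uniformly random element of `S`. -/
def chooseMatching {n : ℕ} (r : Equiv.Perm (Fin (Nat.factorial n)))
    (S : Finset (Equiv.Perm (Fin n))) (h : S.Nonempty) : Equiv.Perm (Fin n) :=
  (permEquiv n).symm (r.symm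
    ((S.image (fun σ => r (permEquiv n σ))).min' (h.image _)))

/-- The sequence of graphs `G_1, G_2, …` produced by the matching algorithm:
`G_1 = K_{n,n}`; at step `i`, `H_i` consists of the edges `(r,c)` of `G_i` with
`M i r c = 1`, a perfect matching of `H_i` is chosen uniformly at random (via the random
permutation `ρ i`) and removed. `algGraph M ρ i` is the paper's `G_{i+1}`. -/
def algGraph {n : ℕ} (M : ℕ → Fin n → Fin n → Bool)
    (ρ : ℕ → Equiv.Perm (Fin (Nat.factorial n))) : ℕ → Finset (Fin n × Fin n)
  | 0 => Finset.univ
  | (i + 1) =>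
    let G := algGraph M ρ i
    let S := matchings (G.filter (fun x => M i x.1 x.2 = true))
    if h : S.Nonempty then
      G.filter (fun x => (chooseMatching (ρ i) S h) x.1 ≠ x.2)
    else G

/-- Extend `M : Fin m → _` to `ℕ → _` (all-zero layers beyond `m`). -/
def extM (n m : ℕ) (M : Fin m → Fin n → Fin n → Bool) : ℕ → Fin n → Fin n → Bool :=
  fun i => if h : i < m then M ⟨i, h⟩ else fun _ _ => false

/-- Extend `ρ : Fin m → _` to `ℕ → _` (identity beyond `m`). -/
def extρ (n m : ℕ) (ρ : Fin m → Equiv.Perm (Fin (Nat.factorial n))) :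
    ℕ → Equiv.Perm (Fin (Nat.factorial n)) :=
  fun i => if h : i < m then ρ ⟨i, h⟩ else 1

/-- The graph `G_{j+1}` of the algorithm run on randomness `(M, ρ)`. -/
def stepG (n m : ℕ) (M : Fin m → Fin n → Fin n → Bool)
    (ρ : Fin m → Equiv.Perm (Fin (Nat.factorial n))) (j : ℕ) : Finset (Fin n × Fin n) :=
  algGraph (extM n m M) (extρ n m ρ) j

/-- The random subgraph `H_{j+1}` of `G_{j+1}` of the algorithm run on `(M, ρ)`. -/
def stepH (n m : ℕ) (M : Fin m → Fin n → Fin n → Bool)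
    (ρ : Fin m → Equiv.Perm (Fin (Nat.factorial n))) (j : ℕ) : Finset (Fin n × Fin n) :=
  (stepG n m M ρ j).filter (fun x => extM n m M j x.1 x.2 = true)

/-- Probability, over the algorithm's randomness (the array `M`, whose entries are
independently `1` with probability `p`, and the independent uniformly random permutations
`ρ` used for the uniform choices of matchings), of the event `P`. -/
def algProb (n m : ℕ) (p : ℝ)
    (P : (Fin m → Fin n → Fin n → Bool) →
      (Fin m → Equiv.Perm (Fin (Nat.factorial n))) → Prop) : ℝ :=
  ∑ M : Fin m → Fin n → Fin n → Bool,
    ∑ ρ : Fin m → Equiv.Perm (Fin (Nat.factorial n)),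
      if P M ρ then
        (∏ i, ∏ r, ∏ c, if M i r c = true then p else 1 - p)
          * (1 / (Fintype.card (Fin m → Equiv.Perm (Fin (Nat.factorial n))) : ℝ))
      else 0

/-- The event that for every `j < i` (0-indexed; the paper's `j + 1 < i + 1`), the graph
`H_{j+1}` has at least `L(j+1)^n·n!/n^n` perfect matchings, where
`L(j+1) = (1−δ)(n−j)p`. -/
def NoAbortBefore (n m : ℕ) (p δ : ℝ) (i : ℕ)
    (M : Fin m → Fin n → Fin n → Bool)
    (ρ : Fin m → Equiv.Perm (Fin (Nat.factorial n))) : Prop :=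
  ∀ j < i, ((1 - δ) * ((n - j : ℕ) : ℝ) * p) ^ n * (Nat.factorial n : ℝ) / (n : ℝ) ^ n
    ≤ ((matchings (stepH n m M ρ j)).card : ℝ)

theorem eval_smul_of_isHomogeneous {n d : ℕ} {p : MvPolynomial (Fin n) ℂ} (hp : p.IsHomogeneous d)
    (l : ℂ) (z : Fin n → ℂ) :
    MvPolynomial.eval (fun i => l * z i) p = l ^ d * MvPolynomial.eval z p := by
  rw [MvPolynomial.eval_eq, MvPolynomial.eval_eq, Finset.mul_sum]
  refine Finset.sum_congr rfl fun e he => ?_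
  have h1 : e.degree = d := by
    have := hp (MvPolynomial.mem_support_iff.mp he)
    rwa [Finsupp.degree_eq_weight_one]
  have h2 : ∏ i ∈ e.support, l ^ e i = l ^ d := by
    rw [Finset.prod_pow_eq_pow_sum, ← h1, Finsupp.degree]; rfl
  simp only [mul_pow, Finset.prod_mul_distrib, h2]
  ring

theorem coeff_one_eq_sum_roots {f : Polynomial ℂ} (h0 : f.eval 0 ≠ 0) :
    f.coeff 1 = f.coeff 0 * (f.roots.map fun r => -r⁻¹).sum := by
  have h := (IsAlgClosed.splits f).eval_derivative_div_eval_of_ne_zero h0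
  have h1 : f.derivative.eval 0 = f.coeff 1 := by
    rw [← Polynomial.coeff_zero_eq_eval_zero, Polynomial.coeff_derivative]; simp
  rw [h1, ← Polynomial.coeff_zero_eq_eval_zero] at h
  rw [← Polynomial.coeff_zero_eq_eval_zero] at h0
  rw [div_eq_iff h0] at h
  rw [h, mul_comm]
  congr 2
  refine Multiset.map_congr rfl fun r _ => ?_
  simp [inv_neg]

theorem coeff_one_ne_zero_of_roots_re_neg {f : Polynomial ℂ} (h0 : f.eval 0 ≠ 0)
    (hr : ∀ r, f.eval r = 0 → r.re < 0) (hd : f.natDegree ≠ 0) : f.coeff 1 ≠ 0 := by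
  rw [coeff_one_eq_sum_roots h0]
  refine mul_ne_zero (by rwa [Polynomial.coeff_zero_eq_eval_zero]) ?_
  have hf : f ≠ 0 := by rintro rfl; simp at h0
  have key : ∀ s : Multiset ℂ, (∀ r ∈ s, r.re < 0) → s ≠ 0 → 0 < (s.map fun r => -r⁻¹).sum.re := by
    intro s
    induction s using Multiset.induction with
    | empty => simp
    | cons a s ih =>
      intro h _
      have ha : 0 < (-a⁻¹).re := by
        have : a.re < 0 := h a (Multiset.mem_cons_self a s)
        have ha0 : a ≠ 0 := by rintro rfl; simp at this
        rw [Complex.neg_re, Complex.inv_re, neg_pos]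
        exact div_neg_of_neg_of_pos this (Complex.normSq_pos.mpr ha0)
      rw [Multiset.map_cons, Multiset.sum_cons, Complex.add_re]
      by_cases hs : s = 0
      · subst hs; simpa using ha
      · have := ih (fun r hr => h r (Multiset.mem_cons_of_mem hr)) hs
        linarith
  have hroots : f.roots ≠ 0 := by
    intro h
    have := (IsAlgClosed.splits f).natDegree_eq_card_roots
    rw [h] at this
    simp at this
    exact hd this
  have := key f.roots (fun r h => hr r ((Polynomial.mem_roots hf).mp h)) hroots
  intro h
  rw [h] at this
  simp at this

theorem norm_eval_le_of_roots_neg {f : Polynomial ℂ} (h0 : f.eval 0 ≠ 0)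
    (hr : ∀ r, f.eval r = 0 → r.re < 0 ∧ r.im = 0) (t : ℝ) (ht : 0 ≤ t) :
    ‖f.eval (t : ℂ)‖ ≤ ‖f.coeff 0‖ * Real.exp (t * (‖f.coeff 1‖ / ‖f.coeff 0‖)) := by
  have hf : f ≠ 0 := by rintro rfl; simp at h0
  have key : ∀ s : Multiset ℂ, (∀ r ∈ s, r.re < 0 ∧ r.im = 0) →
      ‖(s.map fun r => (t : ℂ) - r).prod‖ ≤ ‖(s.map fun r => -r).prod‖ *
        Real.exp (t * ‖(s.map fun r => -r⁻¹).sum‖) ∧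
      ((s.map fun r => -r⁻¹).sum.im = 0 ∧ 0 ≤ (s.map fun r => -r⁻¹).sum.re) := by
    intro s
    induction s using Multiset.induction with
    | empty => simp
    | cons a s ih =>
      intro h
      obtain ⟨h1, h2, h3⟩ := ih fun r hr => h r (Multiset.mem_cons_of_mem hr)
      obtain ⟨a1, a2⟩ := h a (Multiset.mem_cons_self a s)
      obtain ⟨b, rfl⟩ : ∃ b : ℝ, a = b := ⟨a.re, Complex.ext rfl (by simp [a2])⟩
      simp only [Complex.ofReal_re] at a1
      obtain ⟨S, hS⟩ : ∃ S : ℝ, (s.map fun r => -r⁻¹).sum = S :=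
        ⟨(s.map fun r => -r⁻¹).sum.re, Complex.ext rfl (by rw [h2, Complex.ofReal_im])⟩
      simp only [Multiset.map_cons, Multiset.sum_cons, Multiset.prod_cons, norm_mul]
      rw [hS] at h1 h3 ⊢
      simp only [Complex.ofReal_re] at h3
      have e1 : -(b : ℂ)⁻¹ + S = ((-b⁻¹ + S : ℝ) : ℂ) := by push_cast; ring
      have hb : 0 < -b⁻¹ := by rw [neg_pos]; exact inv_lt_zero.mpr a1
      rw [e1]
      refine ⟨?_, Complex.ofReal_im _, by simp only [Complex.ofReal_re]; linarith⟩
      rw [Complex.norm_real, Real.norm_of_nonneg h3] at h1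
      rw [Complex.norm_real, Real.norm_of_nonneg (by linarith)]
      have e2 : ‖(t : ℂ) - b‖ ≤ ‖-(b : ℂ)‖ * Real.exp (t * -b⁻¹) := by
        rw [← Complex.ofReal_sub, ← Complex.ofReal_neg, Complex.norm_real, Complex.norm_real,
          Real.norm_of_nonneg (by linarith), Real.norm_of_nonneg (by linarith)]
        have := Real.add_one_le_exp (t * -b⁻¹)
        have hb' := mul_inv_cancel₀ a1.ne
        calc t - b = -b * (t * -b⁻¹ + 1) := by linear_combination (-t) * hb'
          _ ≤ _ := mul_le_mul_of_nonneg_left this (by linarith)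
      calc _ ≤ (‖-(b : ℂ)‖ * Real.exp (t * -b⁻¹)) *
            (‖(s.map fun r => -r).prod‖ * Real.exp (t * S)) :=
            mul_le_mul e2 h1 (norm_nonneg _) (by positivity)
        _ = _ := by rw [mul_add, Real.exp_add]; ring
  have hs := (key f.roots (fun r h => hr r ((Polynomial.mem_roots hf).mp h))).1
  have hev : ∀ z : ℂ, f.eval z = f.leadingCoeff * (f.roots.map fun r => z - r).prod := by
    intro z
    exact (IsAlgClosed.splits f).eval_eq_prod_roots z
  have e0 := hev 0
  simp only [zero_sub] at e0
  rw [coeff_one_eq_sum_roots h0, norm_mul, mul_div_cancel_left₀ _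
    (by rw [Polynomial.coeff_zero_eq_eval_zero]; simpa using h0),
    Polynomial.coeff_zero_eq_eval_zero, hev, e0, norm_mul, norm_mul, mul_assoc]
  exact mul_le_mul_of_nonneg_left hs (norm_nonneg _)

/-- Non-vanishing at all points whose coordinates have nonnegative real parts, not all zero. -/
def StronglyStable {n : ℕ} (p : MvPolynomial (Fin n) ℂ) : Prop :=
  ∀ z : Fin n → ℂ, (∀ i, 0 ≤ (z i).re) → (∃ i, 0 < (z i).re) → MvPolynomial.eval z p ≠ 0

/-- The univariate restriction of a multivariate polynomial to its first variable. -/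
def firstVar {n : ℕ} (p : MvPolynomial (Fin (n + 1)) ℂ) (z : Fin n → ℂ) : Polynomial ℂ :=
  (MvPolynomial.finSuccEquiv ℂ n p).map (MvPolynomial.eval z)

theorem firstVar_eval {n : ℕ} (p : MvPolynomial (Fin (n + 1)) ℂ) (z : Fin n → ℂ) (t : ℂ) :
    (firstVar p z).eval t = MvPolynomial.eval (Fin.cons t z) p :=
  (MvPolynomial.eval_eq_eval_mv_eval' z t p).symm

theorem firstVar_coeff {n : ℕ} (p : MvPolynomial (Fin (n + 1)) ℂ) (z : Fin n → ℂ) (i : ℕ) :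
    (firstVar p z).coeff i = MvPolynomial.eval z ((MvPolynomial.finSuccEquiv ℂ n p).coeff i) := by
  simp [firstVar]

theorem cons_mul {n : ℕ} (l t : ℂ) (z : Fin n → ℂ) :
    (fun i => l * (Fin.cons t z : Fin (n + 1) → ℂ) i) = Fin.cons (l * t) (fun i => l * z i) := by
  funext i
  refine Fin.cases ?_ (fun j => ?_) i <;> simp

theorem firstVar_natDegree_ne_zero {n d : ℕ} {p : MvPolynomial (Fin (n + 1)) ℂ}
    (hp : p.IsHomogeneous (d + 1)) (hs : StronglyStable p) {z : Fin n → ℂ} :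
    (firstVar p z).natDegree ≠ 0 := by
  intro h
  obtain ⟨c, hc⟩ := Polynomial.natDegree_eq_zero.mp h
  have h1 : ∀ t : ℂ, MvPolynomial.eval (Fin.cons t z) p = c := by
    intro t
    rw [← firstVar_eval, ← hc, Polynomial.eval_C]
  have h2 : ∀ s : ℂ, s ≠ 0 → MvPolynomial.eval (Fin.cons 1 (fun i => s * z i)) p
      = s ^ (d + 1) * c := by
    intro s hs0
    rw [← h1 s⁻¹, ← eval_smul_of_isHomogeneous hp, cons_mul, mul_inv_cancel₀ hs0]
  have hcont : Continuous fun s : ℂ =>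
      MvPolynomial.eval (Fin.cons 1 (fun i => s * z i) : Fin (n + 1) → ℂ) p := by
    refine (MvPolynomial.continuous_eval p).comp ?_
    refine continuous_pi fun i => ?_
    refine Fin.cases ?_ (fun j => ?_) i
    · simpa using continuous_const
    · simp only [Fin.cons_succ]; fun_prop
  have hcont2 : Continuous fun s : ℂ => s ^ (d + 1) * c := by fun_prop
  have h3 := Continuous.ext_on (dense_compl_singleton (0 : ℂ)) hcont hcont2
    (fun s hs0 => h2 s hs0)
  have h4 := congrFun h3 0
  simp only [zero_mul, ne_eq, Nat.add_eq_zero_iff, one_ne_zero, and_false, not_false_eq_true,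
    zero_pow] at h4
  refine hs _ ?_ ⟨0, ?_⟩ h4
  · intro i
    refine Fin.cases ?_ (fun j => ?_) i <;> simp
  · simp

theorem firstVar_eval_ne_zero {n : ℕ} {p : MvPolynomial (Fin (n + 1)) ℂ}
    (hs : StronglyStable p) {z : Fin n → ℂ} (hz : ∀ i, 0 ≤ (z i).re) (hz' : ∃ i, 0 < (z i).re)
    {t : ℂ} (ht : 0 ≤ t.re) : (firstVar p z).eval t ≠ 0 := by
  rw [firstVar_eval]
  obtain ⟨i, hi⟩ := hz'
  refine hs _ (fun j => ?_) ⟨i.succ, by simpa using hi⟩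
  refine Fin.cases ?_ (fun k => ?_) j
  · simpa using ht
  · simpa using hz k

theorem stronglyStable_coeff_one {n d : ℕ} {p : MvPolynomial (Fin (n + 1)) ℂ}
    (hp : p.IsHomogeneous (d + 1)) (hs : StronglyStable p) :
    StronglyStable ((MvPolynomial.finSuccEquiv ℂ n p).coeff 1) := by
  intro z hz hz'
  rw [← firstVar_coeff]
  refine coeff_one_ne_zero_of_roots_re_neg (firstVar_eval_ne_zero hs hz hz' (by simp)) ?_
    (firstVar_natDegree_ne_zero hp hs)
  intro r hr
  by_contra h
  exact firstVar_eval_ne_zero hs hz hz' (not_lt.mp h) hr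

theorem le_norm_coeff_one {n d : ℕ} {p : MvPolynomial (Fin (n + 2)) ℂ} {C : ℝ}
    (hp : p.IsHomogeneous (d + 1)) (hs : StronglyStable p)
    (hC : ∀ x : Fin (n + 2) → ℝ, (∀ i, 0 < x i) →
      C * ∏ i, x i ≤ ‖MvPolynomial.eval (fun i => (x i : ℂ)) p‖)
    (x : Fin (n + 1) → ℝ) (hx : ∀ i, 0 < x i) :
    C * Real.exp (-1) * ∏ i, x i ≤
      ‖MvPolynomial.eval (fun i => (x i : ℂ))
        ((MvPolynomial.finSuccEquiv ℂ (n + 1) p).coeff 1)‖ := by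
  set z : Fin (n + 1) → ℂ := fun i => (x i : ℂ) with hzdef
  have hz : ∀ i, 0 ≤ (z i).re := fun i => by simpa [hzdef] using (hx i).le
  have hz' : ∃ i, 0 < (z i).re := ⟨0, by simpa [hzdef] using hx 0⟩
  have h0 : (firstVar p z).eval 0 ≠ 0 := firstVar_eval_ne_zero hs hz hz' (by simp)
  have hroot : ∀ r, (firstVar p z).eval r = 0 → r.re < 0 ∧ r.im = 0 := by
    intro r hr
    have h1 : r.re < 0 := by
      by_contra h
      exact firstVar_eval_ne_zero hs hz hz' (not_lt.mp h) hr
    refine ⟨h1, ?_⟩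
    by_contra him
    set l : ℂ := ⟨1, r.re / r.im⟩ with hl
    have h2 : MvPolynomial.eval (Fin.cons (l * r) (fun i => l * z i)) p = 0 := by
      rw [← cons_mul, eval_smul_of_isHomogeneous hp, ← firstVar_eval, hr, mul_zero]
    have hlz : ∀ i, (l * z i).re = x i := fun i => by simp [hl, hzdef]
    refine hs _ (fun j => ?_) ⟨Fin.succ 0, ?_⟩ h2
    · refine Fin.cases ?_ (fun k => ?_) j
      · simp only [Fin.cons_zero, Complex.mul_re, hl]
        field_simp
        simp
      · rw [Fin.cons_succ, hlz]; exact (hx k).le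
    · rw [Fin.cons_succ, hlz]; exact hx 0
  rw [← firstVar_coeff]
  have hc1 : (firstVar p z).coeff 1 ≠ 0 :=
    coeff_one_ne_zero_of_roots_re_neg h0 (fun r hr => (hroot r hr).1)
      (firstVar_natDegree_ne_zero hp hs)
  have hc0 : (firstVar p z).coeff 0 ≠ 0 := by rwa [Polynomial.coeff_zero_eq_eval_zero]
  have n1 := norm_pos_iff.mpr hc1
  have n0 := norm_pos_iff.mpr hc0
  set t : ℝ := ‖(firstVar p z).coeff 0‖ / ‖(firstVar p z).coeff 1‖ with ht
  have htpos : 0 < t := div_pos n0 n1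
  have hub := norm_eval_le_of_roots_neg h0 hroot t htpos.le
  have e1 : t * (‖(firstVar p z).coeff 1‖ / ‖(firstVar p z).coeff 0‖) = 1 := by
    rw [ht]; field_simp
  rw [e1, firstVar_eval] at hub
  have hlb := hC (Fin.cons t x) (fun j => by
    refine Fin.cases ?_ (fun k => ?_) j
    · simpa using htpos
    · simpa using hx k)
  have e2 : (fun i => ((Fin.cons t x : Fin (n + 2) → ℝ) i : ℂ)) = Fin.cons (t : ℂ) z := by
    funext i
    refine Fin.cases ?_ (fun j => ?_) i <;> simp [hzdef]
  rw [e2, Fin.prod_univ_succ] at hlb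
  simp only [Fin.cons_zero, Fin.cons_succ] at hlb
  have h3 := hlb.trans hub
  have e3 : ‖(firstVar p z).coeff 0‖ = t * ‖(firstVar p z).coeff 1‖ := by
    rw [ht]; field_simp
  rw [e3] at h3
  have h4 : C * ∏ i, x i ≤ ‖(firstVar p z).coeff 1‖ * Real.exp 1 := by
    refine le_of_mul_le_mul_left ?_ htpos
    linarith
  rw [Real.exp_neg, mul_right_comm, ← div_eq_mul_inv, div_le_iff₀ (Real.exp_pos 1)]
  exact h4

theorem le_norm_coeff_ones {n : ℕ} {p : MvPolynomial (Fin (n + 1)) ℂ} {C : ℝ}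
    (hp : p.IsHomogeneous (n + 1)) (hs : StronglyStable p)
    (hC : ∀ x : Fin (n + 1) → ℝ, (∀ i, 0 < x i) →
      C * ∏ i, x i ≤ ‖MvPolynomial.eval (fun i => (x i : ℂ)) p‖) :
    C * Real.exp (-n) ≤ ‖p.coeff (Finsupp.equivFunOnFinite.symm fun _ => 1)‖ := by
  induction n generalizing C with
  | zero =>
    have h1 := hC (fun _ => 1) (fun _ => one_pos)
    have h2 : MvPolynomial.eval (fun i : Fin 1 => (1 : ℂ)) p
        = p.coeff (Finsupp.equivFunOnFinite.symm fun _ => 1) := by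
      rw [MvPolynomial.eval_eq]
      simp only [one_pow, Finset.prod_const_one, mul_one]
      rw [Finset.sum_eq_single (Finsupp.equivFunOnFinite.symm fun _ => 1)]
      · intro b hb hne
        exfalso
        apply hne
        have := hp (MvPolynomial.mem_support_iff.mp hb)
        have hd : b.degree = 1 := by
          rw [Finsupp.degree_eq_weight_one]
          exact this
        rw [Finsupp.degree_eq_sum] at hd
        ext
        simpa using hd
      · intro h
        simpa using h
    simpa [h2] using h1
  | succ n ih =>
    have h1 := ih (p := (MvPolynomial.finSuccEquiv ℂ (n + 1) p).coeff 1) (C := C * Real.exp (-1))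
      (hp.finSuccEquiv_coeff_isHomogeneous 1 (n + 1) (by ring)) (stronglyStable_coeff_one hp hs)
      (le_norm_coeff_one hp hs hC)
    rw [MvPolynomial.finSuccEquiv_coeff_coeff] at h1
    have e : (Finsupp.equivFunOnFinite.symm fun _ => 1 : Fin (n + 1) →₀ ℕ).cons 1
        = (Finsupp.equivFunOnFinite.symm fun _ => 1 : Fin (n + 2) →₀ ℕ) := by
      ext i
      refine Fin.cases ?_ (fun j => ?_) i <;> simp
    rw [e, mul_assoc, ← Real.exp_add] at h1
    convert h1 using 3
    push_cast; ring

/-- The product of the linear forms given by the rows of a matrix. -/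
def rowProduct {n : ℕ} (A : Fin n → Fin n → ℝ) : MvPolynomial (Fin n) ℂ :=
  ∏ i, ∑ j, MvPolynomial.C (A i j : ℂ) * MvPolynomial.X j

theorem eval_rowProduct {n : ℕ} (A : Fin n → Fin n → ℝ) (z : Fin n → ℂ) :
    MvPolynomial.eval z (rowProduct A) = ∏ i, ∑ j, (A i j : ℂ) * z j := by
  simp [rowProduct]

theorem isHomogeneous_rowProduct {n : ℕ} (A : Fin n → Fin n → ℝ) :
    (rowProduct A).IsHomogeneous n := by
  have h := MvPolynomial.IsHomogeneous.prod (Finset.univ : Finset (Fin n))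
    (fun i => ∑ j, MvPolynomial.C (A i j : ℂ) * MvPolynomial.X j) (fun _ => 1) (fun i _ =>
      MvPolynomial.IsHomogeneous.sum _ _ _ fun j _ => by
        simpa using (MvPolynomial.isHomogeneous_C (Fin n) (A i j : ℂ)).mul
          (MvPolynomial.isHomogeneous_X ℂ j))
  simpa [rowProduct] using h

theorem stronglyStable_rowProduct {n : ℕ} {A : Fin n → Fin n → ℝ} (hA : ∀ i j, 0 < A i j) :
    StronglyStable (rowProduct A) := by
  rintro z hz ⟨k, hk⟩
  rw [eval_rowProduct, Finset.prod_ne_zero_iff]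
  intro i _ h
  have h1 := congrArg Complex.re h
  simp only [Complex.re_sum, Complex.re_ofReal_mul, Complex.zero_re] at h1
  have h2 : 0 < ∑ j, A i j * (z j).re :=
    Finset.sum_pos' (fun j _ => mul_nonneg (hA i j).le (hz j))
      ⟨k, Finset.mem_univ k, mul_pos (hA i k) hk⟩
  linarith

theorem coeff_rowProduct {n : ℕ} (A : Fin n → Fin n → ℝ) :
    (rowProduct A).coeff (Finsupp.equivFunOnFinite.symm fun _ => 1)
      = ((∑ σ : Equiv.Perm (Fin n), ∏ i, A i (σ i) : ℝ) : ℂ) := by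
  unfold rowProduct
  rw [Finset.prod_univ_sum, MvPolynomial.coeff_sum]
  have h1 : ∀ g : Fin n → Fin n,
      (∏ i, (MvPolynomial.C (A i (g i) : ℂ) * MvPolynomial.X (g i))).coeff
        (Finsupp.equivFunOnFinite.symm fun _ => 1) =
      if Function.Bijective g then ((∏ i, A i (g i) : ℝ) : ℂ) else 0 := by
    intro g
    rw [Finset.prod_mul_distrib, ← map_prod, MvPolynomial.coeff_C_mul]
    have h2 : (∏ i, (MvPolynomial.X (g i) : MvPolynomial (Fin n) ℂ))
        = MvPolynomial.monomial (∑ i, Finsupp.single (g i) 1) 1 := by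
      rw [MvPolynomial.monomial_sum_one]
      rfl
    have h3 : (∑ i, Finsupp.single (g i) 1 = Finsupp.equivFunOnFinite.symm fun _ : Fin n => 1) ↔
        Function.Bijective g := by
      constructor
      · intro h
        rw [← Finite.surjective_iff_bijective]
        intro c
        have := DFunLike.congr_fun h c
        simp only [Finsupp.coe_finsetSum, Finset.sum_apply,
          Finsupp.equivFunOnFinite_symm_apply_apply] at this
        by_contra hc
        push Not at hc
        rw [Finset.sum_eq_zero (fun i _ => by rw [Finsupp.single_apply, if_neg (hc i)])] at this
        exact one_ne_zero this.symm
      · intro h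
        ext c
        simp only [Finsupp.coe_finsetSum, Finset.sum_apply,
          Finsupp.equivFunOnFinite_symm_apply_apply]
        obtain ⟨i, hi⟩ := h.2 c
        rw [Finset.sum_eq_single i]
        · rw [hi, Finsupp.single_eq_same]
        · intro b _ hb
          rw [Finsupp.single_apply, if_neg]
          intro hb'
          exact hb (h.1 (hb'.trans hi.symm))
        · simp
    rw [h2, MvPolynomial.coeff_monomial]
    simp only [h3]
    split_ifs <;> simp
  simp only [h1, Fintype.piFinset_univ]
  rw [← Finset.sum_filter]
  push_cast
  symm
  refine Finset.sum_bij (fun σ _ => (σ : Fin n → Fin n)) ?_ ?_ ?_ ?_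
  · intro σ _
    exact Finset.mem_filter.mpr ⟨Finset.mem_univ _, σ.bijective⟩
  · intro σ _ τ _ h
    exact DFunLike.coe_injective h
  · intro g hg
    rw [Finset.mem_filter] at hg
    exact ⟨Equiv.ofBijective g hg.2, Finset.mem_univ _, rfl⟩
  · intro σ _
    rfl

/-- A lower bound for permanents of positive doubly stochastic matrices. -/
theorem exp_neg_le_permanent_of_pos {n : ℕ} {A : Fin n → Fin n → ℝ} (hA : ∀ i j, 0 < A i j)
    (hr : ∀ i, ∑ j, A i j = 1) (hc : ∀ j, ∑ i, A i j = 1) :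
    Real.exp (-n) ≤ ∑ σ : Equiv.Perm (Fin n), ∏ i, A i (σ i) := by
  have hpos : 0 ≤ ∑ σ : Equiv.Perm (Fin n), ∏ i, A i (σ i) :=
    Finset.sum_nonneg fun σ _ => Finset.prod_nonneg fun i _ => (hA i _).le
  cases n with
  | zero => simp
  | succ n =>
    have h := le_norm_coeff_ones (C := 1) (isHomogeneous_rowProduct A)
      (stronglyStable_rowProduct hA) (by
        intro x hx
        rw [eval_rowProduct]
        have e : (∏ i, ∑ j, (A i j : ℂ) * (x j : ℂ)) = ((∏ i, ∑ j, A i j * x j : ℝ) : ℂ) := by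
          push_cast; rfl
        rw [e, Complex.norm_real, one_mul]
        refine le_trans ?_ (le_abs_self _)
        calc ∏ j, x j = ∏ i, ∏ j, x j ^ A i j := by
              rw [Finset.prod_comm]
              refine Finset.prod_congr rfl fun j _ => ?_
              rw [← Real.rpow_sum_of_pos (hx j), hc j, Real.rpow_one]
          _ ≤ ∏ i, ∑ j, A i j * x j := by
              refine Finset.prod_le_prod
                (fun i _ => Finset.prod_nonneg fun j _ => Real.rpow_nonneg (hx j).le _)
                fun i _ => ?_
              exact Real.geom_mean_le_arith_mean_weighted _ _ _ (fun j _ => (hA i j).le) (hr i)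
                (fun j _ => (hx j).le))
    rw [coeff_rowProduct, Complex.norm_real, Real.norm_of_nonneg hpos, one_mul] at h
    refine le_trans (Real.exp_le_exp.mpr ?_) h
    push_cast
    linarith

theorem exp_neg_le_permanent {n : ℕ} {A : Fin n → Fin n → ℝ} (hA : ∀ i j, 0 ≤ A i j)
    (hr : ∀ i, ∑ j, A i j = 1) (hc : ∀ j, ∑ i, A i j = 1) :
    Real.exp (-n) ≤ ∑ σ : Equiv.Perm (Fin n), ∏ i, A i (σ i) := by
  rcases Nat.eq_zero_or_pos n with rfl | hn
  · simp
  have hn' : (0 : ℝ) < n := by exact_mod_cast hn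
  set F : ℝ → ℝ := fun t => ∑ σ : Equiv.Perm (Fin n), ∏ i, ((1 - t) * A i (σ i) + t / n) with hF
  have hcont : Continuous F := by
    rw [hF]; fun_prop
  have h0 : F 0 = ∑ σ : Equiv.Perm (Fin n), ∏ i, A i (σ i) := by simp [hF]
  rw [← h0]
  have hlim : Filter.Tendsto F (nhdsWithin 0 (Set.Ioi 0)) (nhds (F 0)) :=
    hcont.continuousAt.mono_left nhdsWithin_le_nhds
  refine ge_of_tendsto hlim ?_
  filter_upwards [Ioo_mem_nhdsGT (zero_lt_one' ℝ)] with t ht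
  have hs : ∀ f : Fin n → ℝ, ∑ i, f i = 1 → ∑ i, ((1 - t) * f i + t / n) = 1 := by
    intro f hf
    rw [Finset.sum_add_distrib, ← Finset.mul_sum, hf]
    simp
    field_simp
    ring
  exact exp_neg_le_permanent_of_pos (A := fun i j => (1 - t) * A i j + t / n)
    (fun i j => add_pos_of_nonneg_of_pos (mul_nonneg (by linarith [ht.2]) (hA i j))
      (div_pos ht.1 hn')) (fun i => hs _ (hr i)) (fun j => hs _ (hc j))

theorem card_matchings_ge {n k : ℕ} (hk : k ≠ 0) {G : Finset (Fin n × Fin n)}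
    (hG : IsBiRegular G k) : (k : ℝ) ^ n * Real.exp (-n) ≤ ((matchings G).card : ℝ) := by
  have hk' : (k : ℝ) ≠ 0 := by exact_mod_cast hk
  have hrow : ∀ u, (Finset.univ.filter fun v => (u, v) ∈ G).card = k := by
    intro u
    rw [← hG.1 u, rowDeg]
    refine Finset.card_bij (fun v _ => (u, v)) (by simp) (by simp) ?_
    rintro ⟨a, b⟩ hab
    simp only [Finset.mem_filter] at hab
    obtain ⟨h1, rfl⟩ := hab
    exact ⟨b, by simpa using h1, rfl⟩
  have hcol : ∀ v, (Finset.univ.filter fun u => (u, v) ∈ G).card = k := by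
    intro v
    rw [← hG.2 v, colDeg]
    refine Finset.card_bij (fun u _ => (u, v)) (by simp) (by simp) ?_
    rintro ⟨a, b⟩ hab
    simp only [Finset.mem_filter] at hab
    obtain ⟨h1, rfl⟩ := hab
    exact ⟨a, by simpa using h1, rfl⟩
  have h := exp_neg_le_permanent (A := fun u v => if (u, v) ∈ G then (k : ℝ)⁻¹ else 0)
    (fun i j => by split_ifs <;> positivity)
    (fun u => by
      rw [← Finset.sum_filter, Finset.sum_const, hrow, nsmul_eq_mul, mul_inv_cancel₀ hk'])
    (fun v => by
      rw [← Finset.sum_filter, Finset.sum_const, hcol, nsmul_eq_mul, mul_inv_cancel₀ hk'])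
  have e : ∑ σ : Equiv.Perm (Fin n), ∏ u, (if (u, σ u) ∈ G then (k : ℝ)⁻¹ else 0)
      = (matchings G).card * ((k : ℝ) ^ n)⁻¹ := by
    have : ∀ σ : Equiv.Perm (Fin n), (∏ u, (if (u, σ u) ∈ G then (k : ℝ)⁻¹ else 0))
        = if ∀ u, (u, σ u) ∈ G then ((k : ℝ) ^ n)⁻¹ else 0 := by
      intro σ
      split_ifs with h
      · simp [h]
      · push Not at h
        obtain ⟨u, hu⟩ := h
        exact Finset.prod_eq_zero (Finset.mem_univ u) (if_neg hu)
    simp only [this]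
    rw [← Finset.sum_filter, Finset.sum_const, nsmul_eq_mul, matchings]
  rw [e, ← div_eq_mul_inv, le_div_iff₀ (by positivity)] at h
  linarith

/-- The permutations compatible with a relation. -/
def relPerms {α : Type*} [Fintype α] (R : α → α → Prop) : Finset (Equiv.Perm α) :=
  Finset.univ.filter fun σ => ∀ x, R x (σ x)

/-- The number of elements related to `x`. -/
def relDeg {α : Type*} [Fintype α] (R : α → α → Prop) (x : α) : ℕ :=
  (Finset.univ.filter fun y => R x y).card

/-- The normalized logarithm of the factorial, `log (d!) / d`. -/
def logFact (d : ℕ) : ℝ := Real.log (Nat.factorial d) / d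

theorem mul_logFact (d : ℕ) : d * logFact d = Real.log (Nat.factorial d) := by
  unfold logFact
  rcases Nat.eq_zero_or_pos d with rfl | h
  · simp
  · field_simp

theorem sum_mul_log_le {ι : Type*} (s : Finset ι) (a : ι → ℝ) (ha : ∀ i ∈ s, 0 ≤ a i)
    (hP : 0 < ∑ i ∈ s, a i) :
    (∑ i ∈ s, a i) * Real.log (∑ i ∈ s, a i) ≤
      (∑ i ∈ s, a i) * Real.log s.card + ∑ i ∈ s, a i * Real.log (a i) := by
  set P := ∑ i ∈ s, a i with hPdef
  have hs : 0 < (s.card : ℝ) := by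
    have : s.Nonempty := by
      by_contra h
      rw [Finset.not_nonempty_iff_eq_empty] at h
      simp [hPdef, h] at hP
    exact_mod_cast this.card_pos
  have h : ∀ i ∈ s, a i * (Real.log P - Real.log s.card - Real.log (a i)) ≤ P / s.card - a i := by
    intro i hi
    rcases (ha i hi).eq_or_lt with h0 | h0
    · rw [← h0]; simp; positivity
    · have h1 := Real.log_le_sub_one_of_pos (x := P / s.card / a i) (by positivity)
      rw [Real.log_div (by positivity) h0.ne', Real.log_div hP.ne' hs.ne'] at h1
      calc _ ≤ a i * (P / s.card / a i - 1) := mul_le_mul_of_nonneg_left h1 h0.le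
        _ = _ := by field_simp
  have h2 := Finset.sum_le_sum h
  rw [Finset.sum_sub_distrib, Finset.sum_const, nsmul_eq_mul, mul_div_cancel₀ _ hs.ne', ← hPdef,
    sub_self] at h2
  simp only [mul_sub, Finset.sum_sub_distrib, ← Finset.sum_mul, ← hPdef] at h2
  linarith

theorem log_card_relPerms_le_of_isolated {α : Type*} [Fintype α] (N : ℕ) :
    ∀ (I : Finset α) (R : α → α → Prop), I.card = N →
      (∀ i ∉ I, ∃ k, (∀ l, R i l ↔ l = k) ∧ ∀ j, R j k ↔ j = i) → (relPerms R).Nonempty →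
      Real.log (relPerms R).card ≤ ∑ j ∈ I, logFact (relDeg R j) := by
  induction N with
  | zero =>
    intro I R hI hR hS
    rw [Finset.card_eq_zero] at hI
    subst hI
    have h1 : (relPerms R).card ≤ 1 := by
      rw [Finset.card_le_one]
      intro σ hσ τ hτ
      simp only [relPerms, Finset.mem_filter, Finset.mem_univ, true_and] at hσ hτ
      ext i
      obtain ⟨k, hk, -⟩ := hR i (by simp)
      rw [(hk _).mp (hσ i), (hk _).mp (hτ i)]
    have h2 : (relPerms R).card = 1 := le_antisymm h1 hS.card_pos
    simp [h2]
  | succ N ih =>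
    intro I R hI hR hS
    set S := relPerms R with hSdef
    have hSmem : ∀ σ, σ ∈ S ↔ ∀ x, R x (σ x) := fun σ => by simp [hSdef, relPerms]
    have hP : 0 < (S.card : ℝ) := by exact_mod_cast hS.card_pos
    set L := Real.log S.card with hL
    have step : ∀ i ∈ I, S.card * L ≤ ∑ σ ∈ S, (Real.log (relDeg R i) +
        ∑ j ∈ I.erase i, logFact (relDeg R j - if R j (σ i) then 1 else 0)) := by
      intro i hi
      have hfib : ∑ k ∈ Finset.univ.filter (fun k => R i k), ((S.filter fun σ => σ i = k).card : ℝ)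
          = S.card := by
        rw [Finset.card_eq_sum_card_fiberwise (f := fun σ : Equiv.Perm α => σ i)
          (t := Finset.univ.filter (fun k => R i k))]
        · push_cast; rfl
        · intro σ hσ
          simpa using (hSmem σ).mp hσ i
      have hconv := sum_mul_log_le (Finset.univ.filter (fun k => R i k))
        (fun k => ((S.filter fun σ => σ i = k).card : ℝ)) (fun _ _ => Nat.cast_nonneg _)
        (by rw [hfib]; exact hP)
      rw [hfib] at hconv
      have hsum : ∑ k ∈ Finset.univ.filter (fun k => R i k),
          ((S.filter fun σ => σ i = k).card : ℝ) * Real.log (S.filter fun σ => σ i = k).card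
          = ∑ σ ∈ S, Real.log (S.filter fun τ => τ i = σ i).card := by
        rw [← Finset.sum_fiberwise_of_maps_to (g := fun σ : Equiv.Perm α => σ i)
          (t := Finset.univ.filter (fun k => R i k))]
        · refine Finset.sum_congr rfl fun k _ => ?_
          rw [← nsmul_eq_mul, ← Finset.sum_const]
          refine Finset.sum_congr rfl fun σ hσ => ?_
          rw [(Finset.mem_filter.mp hσ).2]
        · intro σ hσ
          simpa using (hSmem σ).mp hσ i
      rw [hsum] at hconv
      rw [Finset.sum_add_distrib, Finset.sum_const, nsmul_eq_mul]
      refine hconv.trans (add_le_add le_rfl (Finset.sum_le_sum fun σ hσ => ?_))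
      set k := σ i with hk
      have hik : R i k := (hSmem σ).mp hσ i
      set R' : α → α → Prop := fun j l => if j = i then l = k else (R j l ∧ l ≠ k) with hR'
      have e1 : (S.filter fun τ => τ i = k) = relPerms R' := by
        ext τ
        simp only [Finset.mem_filter, hSmem, relPerms, Finset.mem_univ, true_and, hR']
        constructor
        · rintro ⟨h1, h2⟩ x
          by_cases hx : x = i
          · simp [hx, h2]
          · rw [if_neg hx]
            exact ⟨h1 x, fun h => hx (τ.injective (h.trans h2.symm))⟩
        · intro h
          have h2 : τ i = k := by simpa using h i
          refine ⟨fun x => ?_, h2⟩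
          by_cases hx : x = i
          · subst hx; rw [h2]; exact hik
          · have := h x
            rw [if_neg hx] at this
            exact this.1
      rw [e1]
      have hne : (relPerms R').Nonempty := by
        rw [← e1]
        exact ⟨σ, Finset.mem_filter.mpr ⟨hσ, rfl⟩⟩
      refine (ih (I.erase i) R' (by rw [Finset.card_erase_of_mem hi, hI]; rfl) ?_ hne).trans
        (Finset.sum_le_sum fun j hj => ?_)
      · intro j hj
        by_cases hji : j = i
        · subst hji
          refine ⟨k, fun l => by simp [hR'], fun j' => ?_⟩
          simp only [hR']
          split_ifs with h
          · simp [h]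
          · simp [h]
        · have hjI : j ∉ I := fun h => hj (Finset.mem_erase.mpr ⟨hji, h⟩)
          obtain ⟨kj, h1, h2⟩ := hR j hjI
          have hkj : kj ≠ k := by
            intro h
            rw [← h] at hik
            exact hji ((h2 i).mp hik).symm
          refine ⟨kj, fun l => ?_, fun j' => ?_⟩
          · simp only [hR', if_neg hji, h1]
            constructor
            · exact fun h => h.1
            · rintro rfl; exact ⟨rfl, hkj⟩
          · simp only [hR']
            split_ifs with h
            · subst h
              simp only [hkj, false_iff]
              exact fun h => hji h.symm
            · rw [h2]
              simp [hkj]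
      · have hji : j ≠ i := (Finset.mem_erase.mp hj).1
        have : relDeg R' j = relDeg R j - if R j k then 1 else 0 := by
          unfold relDeg
          simp only [hR', if_neg hji]
          split_ifs with h
          · rw [← Finset.card_erase_of_mem (a := k) (by simpa using h)]
            congr 1
            ext l
            simp [and_comm]
          · rw [Nat.sub_zero]
            congr 1
            ext l
            simp only [Finset.mem_filter, Finset.mem_univ, true_and, and_iff_left_iff_imp]
            rintro h1 rfl
            exact h h1
        rw [this]
    have hcount : ∀ σ ∈ S, ∑ i ∈ I, (Real.log (relDeg R i) +
        ∑ j ∈ I.erase i, logFact (relDeg R j - if R j (σ i) then 1 else 0))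
        = I.card * ∑ j ∈ I, logFact (relDeg R j) := by
      intro σ hσ
      have hσ' := (hSmem σ).mp hσ
      have hswap : ∑ i ∈ I, ∑ j ∈ I.erase i, logFact (relDeg R j - if R j (σ i) then 1 else 0)
          = ∑ j ∈ I, ∑ i ∈ I.erase j, logFact (relDeg R j - if R j (σ i) then 1 else 0) := by
        refine Finset.sum_comm' fun i j => ?_
        simp only [Finset.mem_erase]
        tauto
      rw [Finset.sum_add_distrib, hswap, ← Finset.sum_add_distrib, Finset.mul_sum]
      refine Finset.sum_congr rfl fun j hj => ?_
      have hdeg : (I.filter fun i => R j (σ i)).card = relDeg R j := by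
        unfold relDeg
        refine Finset.card_bij (fun i _ => σ i) ?_ ?_ ?_
        · intro i hi
          simpa using (Finset.mem_filter.mp hi).2
        · intro a _ b _ h
          exact σ.injective h
        · intro l hl
          have hl' : R j l := by simpa using hl
          refine ⟨σ.symm l, ?_, by simp⟩
          rw [Finset.mem_filter]
          refine ⟨?_, by simpa using hl'⟩
          by_contra hn
          obtain ⟨k, h1, h2⟩ := hR _ hn
          have h3 := hσ' (σ.symm l)
          rw [h1] at h3
          rw [Equiv.apply_symm_apply] at h3
          rw [h3, h2] at hl'
          rw [← hl'] at hn
          exact hn hj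
      have hpos : 0 < relDeg R j := by
        unfold relDeg
        exact Finset.card_pos.mpr ⟨σ j, by simpa using hσ' j⟩
      have hcard : ((I.erase j).filter fun i => R j (σ i)).card = relDeg R j - 1 := by
        rw [Finset.filter_erase, Finset.card_erase_of_mem, hdeg]
        exact Finset.mem_filter.mpr ⟨hj, hσ' j⟩
      have hterm : ∀ i, logFact (relDeg R j - if R j (σ i) then 1 else 0)
          = logFact (relDeg R j) +
            if R j (σ i) then logFact (relDeg R j - 1) - logFact (relDeg R j) else 0 := by
        intro i
        split_ifs <;> simp
      simp only [hterm]
      rw [Finset.sum_add_distrib, ← Finset.sum_filter, Finset.sum_const, Finset.sum_const, hcard,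
        Finset.card_erase_of_mem hj, nsmul_eq_mul, nsmul_eq_mul,
        Nat.cast_sub (Finset.card_pos.mpr ⟨j, hj⟩)]
      obtain ⟨d, hd⟩ : ∃ d, relDeg R j = d + 1 := ⟨relDeg R j - 1, by omega⟩
      rw [hd, Nat.add_sub_cancel]
      have f1 := mul_logFact d
      have f2 := mul_logFact (d + 1)
      rw [Nat.factorial_succ, Nat.cast_mul, Real.log_mul (Nat.cast_ne_zero.mpr d.succ_ne_zero)
        (Nat.cast_ne_zero.mpr d.factorial_ne_zero)] at f2
      push_cast at f2 ⊢
      linear_combination f1 - f2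
    have h1 := Finset.sum_le_sum step
    rw [Finset.sum_comm, Finset.sum_congr rfl hcount, Finset.sum_const, Finset.sum_const,
      nsmul_eq_mul, nsmul_eq_mul] at h1
    have hIc : 0 < (I.card : ℝ) := by rw [hI]; positivity
    have h2 : (I.card * S.card : ℝ) * L ≤
        (I.card * S.card : ℝ) * ∑ j ∈ I, logFact (relDeg R j) := by
      linarith
    exact le_of_mul_le_mul_left h2 (by positivity)

/-- Bregman's theorem for the number of perfect matchings of a bipartite graph. -/
theorem card_matchings_le {n : ℕ} (H : Finset (Fin n × Fin n)) :
    ((matchings H).card : ℝ) ≤ ∏ u, Real.exp (logFact (rowDeg H u)) := by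
  have e : matchings H = relPerms fun u v => (u, v) ∈ H := by
    ext σ
    simp [matchings, relPerms]
  have hdeg : ∀ u, relDeg (fun u v => (u, v) ∈ H) u = rowDeg H u := by
    intro u
    rw [relDeg, rowDeg]
    refine Finset.card_bij (fun v _ => (u, v)) (by simp) (by simp) ?_
    rintro ⟨a, b⟩ hab
    simp only [Finset.mem_filter] at hab
    obtain ⟨h1, rfl⟩ := hab
    exact ⟨b, by simpa using h1, rfl⟩
  rw [← Real.exp_sum]
  rcases (matchings H).eq_empty_or_nonempty with h | h
  · rw [h]; simp; positivity
  · have h1 := log_card_relPerms_le_of_isolated (Finset.univ : Finset (Fin n)).card Finset.univ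
      (fun u v => (u, v) ∈ H) rfl (fun i hi => absurd (Finset.mem_univ i) hi) (by rwa [← e])
    rw [← e] at h1
    simp only [hdeg] at h1
    have h2 : 0 < ((matchings H).card : ℝ) := by exact_mod_cast h.card_pos
    rwa [← Real.log_le_iff_le_exp h2]

theorem chooseMatching_mem {n : ℕ} (r : Equiv.Perm (Fin (Nat.factorial n)))
    (S : Finset (Equiv.Perm (Fin n))) (h : S.Nonempty) : chooseMatching r S h ∈ S := by
  have h1 := Finset.min'_mem (S.image (fun σ => r (permEquiv n σ))) (h.image _)
  obtain ⟨σ, hσ, h2⟩ := Finset.mem_image.mp h1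
  unfold chooseMatching
  rw [← h2]
  simpa using hσ

theorem card_chooseMatching_le {n : ℕ} (S : Finset (Equiv.Perm (Fin n))) (h : S.Nonempty)
    {σ τ : Equiv.Perm (Fin n)} (hσ : σ ∈ S) (hτ : τ ∈ S) :
    (Finset.univ.filter fun r => chooseMatching r S h = σ).card ≤
      (Finset.univ.filter fun r => chooseMatching r S h = τ).card := by
  set π : Equiv.Perm (Fin (Nat.factorial n)) := Equiv.swap (permEquiv n σ) (permEquiv n τ) with hπ
  refine Finset.card_le_card_of_injOn (fun r => r * π) ?_ (fun a _ b _ hab => mul_right_cancel hab)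
  intro r hr
  simp only [Finset.coe_filter, Finset.mem_univ, true_and, Set.mem_ofPred_eq] at hr ⊢
  have himg : (S.image fun x => (r * π) (permEquiv n x)) = S.image fun x => r (permEquiv n x) := by
    have hsub : ∀ x ∈ S, (permEquiv n).symm (π (permEquiv n x)) ∈ S := by
      intro x hx
      rw [hπ, Equiv.swap_apply_def]
      split_ifs
      · simpa using hτ
      · simpa using hσ
      · simpa using hx
    ext y
    simp only [Finset.mem_image, Equiv.Perm.mul_apply]
    constructor
    · rintro ⟨x, hx, rfl⟩
      exact ⟨_, hsub x hx, by simp⟩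
    · rintro ⟨x, hx, rfl⟩
      exact ⟨_, hsub x hx, by simp [hπ]⟩
  have hmin : (S.image fun x => (r * π) (permEquiv n x)).min' (h.image _)
      = (S.image fun x => r (permEquiv n x)).min' (h.image _) := by
    congr 1
  unfold chooseMatching at hr ⊢
  rw [hmin]
  set m := (S.image fun x => r (permEquiv n x)).min' (h.image _)
  rw [Equiv.symm_apply_eq] at hr ⊢
  have : (r * π).symm m = π.symm (r.symm m) := rfl
  rw [this, hr, hπ, Equiv.symm_swap, Equiv.swap_apply_left]

theorem sum_chooseMatching {n : ℕ} (S : Finset (Equiv.Perm (Fin n))) (h : S.Nonempty)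
    (F : Equiv.Perm (Fin n) → ℝ) :
    (∑ r, F (chooseMatching r S h)) / Fintype.card (Equiv.Perm (Fin (Nat.factorial n)))
      = (∑ σ ∈ S, F σ) / S.card := by
  obtain ⟨τ, hτ⟩ := h
  have h : S.Nonempty := ⟨τ, hτ⟩
  set c := (Finset.univ.filter fun r => chooseMatching r S h = τ).card with hc
  have hfib : ∀ σ ∈ S, (Finset.univ.filter fun r => chooseMatching r S h = σ).card = c :=
    fun σ hσ => le_antisymm (card_chooseMatching_le S h hσ hτ) (card_chooseMatching_le S h hτ hσ)
  have hcard : Fintype.card (Equiv.Perm (Fin (Nat.factorial n))) = S.card * c := by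
    rw [← Finset.card_univ, Finset.card_eq_sum_card_fiberwise
      (f := fun r => chooseMatching r S h) (t := S) (fun r _ => chooseMatching_mem r S h),
      Finset.sum_congr rfl hfib, Finset.sum_const, smul_eq_mul]
  have hsum : ∑ r, F (chooseMatching r S h) = c * ∑ σ ∈ S, F σ := by
    rw [← Finset.sum_fiberwise_of_maps_to (g := fun r => chooseMatching r S h) (t := S)
      (fun r _ => chooseMatching_mem r S h), Finset.mul_sum]
    refine Finset.sum_congr rfl fun σ hσ => ?_
    rw [Finset.sum_congr rfl (g := fun _ => F σ)
      (fun r hr => by rw [(Finset.mem_filter.mp hr).2]), Finset.sum_const, hfib σ hσ, nsmul_eq_mul]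
  have hc0 : (c : ℝ) ≠ 0 := by
    intro h0
    have : c = 0 := by exact_mod_cast h0
    rw [this, mul_zero] at hcard
    exact Fintype.card_ne_zero hcard
  have hS0 : (S.card : ℝ) ≠ 0 := by exact_mod_cast h.card_pos.ne'
  rw [hsum, hcard]
  push_cast
  field_simp

/-- The probability weight of one layer of the random array. -/
def layerWeight {n : ℕ} (p : ℝ) (N : Fin n → Fin n → Bool) : ℝ :=
  ∏ r, ∏ c, if N r c = true then p else 1 - p

theorem layerWeight_nonneg {n : ℕ} {p : ℝ} (h0 : 0 ≤ p) (h1 : p ≤ 1) (N : Fin n → Fin n → Bool) :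
    0 ≤ layerWeight p N :=
  Finset.prod_nonneg fun _ _ => Finset.prod_nonneg fun _ _ => by split_ifs <;> linarith

theorem sum_bool_prod {n : ℕ} (h : Fin n → Bool → ℝ) :
    ∑ b : Fin n → Bool, ∏ c, h c (b c) = ∏ c, (h c true + h c false) := by
  have := Finset.prod_univ_sum (fun _ : Fin n => (Finset.univ : Finset Bool)) h
  rw [Fintype.piFinset_univ] at this
  simp only [Fintype.sum_bool] at this
  exact this.symm

theorem sum_layer_prod {n : ℕ} (F : Fin n → (Fin n → Bool) → ℝ) :
    ∑ N : Fin n → Fin n → Bool, ∏ r, F r (N r) = ∏ r, ∑ b : Fin n → Bool, F r b := by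
  have := Finset.prod_univ_sum (fun _ : Fin n => (Finset.univ : Finset (Fin n → Bool))) F
  rw [Fintype.piFinset_univ] at this
  exact this.symm

theorem sum_bool_weight {n : ℕ} (p : ℝ) (s : Finset (Fin n)) :
    ∑ b : Fin n → Bool, (∏ c, if b c = true then p else 1 - p) *
        (if ∀ c ∈ s, b c = true then 1 else 0)
      = p ^ s.card := by
  have h1 : ∀ b : Fin n → Bool, (∏ c, if b c = true then p else 1 - p) *
      (if ∀ c ∈ s, b c = true then 1 else 0)
      = ∏ c, (fun c x => (if x = true then p else 1 - p) *
        (if c ∈ s ∧ x = false then 0 else 1)) c (b c) := by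
    intro b
    rw [Finset.prod_mul_distrib]
    congr 1
    split_ifs with h
    · refine (Finset.prod_eq_one fun c _ => if_neg ?_).symm
      rintro ⟨h2, h3⟩
      rw [h c h2] at h3
      exact Bool.noConfusion h3
    · push Not at h
      obtain ⟨c, hc, hb⟩ := h
      have hb' : b c = false := by simpa using hb
      symm
      refine Finset.prod_eq_zero (Finset.mem_univ c) ?_
      simp [hc, hb']
  refine (Finset.sum_congr rfl fun b _ => h1 b).trans ((sum_bool_prod (fun c x =>
    (if x = true then p else 1 - p) * (if c ∈ s ∧ x = false then 0 else 1))).trans ?_)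
  have h2 : ∀ c : Fin n,
      ((if true = true then p else 1 - p) * (if c ∈ s ∧ true = false then 0 else 1) +
      (if false = true then p else 1 - p) * (if c ∈ s ∧ false = false then 0 else 1))
      = if c ∈ s then p else 1 := by
    intro c
    by_cases hc : c ∈ s <;> simp [hc]
  rw [Finset.prod_congr rfl fun c _ => h2 c]
  simp

theorem sum_layerWeight_perm {n : ℕ} (p : ℝ) (σ : Equiv.Perm (Fin n)) :
    ∑ N : Fin n → Fin n → Bool, layerWeight p N * (if ∀ x, N x (σ x) = true then 1 else 0)
      = p ^ n := by
  have h1 : ∀ N : Fin n → Fin n → Bool,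
      layerWeight p N * (if ∀ x, N x (σ x) = true then 1 else 0)
      = ∏ r, (fun r b => (∏ c, if b c = true then p else 1 - p) *
          (if ∀ c ∈ ({σ r} : Finset (Fin n)), b c = true then 1 else 0)) r (N r) := by
    intro N
    rw [Finset.prod_mul_distrib, layerWeight]
    congr 1
    split_ifs with h
    · simp [h]
    · push Not at h
      obtain ⟨x, hx⟩ := h
      exact (Finset.prod_eq_zero (Finset.mem_univ x) (if_neg (by simpa using hx))).symm
  refine (Finset.sum_congr rfl fun N _ => h1 N).trans ((sum_layer_prod (fun r b =>
    (∏ c, if b c = true then p else 1 - p) *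
      (if ∀ c ∈ ({σ r} : Finset (Fin n)), b c = true then 1 else 0))).trans ?_)
  rw [Finset.prod_congr rfl fun r _ => sum_bool_weight p _]
  simp

theorem sum_layerWeight {n : ℕ} (p : ℝ) :
    ∑ N : Fin n → Fin n → Bool, layerWeight p N = 1 := by
  have h1 : ∀ b : Fin n → Bool, (∏ c, if b c = true then p else 1 - p) =
      (∏ c, if b c = true then p else 1 - p) *
        (if ∀ c ∈ (∅ : Finset (Fin n)), b c = true then 1 else 0) := by simp
  unfold layerWeight
  rw [sum_layer_prod fun _ b => ∏ c, if b c = true then p else 1 - p]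
  refine Finset.prod_eq_one fun r _ => ?_
  rw [Finset.sum_congr rfl fun b _ => h1 b, sum_bool_weight]
  simp

theorem sum_prod_eq_resample {m : ℕ} {Ω : Type*} [Fintype Ω] (w : Ω → ℝ)
    (hw : ∑ o, w o = 1) (X : (Fin m → Ω) → ℝ) (j : Fin m) :
    ∑ ω : Fin m → Ω, (∏ i, w (ω i)) * X ω
      = ∑ ω : Fin m → Ω, (∏ i, w (ω i)) * ∑ o, w o * X (Function.update ω j o) := by
  have h1 : ∑ ω : Fin m → Ω, (∏ i, w (ω i)) * X ω
      = ∑ x : (Fin m → Ω) × Ω, (∏ i, w (x.1 i)) * w x.2 * X x.1 := by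
    rw [Fintype.sum_prod_type]
    refine Finset.sum_congr rfl fun ω _ => ?_
    dsimp only
    rw [← Finset.sum_mul, ← Finset.mul_sum, hw, mul_one]
  have h2 : ∑ ω : Fin m → Ω, (∏ i, w (ω i)) * ∑ o, w o * X (Function.update ω j o)
      = ∑ x : (Fin m → Ω) × Ω, (∏ i, w (x.1 i)) * w x.2 * X (Function.update x.1 j x.2) := by
    rw [Fintype.sum_prod_type]
    refine Finset.sum_congr rfl fun ω _ => ?_
    rw [Finset.mul_sum]
    refine Finset.sum_congr rfl fun o _ => ?_
    ring
  rw [h1, h2]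
  refine Finset.sum_bij' (fun x _ => (Function.update x.1 j x.2, x.1 j))
    (fun x _ => (Function.update x.1 j x.2, x.1 j)) (by simp) (by simp) (by simp) (by simp) ?_
  rintro ⟨ω, o⟩ -
  simp only [Function.update_idem, Function.update_eq_self]
  have : ∀ o', (∏ i, w (Function.update ω j o' i)) = w o' * ∏ i ∈ Finset.univ.erase j, w (ω i) := by
    intro o'
    rw [← Finset.mul_prod_erase _ _ (Finset.mem_univ j), Function.update_self]
    congr 1
    refine Finset.prod_congr rfl fun i hi => ?_
    rw [Function.update_of_ne (Finset.ne_of_mem_erase hi)]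
  rw [this, ← Finset.mul_prod_erase _ _ (Finset.mem_univ j)]
  ring

/-- The number of perfect matchings required at step `j` of the algorithm. -/
def matchThreshold (n : ℕ) (p δ : ℝ) (j : ℕ) : ℝ :=
  ((1 - δ) * ((n - j : ℕ) : ℝ) * p) ^ n * (Nat.factorial n : ℝ) / (n : ℝ) ^ n

/-- Remove the edges of `σ` from `G`. -/
def removeMatching {n : ℕ} (G : Finset (Fin n × Fin n)) (σ : Equiv.Perm (Fin n)) :
    Finset (Fin n × Fin n) :=
  G.filter fun x => σ x.1 ≠ x.2

/-- The edges of `G` retained by the layer `N`. -/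
def sparsify {n : ℕ} (G : Finset (Fin n × Fin n)) (N : Fin n → Fin n → Bool) :
    Finset (Fin n × Fin n) :=
  G.filter fun x => N x.1 x.2 = true

/-- One step of the algorithm. -/
def nextGraph {n : ℕ} (G : Finset (Fin n × Fin n)) (N : Fin n → Fin n → Bool)
    (r : Equiv.Perm (Fin (Nat.factorial n))) : Finset (Fin n × Fin n) :=
  if h : (matchings (sparsify G N)).Nonempty then
    removeMatching G (chooseMatching r (matchings (sparsify G N)) h)
  else G

/-- The randomness used in one step of the algorithm. -/
abbrev StepRand (n : ℕ) := (Fin n → Fin n → Bool) × Equiv.Perm (Fin (Nat.factorial n))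

/-- The probability weight of the randomness used in one step of the algorithm. -/
def stepWeight {n : ℕ} (p : ℝ) (o : StepRand n) : ℝ :=
  layerWeight p o.1 * (1 / (Fintype.card (Equiv.Perm (Fin (Nat.factorial n))) : ℝ))

theorem stepWeight_nonneg {n : ℕ} {p : ℝ} (h0 : 0 ≤ p) (h1 : p ≤ 1) (o : StepRand n) :
    0 ≤ stepWeight p o :=
  mul_nonneg (layerWeight_nonneg h0 h1 _) (by positivity)

theorem sum_stepWeight_mul {n : ℕ} (p : ℝ) (F : StepRand n → ℝ) :
    ∑ o, stepWeight p o * F o = ∑ N, layerWeight p N *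
      ((∑ r, F (N, r)) / Fintype.card (Equiv.Perm (Fin (Nat.factorial n)))) := by
  rw [Fintype.sum_prod_type]
  refine Finset.sum_congr rfl fun N _ => ?_
  rw [Finset.sum_div, Finset.mul_sum]
  refine Finset.sum_congr rfl fun r _ => ?_
  rw [stepWeight]
  ring

theorem sum_stepWeight {n : ℕ} (p : ℝ) : ∑ o : StepRand n, stepWeight p o = 1 := by
  have h := sum_stepWeight_mul (n := n) p fun _ => 1
  simp only [mul_one] at h
  rw [h]
  have hc : (Fintype.card (Equiv.Perm (Fin (Nat.factorial n))) : ℝ) ≠ 0 :=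
    Nat.cast_ne_zero.mpr Fintype.card_ne_zero
  rw [Finset.sum_const, Finset.card_univ, nsmul_eq_mul, mul_one, div_self hc]
  simp only [mul_one]
  exact sum_layerWeight p

/-- The expectation of `Φ (G_{j+1})` on the event of not aborting in the first `j` steps. -/
def survivalSum (n m : ℕ) (p δ : ℝ) (j : ℕ) (Φ : Finset (Fin n × Fin n) → ℝ) : ℝ :=
  ∑ ω : Fin m → StepRand n, (∏ i, stepWeight p (ω i)) *
    (if NoAbortBefore n m p δ j (fun i => (ω i).1) (fun i => (ω i).2)
      then Φ (stepG n m (fun i => (ω i).1) (fun i => (ω i).2) j) else 0)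

theorem algProb_noAbort_and_eq (n m : ℕ) (p δ : ℝ) (j : ℕ) (Q : Finset (Fin n × Fin n) → Prop) :
    algProb n m p (fun M ρ => NoAbortBefore n m p δ j M ρ ∧ Q (stepG n m M ρ j))
      = survivalSum n m p δ j fun G => if Q G then 1 else 0 := by
  unfold algProb survivalSum
  refine (Fintype.sum_prod_type' _).symm.trans ?_
  refine (Fintype.sum_equiv (Equiv.arrowProdEquivProdArrow (Fin m)
    (fun _ => Fin n → Fin n → Bool) (fun _ => Equiv.Perm (Fin (Nat.factorial n)))) _ _
    fun ω => ?_).symm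
  have hw : ∏ i, stepWeight p (ω i) = (∏ i, ∏ r, ∏ c, if (ω i).1 r c = true then p else 1 - p)
        * (1 / (Fintype.card (Fin m → Equiv.Perm (Fin (Nat.factorial n))) : ℝ)) := by
    simp only [stepWeight]
    rw [Finset.prod_mul_distrib, Finset.prod_const, Fintype.card_fun]
    simp [layerWeight]
  rw [hw]
  by_cases h1 : NoAbortBefore n m p δ j (fun i => (ω i).1) (fun i => (ω i).2)
  · by_cases h2 : Q (stepG n m (fun i => (ω i).1) (fun i => (ω i).2) j)
    · rw [if_pos h1]
      beta_reduce
      rw [if_pos h2, mul_one]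
      exact (if_pos ⟨h1, h2⟩).symm
    · rw [if_pos h1]
      beta_reduce
      rw [if_neg h2, mul_zero]
      exact (if_neg fun h => h2 h.2).symm
  · rw [if_neg h1, mul_zero]
    exact (if_neg fun h => h1 h.1).symm

theorem algProb_noAbort_eq (n m : ℕ) (p δ : ℝ) (j : ℕ) :
    algProb n m p (NoAbortBefore n m p δ j) = survivalSum n m p δ j fun _ => 1 := by
  have h := algProb_noAbort_and_eq n m p δ j fun _ => True
  simpa using h

theorem algGraph_congr {n : ℕ} {M M' : ℕ → Fin n → Fin n → Bool}
    {ρ ρ' : ℕ → Equiv.Perm (Fin (Nat.factorial n))} :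
    ∀ {j : ℕ}, (∀ k < j, M k = M' k) → (∀ k < j, ρ k = ρ' k) → algGraph M ρ j = algGraph M' ρ' j
  | 0, _, _ => rfl
  | j + 1, hM, hρ => by
    have ih := algGraph_congr (j := j) (fun k hk => hM k (by omega)) fun k hk => hρ k (by omega)
    show nextGraph (algGraph M ρ j) (M j) (ρ j) = nextGraph (algGraph M' ρ' j) (M' j) (ρ' j)
    rw [ih, hM j (by omega), hρ j (by omega)]

section Update

variable {n m : ℕ} (ω : Fin m → StepRand n) {j : ℕ} (hj : j < m) (o : StepRand n)

theorem extM_update_of_lt {k : ℕ} (hk : k < j) :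
    extM n m (fun i => (Function.update ω ⟨j, hj⟩ o i).1) k = extM n m (fun i => (ω i).1) k := by
  have hkm : k < m := hk.trans hj
  simp only [extM, dif_pos hkm]
  rw [Function.update_of_ne]
  simpa using hk.ne

theorem extρ_update_of_lt {k : ℕ} (hk : k < j) :
    extρ n m (fun i => (Function.update ω ⟨j, hj⟩ o i).2) k = extρ n m (fun i => (ω i).2) k := by
  have hkm : k < m := hk.trans hj
  simp only [extρ, dif_pos hkm]
  rw [Function.update_of_ne]
  simpa using hk.ne

theorem extM_update_self :
    extM n m (fun i => (Function.update ω ⟨j, hj⟩ o i).1) j = o.1 := by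
  simp [extM, dif_pos hj]

theorem extρ_update_self :
    extρ n m (fun i => (Function.update ω ⟨j, hj⟩ o i).2) j = o.2 := by
  simp [extρ, dif_pos hj]

theorem stepG_update {k : ℕ} (hk : k ≤ j) :
    stepG n m (fun i => (Function.update ω ⟨j, hj⟩ o i).1)
      (fun i => (Function.update ω ⟨j, hj⟩ o i).2) k
      = stepG n m (fun i => (ω i).1) (fun i => (ω i).2) k :=
  algGraph_congr (fun _ hl => extM_update_of_lt ω hj o (by omega))
    fun _ hl => extρ_update_of_lt ω hj o (by omega)

theorem noAbortBefore_update (p δ : ℝ) :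
    NoAbortBefore n m p δ j (fun i => (Function.update ω ⟨j, hj⟩ o i).1)
      (fun i => (Function.update ω ⟨j, hj⟩ o i).2)
      ↔ NoAbortBefore n m p δ j (fun i => (ω i).1) (fun i => (ω i).2) := by
  unfold NoAbortBefore stepH
  refine forall₂_congr fun k hk => ?_
  rw [stepG_update ω hj o hk.le, extM_update_of_lt ω hj o hk]

end Update

theorem stepG_succ (n m : ℕ) (M : Fin m → Fin n → Fin n → Bool)
    (ρ : Fin m → Equiv.Perm (Fin (Nat.factorial n))) (j : ℕ) :
    stepG n m M ρ (j + 1) = nextGraph (stepG n m M ρ j) (extM n m M j) (extρ n m ρ j) := rfl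

theorem noAbortBefore_succ (n m : ℕ) (p δ : ℝ) (j : ℕ) (M : Fin m → Fin n → Fin n → Bool)
    (ρ : Fin m → Equiv.Perm (Fin (Nat.factorial n))) :
    NoAbortBefore n m p δ (j + 1) M ρ ↔ NoAbortBefore n m p δ j M ρ ∧
      matchThreshold n p δ j ≤
        ((matchings (sparsify (stepG n m M ρ j) (extM n m M j))).card : ℝ) := by
  unfold NoAbortBefore
  constructor
  · exact fun h => ⟨fun k hk => h k (by omega), h j (by omega)⟩
  · rintro ⟨h1, h2⟩ k hk
    rcases Nat.lt_succ_iff_lt_or_eq.mp hk with h | rfl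
    · exact h1 k h
    · exact h2

/-- The expectation of `Φ` after one non-aborting step from `G`. -/
def stepOp {n : ℕ} (p T : ℝ) (Φ : Finset (Fin n × Fin n) → ℝ) (G : Finset (Fin n × Fin n)) : ℝ :=
  ∑ o : StepRand n, stepWeight p o *
    (if T ≤ ((matchings (sparsify G o.1)).card : ℝ) then Φ (nextGraph G o.1 o.2) else 0)

theorem survivalSum_succ (n m : ℕ) (p δ : ℝ) {j : ℕ} (hj : j < m)
    (Φ : Finset (Fin n × Fin n) → ℝ) :
    survivalSum n m p δ (j + 1) Φ
      = survivalSum n m p δ j (stepOp p (matchThreshold n p δ j) Φ) := by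
  unfold survivalSum
  rw [sum_prod_eq_resample _ (sum_stepWeight p) _ ⟨j, hj⟩]
  refine Finset.sum_congr rfl fun ω _ => ?_
  congr 1
  split_ifs with h
  · unfold stepOp
    refine Finset.sum_congr rfl fun o _ => ?_
    rw [stepG_succ, extM_update_self, extρ_update_self, stepG_update ω hj o le_rfl]
    congr 1
    refine if_congr ?_ rfl rfl
    rw [noAbortBefore_succ, noAbortBefore_update, extM_update_self, stepG_update ω hj o le_rfl]
    exact and_iff_right h
  · refine Finset.sum_eq_zero fun o _ => ?_
    rw [if_neg, mul_zero]
    rw [noAbortBefore_succ, noAbortBefore_update]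
    exact fun h' => h h'.1

theorem survivalSum_zero (n m : ℕ) (p δ : ℝ) (Φ : Finset (Fin n × Fin n) → ℝ) :
    survivalSum n m p δ 0 Φ = Φ Finset.univ := by
  unfold survivalSum
  have h1 : ∑ ω : Fin m → StepRand n, (∏ i, stepWeight p (ω i)) = 1 := by
    have := Finset.prod_univ_sum (fun _ : Fin m => (Finset.univ : Finset (StepRand n)))
      (fun _ o => stepWeight p o)
    rw [Fintype.piFinset_univ] at this
    rw [← this]
    exact Finset.prod_eq_one fun _ _ => sum_stepWeight p
  have h2 : ∀ ω : Fin m → StepRand n, (if NoAbortBefore n m p δ 0 (fun i => (ω i).1)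
      (fun i => (ω i).2) then Φ (stepG n m (fun i => (ω i).1) (fun i => (ω i).2) 0) else 0)
      = Φ Finset.univ := by
    intro ω
    rw [if_pos]
    · rfl
    · intro k hk
      exact absurd hk (Nat.not_lt_zero k)
  simp only [h2]
  rw [← Finset.sum_mul, h1, one_mul]

theorem rowDeg_removeMatching {n : ℕ} {G : Finset (Fin n × Fin n)} {σ : Equiv.Perm (Fin n)}
    (hσ : σ ∈ matchings G) (u : Fin n) : rowDeg (removeMatching G σ) u + 1 = rowDeg G u := by
  have hmem : (u, σ u) ∈ G := (Finset.mem_filter.mp hσ).2 u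
  unfold rowDeg removeMatching
  rw [← Finset.card_erase_add_one (s := G.filter fun e => e.1 = u) (a := (u, σ u)) (by simp [hmem])]
  congr 2
  ext ⟨a, b⟩
  simp only [Finset.mem_filter, Finset.mem_erase, Prod.mk.injEq, ne_eq]
  constructor
  · rintro ⟨⟨h1, h2⟩, rfl⟩
    exact ⟨fun h => h2 h.2.symm, h1, rfl⟩
  · rintro ⟨h1, h2, rfl⟩
    exact ⟨⟨h2, fun h => h1 ⟨rfl, h.symm⟩⟩, rfl⟩

theorem colDeg_removeMatching {n : ℕ} {G : Finset (Fin n × Fin n)} {σ : Equiv.Perm (Fin n)}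
    (hσ : σ ∈ matchings G) (v : Fin n) : colDeg (removeMatching G σ) v + 1 = colDeg G v := by
  have hmem : (σ.symm v, v) ∈ G := by
    have := (Finset.mem_filter.mp hσ).2 (σ.symm v)
    rwa [Equiv.apply_symm_apply] at this
  unfold colDeg removeMatching
  rw [← Finset.card_erase_add_one (s := G.filter fun e => e.2 = v) (a := (σ.symm v, v))
    (by simp [hmem])]
  congr 2
  ext ⟨a, b⟩
  simp only [Finset.mem_filter, Finset.mem_erase, Prod.mk.injEq, ne_eq]
  constructor
  · rintro ⟨⟨h1, h2⟩, rfl⟩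
    refine ⟨fun h => h2 ?_, h1, rfl⟩
    rw [h.1, Equiv.apply_symm_apply]
  · rintro ⟨h1, h2, rfl⟩
    refine ⟨⟨h2, fun h => h1 ⟨?_, rfl⟩⟩, rfl⟩
    rw [← h, Equiv.symm_apply_apply]

theorem IsBiRegular.removeMatching {n d : ℕ} {G : Finset (Fin n × Fin n)}
    (hG : IsBiRegular G (d + 1)) {σ : Equiv.Perm (Fin n)} (hσ : σ ∈ matchings G) :
    IsBiRegular (removeMatching G σ) d :=
  ⟨fun u => by have := rowDeg_removeMatching hσ u; have := hG.1 u; omega,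
    fun v => by have := colDeg_removeMatching hσ v; have := hG.2 v; omega⟩

theorem rowDeg_univ {n : ℕ} (u : Fin n) : rowDeg Finset.univ u = n := by
  unfold rowDeg
  have : (Finset.univ.filter fun e : Fin n × Fin n => e.1 = u) = {u} ×ˢ Finset.univ := by
    ext ⟨a, b⟩; simp [eq_comm]
  rw [this]; simp

theorem colDeg_univ {n : ℕ} (v : Fin n) : colDeg Finset.univ v = n := by
  unfold colDeg
  have : (Finset.univ.filter fun e : Fin n × Fin n => e.2 = v) = Finset.univ ×ˢ {v} := by
    ext ⟨a, b⟩; simp [eq_comm]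
  rw [this]; simp

theorem rowDeg_add_rowDeg_compl {n : ℕ} (G : Finset (Fin n × Fin n)) (u : Fin n) :
    rowDeg G u + rowDeg Gᶜ u = n := by
  unfold rowDeg
  rw [← Finset.card_union_of_disjoint, ← Finset.filter_union, Finset.union_compl]
  · exact rowDeg_univ u
  · exact Finset.disjoint_filter_filter disjoint_compl_right

theorem matchings_sparsify {n : ℕ} (G : Finset (Fin n × Fin n)) (N : Fin n → Fin n → Bool) :
    matchings (sparsify G N) = (matchings G).filter fun σ => ∀ x, N x (σ x) = true := by
  ext σ
  simp only [matchings, sparsify, Finset.mem_filter, Finset.mem_univ, true_and]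
  exact forall_and

theorem stepOp_eq {n : ℕ} (p : ℝ) {T : ℝ} (hT : 0 < T)
    (Φ : Finset (Fin n × Fin n) → ℝ) (G : Finset (Fin n × Fin n)) :
    stepOp p T Φ G = ∑ N, layerWeight p N *
      (if T ≤ ((matchings (sparsify G N)).card : ℝ) then
        (∑ σ ∈ matchings (sparsify G N), Φ (removeMatching G σ)) /
          (matchings (sparsify G N)).card else 0) := by
  unfold stepOp
  rw [sum_stepWeight_mul]
  refine Finset.sum_congr rfl fun N _ => ?_
  congr 1
  dsimp only
  split_ifs with h
  · have hne : (matchings (sparsify G N)).Nonempty := by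
      rw [← Finset.card_pos]
      exact_mod_cast hT.trans_le h
    rw [← sum_chooseMatching _ hne fun σ => Φ (removeMatching G σ)]
    simp only [nextGraph, dif_pos hne]
  · simp

theorem stepOp_le {n : ℕ} {p : ℝ} (h0 : 0 ≤ p) (h1 : p ≤ 1) {T : ℝ} (hT : 0 < T)
    {Φ : Finset (Fin n × Fin n) → ℝ} (hΦ : ∀ G, 0 ≤ Φ G) (G : Finset (Fin n × Fin n)) :
    stepOp p T Φ G ≤ p ^ n / T * ∑ σ ∈ matchings G, Φ (removeMatching G σ) := by
  rw [stepOp_eq p hT]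
  have hstep : ∀ N : Fin n → Fin n → Bool, layerWeight p N *
      (if T ≤ ((matchings (sparsify G N)).card : ℝ) then
        (∑ σ ∈ matchings (sparsify G N), Φ (removeMatching G σ)) /
          (matchings (sparsify G N)).card else 0) ≤
      ∑ σ ∈ matchings G, (layerWeight p N * (if ∀ x, N x (σ x) = true then 1 else 0)) *
        (Φ (removeMatching G σ) / T) := by
    intro N
    have hs : ∑ σ ∈ matchings G, (layerWeight p N * (if ∀ x, N x (σ x) = true then 1 else 0)) *
        (Φ (removeMatching G σ) / T) = layerWeight p N *
          ((∑ σ ∈ matchings (sparsify G N), Φ (removeMatching G σ)) / T) := by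
      rw [matchings_sparsify, Finset.sum_filter, Finset.sum_div, Finset.mul_sum]
      refine Finset.sum_congr rfl fun σ _ => ?_
      split_ifs <;> ring
    rw [hs]
    refine mul_le_mul_of_nonneg_left ?_ (layerWeight_nonneg h0 h1 N)
    have hnn : 0 ≤ ∑ σ ∈ matchings (sparsify G N), Φ (removeMatching G σ) :=
      Finset.sum_nonneg fun _ _ => hΦ _
    split_ifs with h
    · exact div_le_div_of_nonneg_left hnn hT h
    · exact div_nonneg hnn hT.le
  refine (Finset.sum_le_sum fun N _ => hstep N).trans_eq ?_
  rw [Finset.sum_comm, Finset.mul_sum]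
  refine Finset.sum_congr rfl fun σ _ => ?_
  rw [← Finset.sum_mul, sum_layerWeight_perm]
  ring

/-- The `d`-regular bipartite graphs. -/
def regularGraphs (n d : ℕ) : Finset (Finset (Fin n × Fin n)) :=
  Finset.univ.filter fun G => IsBiRegular G d

theorem sum_removeMatching_le {n d : ℕ} (hd : d + 1 ≤ n)
    {Φ : Finset (Fin n × Fin n) → ℝ} (hΦ : ∀ G, 0 ≤ Φ G) :
    ∑ G ∈ regularGraphs n (d + 1), ∑ σ ∈ matchings G, Φ (removeMatching G σ) ≤
      Real.exp (logFact (n - d)) ^ n * ∑ G ∈ regularGraphs n d, Φ G := by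
  have hinj : ∑ G ∈ regularGraphs n (d + 1), ∑ σ ∈ matchings G, Φ (removeMatching G σ) ≤
      ∑ G ∈ regularGraphs n d, ∑ _σ ∈ matchings Gᶜ, Φ G := by
    rw [Finset.sum_sigma', Finset.sum_sigma']
    set g : (Σ _ : Finset (Fin n × Fin n), Equiv.Perm (Fin n)) →
      (Σ _ : Finset (Fin n × Fin n), Equiv.Perm (Fin n)) :=
      fun x => ⟨removeMatching x.1 x.2, x.2⟩ with hg
    have hgi : Set.InjOn g ((regularGraphs n (d + 1)).sigma fun G => matchings G) := by
      rintro ⟨G, σ⟩ hG ⟨G', σ'⟩ hG' heq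
      simp only [hg, Sigma.mk.injEq, heq_eq_eq] at heq
      obtain ⟨h1, rfl⟩ := heq
      have e1 := (Finset.mem_filter.mp (Finset.mem_sigma.mp hG).2).2
      have e2 := (Finset.mem_filter.mp (Finset.mem_sigma.mp hG').2).2
      suffices G = G' by rw [this]
      ext ⟨a, b⟩
      by_cases hab : σ a = b
      · subst hab
        exact iff_of_true (e1 a) (e2 a)
      · have := Finset.ext_iff.mp h1 (a, b)
        simpa [removeMatching, hab] using this
    rw [← Finset.sum_image (f := fun x => Φ x.1) hgi]
    refine Finset.sum_le_sum_of_subset_of_nonneg ?_ fun x _ _ => hΦ _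
    intro y hy
    obtain ⟨⟨G, σ⟩, hx, rfl⟩ := Finset.mem_image.mp hy
    rw [Finset.mem_sigma] at hx ⊢
    have hreg : IsBiRegular G (d + 1) := (Finset.mem_filter.mp hx.1).2
    refine ⟨Finset.mem_filter.mpr ⟨Finset.mem_univ _, hreg.removeMatching hx.2⟩,
      Finset.mem_filter.mpr ⟨Finset.mem_univ _, fun x => ?_⟩⟩
    simp [hg, removeMatching]
  refine hinj.trans ?_
  rw [Finset.mul_sum]
  refine Finset.sum_le_sum fun G hG => ?_
  rw [Finset.sum_const, nsmul_eq_mul]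
  refine mul_le_mul_of_nonneg_right ?_ (hΦ G)
  refine (card_matchings_le Gᶜ).trans_eq ?_
  have hG' : IsBiRegular G d := (Finset.mem_filter.mp hG).2
  have : ∀ u, rowDeg Gᶜ u = n - d := fun u => by
    have h1 := rowDeg_add_rowDeg_compl G u
    have h2 := hG'.1 u
    omega
  simp [this]

theorem survivalSum_mono {n m : ℕ} {p : ℝ} (h0 : 0 ≤ p) (h1 : p ≤ 1) (δ : ℝ) (j : ℕ)
    {Φ Ψ : Finset (Fin n × Fin n) → ℝ}
    (h : ∀ ω : Fin m → StepRand n, NoAbortBefore n m p δ j (fun i => (ω i).1) (fun i => (ω i).2) →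
      Φ (stepG n m (fun i => (ω i).1) (fun i => (ω i).2) j) ≤
        Ψ (stepG n m (fun i => (ω i).1) (fun i => (ω i).2) j)) :
    survivalSum n m p δ j Φ ≤ survivalSum n m p δ j Ψ := by
  refine Finset.sum_le_sum fun ω _ => mul_le_mul_of_nonneg_left ?_
    (Finset.prod_nonneg fun i _ => stepWeight_nonneg h0 h1 _)
  split_ifs with hω
  · exact h ω hω
  · exact le_rfl

theorem survivalSum_le {n m : ℕ} {p : ℝ} (h0 : 0 ≤ p) (h1 : p ≤ 1) {δ : ℝ}
    (hT : ∀ j < m, 0 < matchThreshold n p δ j) (hmn : m ≤ n) :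
    ∀ {j : ℕ}, j ≤ m → ∀ {Φ : Finset (Fin n × Fin n) → ℝ}, (∀ G, 0 ≤ Φ G) →
      survivalSum n m p δ j Φ ≤
        (∏ k ∈ Finset.range j,
          p ^ n / matchThreshold n p δ k * Real.exp (logFact (k + 1)) ^ n) *
          ∑ G ∈ regularGraphs n (n - j), Φ G
  | 0, _, Φ, hΦ => by
    rw [survivalSum_zero, Finset.prod_range_zero, one_mul]
    refine Finset.single_le_sum (f := Φ) (fun G _ => hΦ G)
      (Finset.mem_filter.mpr ⟨Finset.mem_univ _, ?_⟩)
    exact ⟨rowDeg_univ, colDeg_univ⟩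
  | j + 1, hj, Φ, hΦ => by
    have hjm : j < m := hj
    have hT' := hT j hjm
    rw [survivalSum_succ n m p δ hjm]
    have hΦ' : ∀ G : Finset (Fin n × Fin n),
        0 ≤ p ^ n / matchThreshold n p δ j * ∑ σ ∈ matchings G, Φ (removeMatching G σ) :=
      fun G => mul_nonneg (by positivity) (Finset.sum_nonneg fun _ _ => hΦ _)
    refine (survivalSum_mono h0 h1 δ j (Ψ := fun G => p ^ n / matchThreshold n p δ j *
      ∑ σ ∈ matchings G, Φ (removeMatching G σ)) fun ω _ => stepOp_le h0 h1 hT' hΦ _).trans ?_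
    refine (survivalSum_le h0 h1 hT hmn hjm.le hΦ').trans ?_
    rw [Finset.prod_range_succ, mul_assoc]
    refine mul_le_mul_of_nonneg_left ?_ (Finset.prod_nonneg fun k hk => ?_)
    · rw [← Finset.mul_sum, mul_assoc]
      refine mul_le_mul_of_nonneg_left ?_ (by positivity)
      have hd : n - j = (n - (j + 1)) + 1 := by omega
      have h := sum_removeMatching_le (n := n) (d := n - (j + 1)) (by omega) hΦ
      rw [hd]
      refine h.trans_eq ?_
      have : n - (n - (j + 1)) = j + 1 := by omega
      rw [this]
    · have := hT k (by have := Finset.mem_range.mp hk; omega)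
      positivity

theorem isBiRegular_stepG {n m : ℕ} {p δ : ℝ} (hT : ∀ j < m, 0 < matchThreshold n p δ j)
    (hmn : m ≤ n) (M : Fin m → Fin n → Fin n → Bool)
    (ρ : Fin m → Equiv.Perm (Fin (Nat.factorial n))) :
    ∀ {j : ℕ}, j ≤ m → NoAbortBefore n m p δ j M ρ → IsBiRegular (stepG n m M ρ j) (n - j)
  | 0, _, _ => ⟨rowDeg_univ, colDeg_univ⟩
  | j + 1, hj, h => by
    rw [noAbortBefore_succ] at h
    have ih := isBiRegular_stepG hT hmn M ρ (by omega) h.1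
    have hne : (matchings (sparsify (stepG n m M ρ j) (extM n m M j))).Nonempty := by
      rw [← Finset.card_pos]
      exact_mod_cast (hT j hj).trans_le h.2
    rw [stepG_succ, nextGraph, dif_pos hne]
    have hd : n - j = (n - (j + 1)) + 1 := by omega
    rw [hd] at ih
    refine ih.removeMatching ?_
    have := chooseMatching_mem (extρ n m ρ j) _ hne
    exact (Finset.mem_filter.mp ((Finset.ext_iff.mp (matchings_sparsify _ _) _).mp this)).1

theorem stepOp_one {n : ℕ} (p : ℝ) {T : ℝ} (hT : 0 < T) (G : Finset (Fin n × Fin n)) :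
    stepOp p T (fun _ => 1) G = ∑ N, layerWeight p N *
      (if T ≤ ((matchings (sparsify G N)).card : ℝ) then 1 else 0) := by
  rw [stepOp_eq p hT]
  refine Finset.sum_congr rfl fun N _ => ?_
  split_ifs with h
  · have : ((matchings (sparsify G N)).card : ℝ) ≠ 0 := (hT.trans_le h).ne'
    rw [Finset.sum_const, nsmul_eq_mul, mul_one, div_self this]
  · rfl

theorem le_survivalSum_one {n m : ℕ} {p : ℝ} (h0 : 0 ≤ p) (h1 : p ≤ 1) {δ q : ℝ} (hq : 0 ≤ q)
    (hT : ∀ j < m, 0 < matchThreshold n p δ j) (hmn : m ≤ n)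
    (hstep : ∀ j < m, ∀ G : Finset (Fin n × Fin n), IsBiRegular G (n - j) →
      q ≤ ∑ N, layerWeight p N *
        (if matchThreshold n p δ j ≤ ((matchings (sparsify G N)).card : ℝ) then 1 else 0)) :
    ∀ {j : ℕ}, j ≤ m → q ^ j ≤ survivalSum n m p δ j fun _ => 1
  | 0, _ => by rw [survivalSum_zero, pow_zero]
  | j + 1, hj => by
    have ih := le_survivalSum_one h0 h1 hq hT hmn hstep (j := j) (by omega)
    rw [survivalSum_succ n m p δ hj]
    have h2 : survivalSum n m p δ j (fun _ => q) ≤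
        survivalSum n m p δ j (stepOp p (matchThreshold n p δ j) fun _ => 1) := by
      refine survivalSum_mono h0 h1 δ j fun ω hω => ?_
      rw [stepOp_one p (hT j hj)]
      exact hstep j hj _ (isBiRegular_stepG hT hmn _ _ (by omega) hω)
    have h3 : survivalSum n m p δ j (fun _ => q) = q * survivalSum n m p δ j fun _ => 1 := by
      unfold survivalSum
      rw [Finset.mul_sum]
      refine Finset.sum_congr rfl fun ω _ => ?_
      split_ifs <;> ring
    rw [pow_succ']
    exact (mul_le_mul_of_nonneg_left ih hq).trans (h3 ▸ h2)

theorem log_factorial_le {d : ℕ} (hd : 1 ≤ d) :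
    Real.log (d.factorial) ≤ 1 + Real.log d + d * Real.log d - d := by
  induction d, hd using Nat.le_induction with
  | base => simp
  | succ d hd ih =>
    have hd0 : (0 : ℝ) < d := by exact_mod_cast hd
    rw [Nat.factorial_succ]
    push_cast
    rw [Real.log_mul (by positivity) (by positivity)]
    have h1 := Real.one_sub_inv_le_log_of_pos (x := ((d : ℝ) + 1) / d) (by positivity)
    rw [Real.log_div (by positivity) (by positivity)] at h1
    have h2 : 1 - (((d : ℝ) + 1) / d)⁻¹ = 1 / (d + 1) := by field_simp; ring
    rw [h2] at h1
    have h3 := mul_le_mul_of_nonneg_left h1 (show (0 : ℝ) ≤ d + 1 by positivity)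
    rw [mul_one_div_cancel (by positivity)] at h3
    nlinarith

theorem exp_two_mul_le {x : ℝ} (h0 : 0 ≤ x) (h1 : x ≤ 1) : Real.exp (2 * x) ≤ 1 + 7 * x := by
  have h := convexOn_exp.2 (Set.mem_univ (0 : ℝ)) (Set.mem_univ (2 : ℝ))
    (show 0 ≤ 1 - x by linarith) h0 (by ring)
  simp only [smul_eq_mul, mul_zero, zero_add, Real.exp_zero, mul_one] at h
  have h2 : Real.exp 2 ≤ 8 := by
    have : Real.exp 2 = Real.exp 1 * Real.exp 1 := by rw [← Real.exp_add]; norm_num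
    rw [this]
    nlinarith [Real.exp_one_lt_d9, Real.exp_pos 1]
  rw [mul_comm x 2] at h
  nlinarith

theorem logFact_le {d : ℕ} (hd : 1 ≤ d) : logFact d ≤ Real.log d - 1 + 2 * (1 / √d) := by
  have hd0 : (0 : ℝ) < d := by exact_mod_cast hd
  have hs : 0 < √(d : ℝ) := Real.sqrt_pos.mpr hd0
  have hss : √(d : ℝ) * √d = d := Real.mul_self_sqrt hd0.le
  have hlog : 1 + Real.log d ≤ 2 * √d := by
    have h := Real.log_le_sub_one_of_pos hs
    rw [Real.log_sqrt hd0.le] at h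
    linarith
  rw [logFact, div_le_iff₀ hd0]
  have h2 : 2 * (1 / √(d : ℝ)) * d = 2 * √d := by
    field_simp
    nlinarith
  nlinarith [log_factorial_le hd]

theorem exp_logFact_le (d : ℕ) :
    Real.exp (logFact d) ≤ (d + 7 * √d + 3) / Real.exp 1 := by
  rcases Nat.eq_zero_or_pos d with rfl | hd
  · simp only [logFact, Nat.factorial_zero, Nat.cast_one, Real.log_one, zero_div, Real.exp_zero]
    rw [le_div_iff₀ (Real.exp_pos 1)]
    have := Real.exp_one_lt_d9
    simp only [CharP.cast_eq_zero, Real.sqrt_zero]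
    linarith
  · have hd0 : (0 : ℝ) < d := by exact_mod_cast hd
    have hs : 0 < √(d : ℝ) := Real.sqrt_pos.mpr hd0
    have hs1 : 1 ≤ √(d : ℝ) := Real.one_le_sqrt.mpr (by exact_mod_cast hd)
    have hss : √(d : ℝ) * √d = d := Real.mul_self_sqrt hd0.le
    refine (Real.exp_le_exp.mpr (logFact_le hd)).trans ?_
    rw [Real.exp_add, Real.exp_sub, Real.exp_log hd0]
    have h3 := exp_two_mul_le (x := 1 / √(d : ℝ)) (by positivity)
      (by rw [div_le_one hs]; exact hs1)
    refine (mul_le_mul_of_nonneg_left h3 (by positivity)).trans ?_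
    rw [div_mul_eq_mul_div]
    gcongr
    have h4 : (d : ℝ) * (1 + 7 * (1 / √d)) = d + 7 * √d := by
      field_simp
      nlinarith
    linarith

theorem exp_logFact_le_linear {s : ℝ} (hs : 1 ≤ s) (d : ℕ) :
    Real.exp (logFact d) ≤ ((1 + 7 / (2 * s)) * d + 13 / 2 * s) / Real.exp 1 := by
  refine (exp_logFact_le d).trans ?_
  refine div_le_div_of_nonneg_right ?_ (Real.exp_pos 1).le
  have hd : √(d : ℝ) * √d = d := Real.mul_self_sqrt (Nat.cast_nonneg d)
  have h : √(d : ℝ) ≤ (d / s + s) / 2 := by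
    have h1 : (d / s + s) / 2 - √(d : ℝ) = (√d - s) ^ 2 / (2 * s) := by
      field_simp
      nlinarith
    have h2 : 0 ≤ (√(d : ℝ) - s) ^ 2 / (2 * s) := by positivity
    linarith
  have h3 : (1 + 7 / (2 * s)) * d = d + 7 * (d / s / 2) := by field_simp
  rw [h3]
  linarith

/-- The number of selected elements of `s`. -/
def selCard {n : ℕ} (s : Finset (Fin n)) (b : Fin n → Bool) : ℕ :=
  (s.filter fun c => b c = true).card

theorem selCard_eq_sum {n : ℕ} (s : Finset (Fin n)) (b : Fin n → Bool) :
    (selCard s b : ℝ) = ∑ c ∈ s, if b c = true then (1 : ℝ) else 0 := by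
  rw [selCard, Finset.card_filter]
  push_cast
  rfl

/-- The probability weight of one row of the random array. -/
def rowWeight {n : ℕ} (p : ℝ) (b : Fin n → Bool) : ℝ := ∏ c, if b c = true then p else 1 - p

theorem rowWeight_nonneg {n : ℕ} {p : ℝ} (h0 : 0 ≤ p) (h1 : p ≤ 1) (b : Fin n → Bool) :
    0 ≤ rowWeight p b :=
  Finset.prod_nonneg fun _ _ => by split_ifs <;> linarith

theorem sum_rowWeight {n : ℕ} (p : ℝ) : ∑ b : Fin n → Bool, rowWeight p b = 1 := by
  have := sum_bool_weight p (∅ : Finset (Fin n))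
  simpa [rowWeight] using this

theorem sum_rowWeight_selCard {n : ℕ} (p : ℝ) (s : Finset (Fin n)) :
    ∑ b : Fin n → Bool, rowWeight p b * selCard s b = s.card * p := by
  have h : ∀ b : Fin n → Bool, rowWeight p b * selCard s b = ∑ c ∈ s,
      rowWeight p b * (if ∀ x ∈ ({c} : Finset (Fin n)), b x = true then 1 else 0) := by
    intro b
    rw [selCard_eq_sum, Finset.mul_sum]
    simp
  rw [Finset.sum_congr rfl fun b _ => h b, Finset.sum_comm]
  simp only [rowWeight]
  rw [Finset.sum_congr rfl fun c _ => sum_bool_weight p _]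
  simp

theorem sum_rowWeight_selCard_sq_le {n : ℕ} (p : ℝ) (s : Finset (Fin n)) :
    ∑ b : Fin n → Bool, rowWeight p b * (selCard s b : ℝ) ^ 2
      ≤ (s.card * p) ^ 2 + s.card * p := by
  have h : ∀ b : Fin n → Bool, rowWeight p b * (selCard s b : ℝ) ^ 2 = ∑ c ∈ s, ∑ c' ∈ s,
      rowWeight p b * (if ∀ x ∈ ({c, c'} : Finset (Fin n)), b x = true then 1 else 0) := by
    intro b
    rw [selCard_eq_sum, sq, Finset.sum_mul_sum, Finset.mul_sum]
    refine Finset.sum_congr rfl fun c _ => ?_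
    rw [Finset.mul_sum]
    refine Finset.sum_congr rfl fun c' _ => ?_
    by_cases h1 : b c = true <;> by_cases h2 : b c' = true <;> simp [h1, h2]
  rw [Finset.sum_congr rfl fun b _ => h b, Finset.sum_comm]
  simp only [rowWeight]
  have h2 : ∀ c ∈ s, ∑ b : Fin n → Bool, ∑ c' ∈ s,
      (∏ x, if b x = true then p else 1 - p) *
        (if ∀ x ∈ ({c, c'} : Finset (Fin n)), b x = true then 1 else 0)
      ≤ s.card * p ^ 2 + p := by
    intro c hc
    rw [Finset.sum_comm, Finset.sum_congr rfl fun c' _ => sum_bool_weight p _]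
    have h3 : ∀ c' ∈ s, p ^ ({c, c'} : Finset (Fin n)).card ≤
        p ^ 2 + if c' = c then p else 0 := by
      intro c' _
      split_ifs with hcc
      · subst hcc
        simp only [Finset.pair_eq_singleton, Finset.card_singleton, pow_one]
        nlinarith [sq_nonneg p]
      · rw [Finset.card_pair (Ne.symm hcc), add_zero]
    refine (Finset.sum_le_sum h3).trans_eq ?_
    rw [Finset.sum_add_distrib, Finset.sum_const, nsmul_eq_mul, Finset.sum_ite_eq' s c, if_pos hc]
  refine (Finset.sum_le_sum h2).trans_eq ?_
  rw [Finset.sum_const, nsmul_eq_mul]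
  ring

theorem sum_rowWeight_exp_le {n : ℕ} {p : ℝ} (h0 : 0 ≤ p) (h1 : p ≤ 1) (s : Finset (Fin n))
    {t : ℝ} (ht : 1 ≤ t) (hμ : s.card * p = t ^ 2) :
    ∑ b : Fin n → Bool, rowWeight p b * Real.exp (logFact (selCard s b)) ^ 2
      ≤ (t ^ 2 / Real.exp 1) ^ 2 * (1 + 141 / t) := by
  have ht0 : 0 < t := by linarith
  set a := 1 + 7 / (2 * t) with ha
  set d := 13 / 2 * t with hd
  have hpt : ∀ b : Fin n → Bool, rowWeight p b * Real.exp (logFact (selCard s b)) ^ 2 ≤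
      (a ^ 2 * (rowWeight p b * (selCard s b : ℝ) ^ 2) +
        2 * a * d * (rowWeight p b * selCard s b) + d ^ 2 * rowWeight p b) / Real.exp 1 ^ 2 := by
    intro b
    have h2 := exp_logFact_le_linear ht (selCard s b)
    have h3 := pow_le_pow_left₀ (Real.exp_pos _).le h2 2
    refine (mul_le_mul_of_nonneg_left h3 (rowWeight_nonneg h0 h1 b)).trans_eq ?_
    rw [div_pow]
    ring
  refine (Finset.sum_le_sum fun b _ => hpt b).trans ?_
  rw [← Finset.sum_div, Finset.sum_add_distrib, Finset.sum_add_distrib, ← Finset.mul_sum,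
    ← Finset.mul_sum, ← Finset.mul_sum, sum_rowWeight, sum_rowWeight_selCard, hμ, div_pow,
    div_mul_eq_mul_div]
  have h4 := sum_rowWeight_selCard_sq_le p s
  rw [hμ] at h4
  gcongr
  have ha0 : 0 ≤ a := by positivity
  have h5 := mul_le_mul_of_nonneg_left h4 (sq_nonneg a)
  refine (add_le_add_left (add_le_add_left h5 _) _).trans ?_
  have e1 : a = (2 * t + 7) / (2 * t) := by rw [ha]; field_simp
  have e2 : (t ^ 2) ^ 2 * (1 + 141 / t) -
        (a ^ 2 * ((t ^ 2) ^ 2 + t ^ 2) + 2 * a * d * t ^ 2 + d ^ 2 * 1)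
      = t ^ 3 * 141 - (7 * t ^ 3 + 49 / 4 * t ^ 2 + t ^ 2 + 7 * t + 49 / 4)
        - 13 / 2 * (2 * t + 7) * t ^ 2 - 169 / 4 * t ^ 2 := by
    rw [e1, hd]
    field_simp
    ring
  have e3 : t ≤ t ^ 3 := by nlinarith [mul_pos ht0 ht0]
  have e4 : t ^ 2 ≤ t ^ 3 := by nlinarith [mul_pos ht0 ht0]
  nlinarith

/-- A second-moment lower bound for the probability that a nonnegative variable is at least `T`. -/
theorem sq_mean_le_four_mul {α : Type*} [Fintype α] {w X : α → ℝ} (hw : ∀ a, 0 ≤ w a)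
    (hw1 : ∑ a, w a = 1) (hX : ∀ a, 0 ≤ X a) {T : ℝ} (hT0 : 0 ≤ T)
    (hT : 2 * T ≤ ∑ a, w a * X a) :
    (∑ a, w a * X a) ^ 2 ≤
      4 * ((∑ a, w a * X a ^ 2) * ∑ a, w a * (if T ≤ X a then 1 else 0)) := by
  have h1 : ∑ a, w a * X a ≤ T + ∑ a, w a * X a * (if T ≤ X a then 1 else 0) := by
    have h2 : ∀ a, w a * X a ≤ w a * T + w a * X a * (if T ≤ X a then 1 else 0) := by
      intro a
      split_ifs with h
      · have := mul_nonneg (hw a) hT0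
        linarith
      · have := mul_le_mul_of_nonneg_left (not_le.mp h).le (hw a)
        linarith
    refine (Finset.sum_le_sum fun a _ => h2 a).trans_eq ?_
    rw [Finset.sum_add_distrib, ← Finset.sum_mul, hw1, one_mul]
  have h3 : (∑ a, w a * X a * (if T ≤ X a then 1 else 0)) ^ 2 ≤
      (∑ a, w a * X a ^ 2) * ∑ a, w a * (if T ≤ X a then 1 else 0) := by
    refine Finset.sum_sq_le_sum_mul_sum_of_sq_le_mul _ (fun a _ => ?_) (fun a _ => ?_) fun a _ => ?_
    · exact mul_nonneg (hw a) (sq_nonneg _)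
    · exact mul_nonneg (hw a) (by split_ifs <;> norm_num)
    · split_ifs <;> exact le_of_eq (by ring)
  have h4 : 0 ≤ ∑ a, w a * X a := Finset.sum_nonneg fun a _ => mul_nonneg (hw a) (hX a)
  have h5 : (∑ a, w a * X a) / 2 ≤ ∑ a, w a * X a * (if T ≤ X a then 1 else 0) := by linarith
  have h6 := pow_le_pow_left₀ (by positivity) h5 2
  nlinarith

theorem sum_layerWeight_card_matchings {n : ℕ} (p : ℝ) (G : Finset (Fin n × Fin n)) :
    ∑ N, layerWeight p N * ((matchings (sparsify G N)).card : ℝ)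
      = p ^ n * ((matchings G).card : ℝ) := by
  have h : ∀ N, layerWeight p N * ((matchings (sparsify G N)).card : ℝ)
      = ∑ σ ∈ matchings G, layerWeight p N * (if ∀ x, N x (σ x) = true then 1 else 0) := by
    intro N
    rw [matchings_sparsify, Finset.card_filter, ← Finset.mul_sum]
    push_cast
    rfl
  rw [Finset.sum_congr rfl fun N _ => h N, Finset.sum_comm,
    Finset.sum_congr rfl fun σ _ => sum_layerWeight_perm p σ, Finset.sum_const, nsmul_eq_mul,
    mul_comm]

theorem rowDeg_eq_card {n : ℕ} (G : Finset (Fin n × Fin n)) (u : Fin n) :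
    rowDeg G u = (Finset.univ.filter fun c => (u, c) ∈ G).card := by
  unfold rowDeg
  refine Finset.card_bij' (fun e _ => e.2) (fun c _ => (u, c)) ?_ ?_ ?_ ?_
  · rintro ⟨a, b⟩ h
    obtain ⟨h1, rfl⟩ := Finset.mem_filter.mp h
    simpa using h1
  · intro c hc
    simpa using hc
  · rintro ⟨a, b⟩ h
    obtain ⟨h1, rfl⟩ := Finset.mem_filter.mp h
    rfl
  · intro c hc
    rfl

theorem sum_layerWeight_card_matchings_sq_le {n k : ℕ} {p : ℝ} (h0 : 0 ≤ p) (h1 : p ≤ 1)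
    {G : Finset (Fin n × Fin n)} (hG : IsBiRegular G k) {t : ℝ} (ht : 1 ≤ t)
    (hμ : k * p = t ^ 2) :
    ∑ N, layerWeight p N * ((matchings (sparsify G N)).card : ℝ) ^ 2
      ≤ ((t ^ 2 / Real.exp 1) ^ 2 * (1 + 141 / t)) ^ n := by
  set s : Fin n → Finset (Fin n) := fun u => Finset.univ.filter fun c => (u, c) ∈ G with hs
  have hcard : ∀ u, (s u).card = k := fun u => by rw [← hG.1 u, rowDeg_eq_card]
  have hdeg : ∀ N u, rowDeg (sparsify G N) u = selCard (s u) (N u) := by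
    intro N u
    rw [rowDeg_eq_card, selCard, hs, Finset.filter_filter]
    simp [sparsify]
  have hpt : ∀ N : Fin n → Fin n → Bool,
      layerWeight p N * ((matchings (sparsify G N)).card : ℝ) ^ 2 ≤
      ∏ u, (fun u b => rowWeight p b * Real.exp (logFact (selCard (s u) b)) ^ 2) u (N u) := by
    intro N
    rw [Finset.prod_mul_distrib]
    refine mul_le_mul_of_nonneg_left ?_ (layerWeight_nonneg h0 h1 N)
    rw [Finset.prod_pow]
    refine pow_le_pow_left₀ (Nat.cast_nonneg _) ((card_matchings_le _).trans_eq ?_) 2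
    exact Finset.prod_congr rfl fun u _ => by rw [hdeg]
  refine (Finset.sum_le_sum fun N _ => hpt N).trans ?_
  refine (sum_layer_prod fun u b =>
    rowWeight p b * Real.exp (logFact (selCard (s u) b)) ^ 2).trans_le ?_
  refine (Finset.prod_le_prod (fun u _ => Finset.sum_nonneg fun b _ =>
    mul_nonneg (rowWeight_nonneg h0 h1 b) (by positivity)) fun u _ =>
    sum_rowWeight_exp_le h0 h1 (s u) ht (by rw [hcard, hμ])).trans_eq ?_
  simp

theorem le_sum_layerWeight_of_isBiRegular {n k : ℕ} {p : ℝ} (h0 : 0 ≤ p) (h1 : p ≤ 1)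
    {G : Finset (Fin n × Fin n)} (hG : IsBiRegular G k) {t : ℝ} (ht : 1 ≤ t)
    (hμ : k * p = t ^ 2) {T : ℝ} (hT0 : 0 ≤ T) (hT : 2 * T ≤ (t ^ 2 / Real.exp 1) ^ n) :
    Real.exp (-(141 * n / t)) / 4 ≤ ∑ N, layerWeight p N *
        (if T ≤ ((matchings (sparsify G N)).card : ℝ) then 1 else 0) := by
  have ht0 : 0 < t := by linarith
  have hk : k ≠ 0 := by
    rintro rfl
    simp only [CharP.cast_eq_zero, zero_mul] at hμ
    exact (pow_pos ht0 2).ne hμ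
  set P := ∑ N, layerWeight p N *
        (if T ≤ ((matchings (sparsify G N)).card : ℝ) then (1 : ℝ) else 0) with hP
  have hP0 : 0 ≤ P := Finset.sum_nonneg fun N _ =>
    mul_nonneg (layerWeight_nonneg h0 h1 N) (by split_ifs <;> norm_num)
  have hE : (t ^ 2 / Real.exp 1) ^ n ≤
      ∑ N, layerWeight p N * ((matchings (sparsify G N)).card : ℝ) := by
    rw [sum_layerWeight_card_matchings]
    refine Eq.trans_le ?_ (mul_le_mul_of_nonneg_left (card_matchings_ge hk hG) (pow_nonneg h0 n))
    rw [← hμ, div_pow, ← Real.exp_nat_mul, mul_one, Real.exp_neg, mul_pow]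
    ring
  have h2 := sq_mean_le_four_mul (layerWeight_nonneg h0 h1) (sum_layerWeight p)
    (fun N => Nat.cast_nonneg (matchings (sparsify G N)).card) hT0 (hT.trans hE)
  have hb : 0 < (t ^ 2 / Real.exp 1) ^ n := by positivity
  have h3 := (pow_le_pow_left₀ hb.le hE 2).trans h2
  have h4 := sum_layerWeight_card_matchings_sq_le h0 h1 hG ht hμ
  have h5 : ((t ^ 2 / Real.exp 1) ^ 2 * (1 + 141 / t)) ^ n ≤
      ((t ^ 2 / Real.exp 1) ^ n) ^ 2 * Real.exp (141 * n / t) := by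
    rw [mul_pow, ← pow_mul, ← pow_mul, mul_comm 2 n]
    refine mul_le_mul_of_nonneg_left ?_ (by positivity)
    have h6 : 1 + 141 / t ≤ Real.exp (141 / t) := by
      rw [add_comm]; exact Real.add_one_le_exp _
    refine (pow_le_pow_left₀ (by positivity) h6 n).trans_eq ?_
    rw [← Real.exp_nat_mul]
    congr 1
    ring
  have h7 := h3.trans (mul_le_mul_of_nonneg_left
    (mul_le_mul_of_nonneg_right (h4.trans h5) hP0) (by norm_num : (0 : ℝ) ≤ 4))
  have h8 : 1 ≤ 4 * (Real.exp (141 * n / t) * P) := by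
    have h9 : ((t ^ 2 / Real.exp 1) ^ n) ^ 2 * 1 ≤
        ((t ^ 2 / Real.exp 1) ^ n) ^ 2 * (4 * (Real.exp (141 * n / t) * P)) := by
      rw [mul_one]
      refine h7.trans_eq ?_
      ring
    exact le_of_mul_le_mul_left h9 (by positivity)
  rw [Real.exp_neg, div_le_iff₀ (by norm_num), inv_le_iff_one_le_mul₀ (Real.exp_pos _)]
  linarith

theorem sum_rowDeg {n : ℕ} (G : Finset (Fin n × Fin n)) : ∑ u, rowDeg G u = G.card :=
  (Finset.card_eq_sum_card_fiberwise (f := Prod.fst) (t := Finset.univ)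
    fun _ _ => Finset.mem_univ _).symm

theorem IsBiRegular.card {n k : ℕ} {G : Finset (Fin n × Fin n)} (hG : IsBiRegular G k) :
    G.card = n * k := by
  rw [← sum_rowDeg, Finset.sum_congr rfl fun u _ => hG.1 u]
  simp

theorem one_sub_add_mul_exp_neg_le {r c : ℝ} (hr : 0 ≤ r) (hc : 0 ≤ c) :
    1 - r + r * Real.exp (-c) ≤ Real.exp (-(r * (c - c ^ 2 / 2))) := by
  have h1 : Real.exp (-c) ≤ 1 - c + c ^ 2 / 2 := by
    rw [Real.exp_neg]
    have h2 := Real.quadratic_le_exp_of_nonneg hc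
    have h3 : 0 < 1 + c + c ^ 2 / 2 := by positivity
    refine (inv_anti₀ h3 h2).trans ?_
    rw [inv_le_iff_one_le_mul₀ h3]
    nlinarith [sq_nonneg (c ^ 2)]
  have h4 := Real.add_one_le_exp (-(r * (c - c ^ 2 / 2)))
  nlinarith

theorem card_sparse_pair_mul_le {n k : ℕ} (hk : k ≤ n) (hn : n ≠ 0) (X Y : Finset (Fin n)) {c : ℝ}
    (hc : 0 ≤ c) :
    (((regularGraphs n k).filter fun G => (edgesBetween G X Y : ℝ) <
        (1 - c) * X.card * Y.card * k / n).card : ℝ) *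
      (((k : ℝ) / n) ^ (n * k) * (1 - (k : ℝ) / n) ^ (n * (n - k)))
      ≤ Real.exp (-(X.card * Y.card * ((k : ℝ) / n) * c ^ 2 / 2)) := by
  set r : ℝ := (k : ℝ) / n with hr
  have hn0 : (0 : ℝ) < n := by exact_mod_cast Nat.pos_of_ne_zero hn
  have hr0 : 0 ≤ r := by positivity
  have hr1 : r ≤ 1 := by
    rw [hr, div_le_one hn0]
    exact_mod_cast hk
  set thr : ℝ := (1 - c) * X.card * Y.card * k / n with hthr
  set g : Fin n × Fin n → ℝ := fun e => if e ∈ X ×ˢ Y then r * Real.exp (-c) else r with hg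
  have hprod := Finset.prod_add g (fun _ => 1 - r) (Finset.univ : Finset (Fin n × Fin n))
  have hlhs : ∏ e : Fin n × Fin n, (g e + (1 - r)) =
      (1 - r + r * Real.exp (-c)) ^ (X.card * Y.card) := by
    have : ∀ e : Fin n × Fin n, g e + (1 - r) =
        if e ∈ X ×ˢ Y then 1 - r + r * Real.exp (-c) else 1 := by
      intro e
      simp only [hg]
      split_ifs <;> ring
    rw [Finset.prod_congr rfl fun e _ => this e, Finset.prod_ite_mem, Finset.univ_inter,
      Finset.prod_const, Finset.card_product]
  have hterm : ∀ G ∈ (regularGraphs n k).filter fun G => (edgesBetween G X Y : ℝ) < thr,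
      r ^ (n * k) * (1 - r) ^ (n * (n - k)) * Real.exp (-(c * thr)) ≤
        (∏ e ∈ G, g e) * ∏ e ∈ Finset.univ \ G, (1 - r) := by
    intro G hG
    obtain ⟨h1, h2⟩ := Finset.mem_filter.mp hG
    have hreg : IsBiRegular G k := (Finset.mem_filter.mp h1).2
    have hgG : ∏ e ∈ G, g e = r ^ (n * k) * Real.exp (-c) ^ (edgesBetween G X Y) := by
      have : ∀ e, g e = r * (if e.1 ∈ X ∧ e.2 ∈ Y then Real.exp (-c) else 1) := by
        intro e
        simp only [hg, Finset.mem_product]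
        split_ifs <;> ring
      rw [Finset.prod_congr rfl fun e _ => this e, Finset.prod_mul_distrib, Finset.prod_const,
        hreg.card, ← Finset.prod_filter, Finset.prod_const, edgesBetween]
    have hcompl : (Finset.univ \ G).card = n * (n - k) := by
      rw [Finset.card_univ_sdiff, hreg.card, Fintype.card_prod, Fintype.card_fin, Nat.mul_sub]
    rw [hgG, Finset.prod_const, hcompl, ← Real.exp_nat_mul, mul_right_comm]
    refine mul_le_mul_of_nonneg_right (mul_le_mul_of_nonneg_left (Real.exp_le_exp.mpr ?_)
      (by positivity)) (pow_nonneg (by linarith) _)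
    nlinarith
  have hsum : (((regularGraphs n k).filter fun G => (edgesBetween G X Y : ℝ) < thr).card : ℝ) *
      (r ^ (n * k) * (1 - r) ^ (n * (n - k)) * Real.exp (-(c * thr))) ≤
        (1 - r + r * Real.exp (-c)) ^ (X.card * Y.card) := by
    rw [← hlhs, hprod, ← nsmul_eq_mul]
    refine (Finset.card_nsmul_le_sum _ _ _ hterm).trans ?_
    refine Finset.sum_le_sum_of_subset_of_nonneg (fun G _ => by simp) fun G _ _ => ?_
    refine mul_nonneg (Finset.prod_nonneg fun e _ => ?_) (Finset.prod_nonneg fun _ _ => by linarith)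
    simp only [hg]
    split_ifs <;> positivity
  have hpow : (1 - r + r * Real.exp (-c)) ^ (X.card * Y.card) ≤
      Real.exp (-(X.card * Y.card * (r * (c - c ^ 2 / 2)))) := by
    refine (pow_le_pow_left₀ (by have := Real.exp_pos (-c); nlinarith)
      (one_sub_add_mul_exp_neg_le hr0 hc) _).trans_eq ?_
    rw [← Real.exp_nat_mul]
    congr 1
    push_cast
    ring
  have h3 := mul_le_mul_of_nonneg_right (hsum.trans hpow) (Real.exp_pos (c * thr)).le
  rw [← Real.exp_add] at h3
  have h4 : -(X.card * Y.card * (r * (c - c ^ 2 / 2))) + c * thr =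
      -((X.card : ℝ) * Y.card * r * c ^ 2 / 2) := by
    rw [hthr, hr]
    field_simp
    ring
  rw [h4] at h3
  refine Eq.trans_le ?_ h3
  rw [mul_assoc, mul_assoc, ← Real.exp_add]
  simp

theorem card_not_pseudorandom_mul_le {n k : ℕ} (hk : k ≤ n) (hn : n ≠ 0) {ε c : ℝ} (hε : 0 ≤ ε)
    (hc : 0 ≤ c) (hεk : ε * n ≤ k) :
    (((regularGraphs n k).filter fun G => ¬ Pseudorandom ε G k c).card : ℝ) *
      (((k : ℝ) / n) ^ (n * k) * (1 - (k : ℝ) / n) ^ (n * (n - k)))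
      ≤ 4 ^ n * Real.exp (-(ε ^ 3 / 200 * c ^ 2 * n ^ 2)) := by
  have hn0 : (0 : ℝ) < n := by exact_mod_cast Nat.pos_of_ne_zero hn
  have hr1 : (k : ℝ) / n ≤ 1 := by
    rw [div_le_one hn0]
    exact_mod_cast hk
  set D : ℝ := ((k : ℝ) / n) ^ (n * k) * (1 - (k : ℝ) / n) ^ (n * (n - k)) with hD
  have hD0 : 0 ≤ D := mul_nonneg (by positivity) (pow_nonneg (by linarith) _)
  set P : Finset (Finset (Fin n) × Finset (Fin n)) := Finset.univ.filter fun XY =>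
    (ε / 10) * n ≤ (XY.1.card : ℝ) ∧ (ε / 10) * n ≤ (XY.2.card : ℝ) with hP
  set F : Finset (Fin n) × Finset (Fin n) → Finset (Finset (Fin n × Fin n)) := fun XY =>
    (regularGraphs n k).filter fun G => (edgesBetween G XY.1 XY.2 : ℝ) <
      (1 - c) * XY.1.card * XY.2.card * k / n with hF
  have hsub : ((regularGraphs n k).filter fun G => ¬ Pseudorandom ε G k c) ⊆ P.biUnion F := by
    intro G hG
    obtain ⟨h1, h2⟩ := Finset.mem_filter.mp hG
    unfold Pseudorandom at h2
    push Not at h2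
    obtain ⟨X, Y, hX, hY, h3⟩ := h2
    exact Finset.mem_biUnion.mpr ⟨(X, Y), Finset.mem_filter.mpr ⟨Finset.mem_univ _, hX, hY⟩,
      Finset.mem_filter.mpr ⟨h1, h3⟩⟩
  have hcard : (((regularGraphs n k).filter fun G => ¬ Pseudorandom ε G k c).card : ℝ) ≤
      ∑ XY ∈ P, ((F XY).card : ℝ) := by
    exact_mod_cast (Finset.card_le_card hsub).trans Finset.card_biUnion_le
  refine (mul_le_mul_of_nonneg_right hcard hD0).trans ?_
  rw [Finset.sum_mul]
  have hterm : ∀ XY ∈ P, ((F XY).card : ℝ) * D ≤ Real.exp (-(ε ^ 3 / 200 * c ^ 2 * n ^ 2)) := by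
    intro XY hXY
    obtain ⟨-, hX, hY⟩ := Finset.mem_filter.mp hXY
    refine (card_sparse_pair_mul_le hk hn XY.1 XY.2 hc).trans (Real.exp_le_exp.mpr ?_)
    have h1 : (ε / 10 * n) * (ε / 10 * n) ≤ (XY.1.card : ℝ) * XY.2.card :=
      mul_le_mul hX hY (by positivity) (by positivity)
    have h2 : ε ≤ (k : ℝ) / n := by rwa [le_div_iff₀ hn0]
    have h3 : (ε / 10 * n) * (ε / 10 * n) * ε ≤ (XY.1.card : ℝ) * XY.2.card * (k / n) :=
      mul_le_mul h1 h2 hε (by positivity)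
    have h4 := mul_le_mul_of_nonneg_right h3 (sq_nonneg c)
    nlinarith
  refine (Finset.sum_le_sum hterm).trans ?_
  rw [Finset.sum_const, nsmul_eq_mul]
  refine mul_le_mul_of_nonneg_right ?_ (Real.exp_pos _).le
  have h5 : P.card ≤ 4 ^ n := by
    refine (Finset.card_le_univ P).trans_eq ?_
    rw [Fintype.card_prod, Fintype.card_finset, Fintype.card_fin, ← mul_pow]
    norm_num
  exact_mod_cast h5

theorem factorial_le_mul_div_exp_pow (d : ℕ) :
    (d.factorial : ℝ) ≤ Real.exp 1 * (d + 1) * (d / Real.exp 1) ^ d := by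
  rcases Nat.eq_zero_or_pos d with rfl | hd
  · simp
  · have hd0 : (0 : ℝ) < d := by exact_mod_cast hd
    have h1 := Real.exp_le_exp.mpr (log_factorial_le hd)
    rw [Real.exp_log (by positivity), Real.exp_sub, Real.exp_add, Real.exp_add,
      Real.exp_log hd0, Real.exp_nat_mul, Real.exp_log hd0] at h1
    refine h1.trans ?_
    rw [div_pow, ← Real.exp_nat_mul, mul_one, mul_div_assoc]
    gcongr
    linarith

theorem div_exp_pow_le_factorial (d : ℕ) : ((d : ℝ) / Real.exp 1) ^ d ≤ d.factorial := by
  rw [div_pow, ← Real.exp_nat_mul, mul_one, div_le_iff₀ (Real.exp_pos _)]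
  have h := Real.pow_div_factorial_le_exp (d : ℝ) (Nat.cast_nonneg d) d
  rw [div_le_iff₀ (by positivity)] at h
  linarith

theorem exp_one_mul_exp_logFact_succ_le (j : ℕ) :
    Real.exp 1 * Real.exp (logFact (j + 1)) ≤
      (j + 1) * Real.exp (4 * (√(j + 1 : ℕ) - √j)) := by
  have h1 := logFact_le (Nat.le_add_left 1 j)
  have hj0 : (0 : ℝ) < (j + 1 : ℕ) := by positivity
  have hs : 0 < √((j + 1 : ℕ) : ℝ) := Real.sqrt_pos.mpr hj0
  have hle : √(j : ℝ) ≤ √((j + 1 : ℕ) : ℝ) := Real.sqrt_le_sqrt (by push_cast; linarith)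
  have e1 : √((j + 1 : ℕ) : ℝ) * √((j + 1 : ℕ) : ℝ) = j + 1 := by
    rw [Real.mul_self_sqrt hj0.le]
    push_cast
    rfl
  have e2 : √(j : ℝ) * √j = j := Real.mul_self_sqrt (Nat.cast_nonneg j)
  have h2 : 2 * (1 / √((j + 1 : ℕ) : ℝ)) ≤ 4 * (√(j + 1 : ℕ) - √j) := by
    rw [mul_one_div, div_le_iff₀ hs]
    nlinarith [Real.sqrt_nonneg (j : ℝ)]
  have hcast : ((j : ℝ) + 1) = ((j + 1 : ℕ) : ℝ) := by push_cast; rfl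
  rw [hcast, ← Real.exp_log hj0, ← Real.exp_add, ← Real.exp_add, Real.exp_log hj0]
  exact Real.exp_le_exp.mpr (by linarith)

theorem pow_div_matchThreshold_mul_le {n j : ℕ} (hj : j < n) {p δ : ℝ} (hp : 0 < p) (hδ : δ < 1) :
    p ^ n / matchThreshold n p δ j * Real.exp (logFact (j + 1)) ^ n ≤
      ((j + 1) * Real.exp (4 * (√(j + 1 : ℕ) - √j)) / ((1 - δ) * (n - j : ℕ))) ^ n := by
  have hn0 : (0 : ℝ) < n := by exact_mod_cast Nat.zero_lt_of_lt hj
  have hk0 : (0 : ℝ) < (n - j : ℕ) := by exact_mod_cast Nat.sub_pos_of_lt hj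
  have hδ' : 0 < 1 - δ := by linarith
  have h1 : p ^ n / matchThreshold n p δ j * Real.exp (logFact (j + 1)) ^ n =
      ((n : ℝ) ^ n / n.factorial) * (Real.exp (logFact (j + 1)) / ((1 - δ) * (n - j : ℕ))) ^ n := by
    unfold matchThreshold
    rw [div_pow, mul_pow, mul_pow]
    field_simp
  have h2 : (n : ℝ) ^ n / n.factorial ≤ Real.exp 1 ^ n := by
    rw [← Real.exp_nat_mul, mul_one]
    exact Real.pow_div_factorial_le_exp (n : ℝ) hn0.le n
  rw [h1]
  refine (mul_le_mul_of_nonneg_right h2 (by positivity)).trans ?_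
  rw [← mul_pow]
  refine pow_le_pow_left₀ (by positivity) ?_ n
  rw [← mul_div_assoc]
  exact div_le_div_of_nonneg_right (exp_one_mul_exp_logFact_succ_le j) (by positivity)

theorem prod_pow_div_matchThreshold_le {n : ℕ} {p δ : ℝ} (hp : 0 < p) (hδ : δ < 1) {j : ℕ}
    (hj : j ≤ n) :
    ∏ k ∈ Finset.range j, p ^ n / matchThreshold n p δ k * Real.exp (logFact (k + 1)) ^ n ≤
      ((j.factorial * (n - j).factorial / n.factorial : ℝ) *
        (Real.exp (4 * √j) * ((1 - δ)⁻¹) ^ j)) ^ n := by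
  have hδ' : 0 < 1 - δ := by linarith
  induction j with
  | zero =>
    have : ((n.factorial : ℝ)) ≠ 0 := by positivity
    simp [this]
  | succ j ih =>
    rw [Finset.prod_range_succ]
    have h1 := pow_div_matchThreshold_mul_le (n := n) (j := j) hj hp hδ
    refine (mul_le_mul (ih (by omega)) h1 ?_ (by positivity)).trans_eq ?_
    · unfold matchThreshold
      positivity
    rw [← mul_pow]
    congr 1
    have hd : n - j = (n - (j + 1)) + 1 := by omega
    rw [hd, Nat.factorial_succ, Nat.factorial_succ, mul_sub, Real.exp_sub, pow_succ]
    push_cast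
    field_simp

theorem factorial_mul_factorial_div_le {n i : ℕ} (hn : n ≠ 0) (hi : i ≤ n) :
    (i.factorial * (n - i).factorial / n.factorial : ℝ) ≤
      (Real.exp 1 * (n + 1)) ^ 2 * (((n - i : ℕ) : ℝ) / n) ^ (n - i) *
        (1 - ((n - i : ℕ) : ℝ) / n) ^ i := by
  have hn0 : (0 : ℝ) < n := by exact_mod_cast Nat.pos_of_ne_zero hn
  have hcast : ((n - i : ℕ) : ℝ) = n - i := Nat.cast_sub hi
  have h1 : 1 - ((n - i : ℕ) : ℝ) / n = i / n := by
    rw [hcast]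
    field_simp
    ring
  rw [h1, div_le_iff₀ (by positivity)]
  have h2 := factorial_le_mul_div_exp_pow i
  have h3 := factorial_le_mul_div_exp_pow (n - i)
  have h4 := div_exp_pow_le_factorial n
  have hi' : (i : ℝ) ≤ n := by exact_mod_cast hi
  have hi0 : (0 : ℝ) ≤ i := Nat.cast_nonneg i
  have h2' : (i.factorial : ℝ) ≤ Real.exp 1 * (n + 1) * (i / Real.exp 1) ^ i :=
    h2.trans (by gcongr)
  have h3' : ((n - i).factorial : ℝ) ≤
      Real.exp 1 * (n + 1) * (((n - i : ℕ) : ℝ) / Real.exp 1) ^ (n - i) :=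
    h3.trans (by gcongr; exact Nat.sub_le n i)
  refine (mul_le_mul h2' h3' (by positivity) (by positivity)).trans ?_
  have h5 := mul_le_mul_of_nonneg_left h4 (show 0 ≤ (Real.exp 1 * (n + 1)) ^ 2 *
    (((n - i : ℕ) : ℝ) / n) ^ (n - i) * ((i : ℝ) / n) ^ i by positivity)
  refine Eq.trans_le ?_ h5
  have h6 : ((n : ℝ) / Real.exp 1) ^ n =
      ((n : ℝ) / Real.exp 1) ^ i * ((n : ℝ) / Real.exp 1) ^ (n - i) := by
    rw [← pow_add]
    congr 1
    omega
  rw [h6]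
  simp only [div_pow]
  field_simp

theorem inv_one_sub_le {δ : ℝ} (h0 : 0 ≤ δ) (h1 : δ ≤ 1 / 2) : (1 - δ)⁻¹ ≤ Real.exp (2 * δ) := by
  rw [inv_le_iff_one_le_mul₀ (by linarith)]
  have := Real.add_one_le_exp (2 * δ)
  nlinarith

/-- Upper bound for the probability of surviving and not being pseudorandom. -/
theorem survivalSum_not_pseudorandom_le {n m i : ℕ} {p δ ε c : ℝ} (hp : 0 < p) (hp1 : p ≤ 1)
    (hδ0 : 0 ≤ δ) (hδ : δ ≤ 1 / 2) (hmn : m < n) (hi : i ≤ m) (hε : 0 ≤ ε)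
    (hc : 0 ≤ c) (hεi : ε * n ≤ (n - i : ℕ)) :
    survivalSum n m p δ i (fun G => if ¬ Pseudorandom ε G (n - i) c then 1 else 0) ≤
      (Real.exp 1 * (n + 1)) ^ (2 * n) * 4 ^ n *
        Real.exp (4 * √n * n + 2 * δ * n ^ 2 - ε ^ 3 / 200 * c ^ 2 * n ^ 2) := by
  have hn : n ≠ 0 := by omega
  have hin : i ≤ n := by omega
  have hT : ∀ j < m, 0 < matchThreshold n p δ j := by
    intro j hj
    have hk0 : (0 : ℝ) < (n - j : ℕ) := by exact_mod_cast Nat.sub_pos_of_lt (by omega)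
    have hn0 : (0 : ℝ) < n := by exact_mod_cast Nat.pos_of_ne_zero hn
    have : 0 < 1 - δ := by linarith
    unfold matchThreshold
    positivity
  have h1 := survivalSum_le hp.le hp1 (m := m) hT hmn.le hi
    (Φ := fun G => if ¬ Pseudorandom ε G (n - i) c then (1 : ℝ) else 0)
    (fun G => by split_ifs <;> norm_num)
  refine h1.trans ?_
  have h2 : ∑ G ∈ regularGraphs n (n - i), (if ¬ Pseudorandom ε G (n - i) c then (1 : ℝ) else 0)
      = (((regularGraphs n (n - i)).filter fun G => ¬ Pseudorandom ε G (n - i) c).card : ℝ) := by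
    rw [Finset.card_filter]
    push_cast
    rfl
  rw [h2]
  set bad : ℝ := (((regularGraphs n (n - i)).filter fun G => ¬ Pseudorandom ε G (n - i) c).card : ℝ)
  have h3 := prod_pow_div_matchThreshold_le (n := n) hp (show δ < 1 by linarith) hin
  have h4 := factorial_mul_factorial_div_le hn hin
  have h5 := card_not_pseudorandom_mul_le (k := n - i) (Nat.sub_le n i) hn hε hc hεi
  set D1 : ℝ := (((n - i : ℕ) : ℝ) / n) ^ (n - i) * (1 - ((n - i : ℕ) : ℝ) / n) ^ i with hD1
  have hD : (((n - i : ℕ) : ℝ) / n) ^ (n * (n - i)) *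
      (1 - ((n - i : ℕ) : ℝ) / n) ^ (n * (n - (n - i))) = D1 ^ n := by
    rw [hD1, mul_pow, ← pow_mul, ← pow_mul, mul_comm n (n - i), mul_comm n (n - (n - i))]
    congr 3
    omega
  rw [hD] at h5
  rw [mul_assoc, ← hD1] at h4
  have h6 : Real.exp (4 * √i) * ((1 - δ)⁻¹) ^ i ≤ Real.exp (4 * √n + 2 * δ * n) := by
    rw [Real.exp_add]
    have hi' : (i : ℝ) ≤ n := by exact_mod_cast hin
    have h7 : ((1 - δ)⁻¹) ^ i ≤ Real.exp (2 * δ * n) := by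
      refine (pow_le_pow_left₀ (inv_nonneg.mpr (by linarith)) (inv_one_sub_le hδ0 hδ) i).trans ?_
      rw [← Real.exp_nat_mul]
      refine Real.exp_le_exp.mpr ?_
      nlinarith
    have h8 : 0 ≤ ((1 - δ)⁻¹) ^ i := pow_nonneg (inv_nonneg.mpr (by linarith)) i
    exact mul_le_mul (Real.exp_le_exp.mpr (by have := Real.sqrt_le_sqrt hi'; linarith)) h7 h8
      (Real.exp_pos _).le
  have hDnn : 0 ≤ D1 := by
    have hr1 : ((n - i : ℕ) : ℝ) / n ≤ 1 := by
      rw [div_le_one (by exact_mod_cast Nat.pos_of_ne_zero hn)]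
      exact_mod_cast Nat.sub_le n i
    exact mul_nonneg (by positivity) (pow_nonneg (by linarith) _)
  have h9 : 0 ≤ Real.exp (4 * √i) * ((1 - δ)⁻¹) ^ i :=
    mul_nonneg (Real.exp_pos _).le (pow_nonneg (inv_nonneg.mpr (by linarith)) i)
  have h10 := h3.trans (pow_le_pow_left₀ (mul_nonneg (by positivity) h9)
    (mul_le_mul h4 h6 h9 (mul_nonneg (by positivity) hDnn)) n)
  refine (mul_le_mul_of_nonneg_right h10 (Nat.cast_nonneg _)).trans ?_
  have h11 : ((Real.exp 1 * (n + 1)) ^ 2 * D1 * Real.exp (4 * √n + 2 * δ * n)) ^ n * bad =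
      (Real.exp 1 * (n + 1)) ^ (2 * n) * Real.exp (n * (4 * √n + 2 * δ * n)) * (bad * D1 ^ n) := by
    rw [mul_pow, mul_pow, ← pow_mul, Real.exp_nat_mul]
    ring
  rw [h11]
  refine (mul_le_mul_of_nonneg_left h5 (by positivity)).trans_eq ?_
  rw [sub_eq_add_neg, Real.exp_add, show (n : ℝ) * (4 * √n + 2 * δ * n)
    = 4 * √n * n + 2 * δ * n ^ 2 by ring]
  ring

/-- Lower bound for the probability of surviving. -/
theorem le_survivalSum_of_le {n m i : ℕ} {p δ ε : ℝ} (hp : 0 < p) (hp1 : p ≤ 1)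
    (hδ : δ ≤ 1 / 2) (hmn : m < n) (hi : i ≤ m)
    (hεm : ∀ j < m, ε * n ≤ (n - j : ℕ)) {t : ℝ} (ht : 1 ≤ t) (htp : t ^ 2 ≤ ε * n * p)
    (hδn : 2 * Real.exp 1 * (n + 1) * Real.exp (-(δ * n)) ≤ 1) :
    (Real.exp (-(141 * n / t)) / 4) ^ i ≤ survivalSum n m p δ i fun _ => 1 := by
  have hn0 : (0 : ℝ) < n := by exact_mod_cast Nat.zero_lt_of_lt hmn
  have hδ' : 0 < 1 - δ := by linarith
  have hT : ∀ j < m, 0 < matchThreshold n p δ j := by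
    intro j hj
    have hk0 : (0 : ℝ) < (n - j : ℕ) := by exact_mod_cast Nat.sub_pos_of_lt (by omega)
    unfold matchThreshold
    positivity
  refine le_survivalSum_one hp.le hp1 (by positivity) hT hmn.le (fun j hj G hG => ?_) hi
  set s := √((n - j : ℕ) * p) with hs
  have hss : ((n - j : ℕ) : ℝ) * p = s ^ 2 := (Real.sq_sqrt (by positivity)).symm
  have hts : t ≤ s := by
    refine Real.le_sqrt_of_sq_le (htp.trans ?_)
    exact mul_le_mul_of_nonneg_right (hεm j hj) hp.le
  refine le_trans ?_ (le_sum_layerWeight_of_isBiRegular hp.le hp1 hG (ht.trans hts) hss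
    (hT j hj).le ?_)
  · gcongr
  · unfold matchThreshold
    rw [mul_assoc (1 - δ), hss, mul_pow]
    have h1 : (1 - δ) ^ n ≤ Real.exp (-(δ * n)) := by
      refine (pow_le_pow_left₀ hδ'.le (Real.one_sub_le_exp_neg δ) n).trans_eq ?_
      rw [← Real.exp_nat_mul]
      congr 1
      ring
    have h2 := factorial_le_mul_div_exp_pow n
    have h3 : 2 * ((1 - δ) ^ n * n.factorial) ≤ ((n : ℝ) / Real.exp 1) ^ n := by
      have h4 := mul_le_mul h1 h2 (by positivity) (Real.exp_pos _).le
      have h5 := mul_le_mul_of_nonneg_right hδn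
        (show 0 ≤ ((n : ℝ) / Real.exp 1) ^ n by positivity)
      nlinarith
    have h6 := mul_le_mul_of_nonneg_left h3 (show 0 ≤ (s ^ 2) ^ n / (n : ℝ) ^ n by positivity)
    refine (Eq.trans_le ?_ h6).trans_eq ?_
    · ring
    · rw [div_pow, div_pow]
      field_simp

theorem upper_le_exp_neg_mul_lower {n : ℕ} (hn : 1 ≤ n) {δ x ε κ : ℝ} (hx : δ = x ^ 3)
    (hsmall : (2 + 141 / ε) * x ≤ κ / 2)
    (hbig : 16 * √n ≤ κ / 2 * x ^ 2 * n) :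
    (Real.exp 1 * (n + 1)) ^ (2 * n) * 4 ^ n *
        Real.exp (4 * √n * n + 2 * δ * n ^ 2 - κ * x ^ 2 * n ^ 2) ≤
      Real.exp (-n) * (Real.exp (-(141 * n / (ε / δ))) / 4) ^ n := by
  have hn1 : (1 : ℝ) ≤ n := by exact_mod_cast hn
  have hn0 : (0 : ℝ) < n := by linarith
  have h4 : (4 : ℝ) = Real.exp (Real.log 4) := (Real.exp_log (by norm_num)).symm
  have hn' : (n : ℝ) + 1 = Real.exp (Real.log (n + 1)) := (Real.exp_log (by linarith)).symm
  have hL : (Real.exp 1 * (n + 1)) ^ (2 * n) * 4 ^ n =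
      Real.exp (2 * n * (1 + Real.log (n + 1)) + n * Real.log 4) := by
    rw [Real.exp_add, Real.exp_nat_mul, Real.exp_log (by norm_num : (0 : ℝ) < 4),
      show 2 * (n : ℝ) * (1 + Real.log (n + 1)) = ((2 * n : ℕ) : ℝ) * (1 + Real.log (n + 1)) by
        push_cast; ring, Real.exp_nat_mul, Real.exp_add, Real.exp_log (by linarith)]
  have hR : (Real.exp (-(141 * n / (ε / δ))) / 4) ^ n =
      Real.exp (n * (-(141 * n / (ε / δ)) - Real.log 4)) := by
    rw [Real.exp_nat_mul, Real.exp_sub, Real.exp_log (by norm_num : (0 : ℝ) < 4)]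
  rw [hL, hR, ← Real.exp_add, ← Real.exp_add]
  refine Real.exp_le_exp.mpr ?_
  have hlog4 : Real.log 4 ≤ 3 / 2 := by
    rw [show (4 : ℝ) = 2 ^ 2 by norm_num, Real.log_pow]
    have := Real.log_two_lt_d9
    push_cast
    linarith
  have hs1 : 1 ≤ √(n : ℝ) := Real.one_le_sqrt.mpr hn1
  have hss : √(n : ℝ) * √n = n := Real.mul_self_sqrt hn0.le
  have hlogn : Real.log (n + 1) ≤ 2 * √n := by
    have h1 : (n : ℝ) + 1 ≤ (1 + √n) ^ 2 := by nlinarith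
    have h2 := Real.log_le_log (by linarith) h1
    rw [Real.log_pow] at h2
    have h3 := Real.log_le_sub_one_of_pos (show 0 < 1 + √(n : ℝ) by linarith)
    push_cast at h2
    linarith
  have h5 : 3 + 2 * Real.log (n + 1) + 2 * Real.log 4 + 4 * √n ≤ κ / 2 * x ^ 2 * n := by linarith
  have h6 := mul_le_mul_of_nonneg_left h5 hn0.le
  have h7 := mul_le_mul_of_nonneg_left hsmall (show 0 ≤ x ^ 2 * (n : ℝ) ^ 2 by positivity)
  have h8 : 141 * (n : ℝ) / (ε / δ) = 141 / ε * x ^ 3 * n := by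
    rw [hx, div_div_eq_mul_div]
    ring
  rw [h8, hx]
  nlinarith

theorem two_mul_exp_one_mul_le {y : ℝ} (hy : 22 ≤ y) {n : ℕ} (hn : y ^ 18 = n) {d : ℝ}
    (hd : y ^ 12 ≤ d) : 2 * Real.exp 1 * (n + 1) * Real.exp (-d) ≤ 1 := by
  have hy1 : 1 ≤ y := by linarith
  have h1 := Real.quadratic_le_exp_of_nonneg (show 0 ≤ y ^ 12 by positivity)
  have h2 := h1.trans (Real.exp_le_exp.mpr hd)
  rw [Real.exp_neg, ← div_eq_mul_inv, div_le_one (Real.exp_pos _), ← hn]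
  refine le_trans ?_ h2
  have h3 : 1 ≤ y ^ 18 := one_le_pow₀ hy1
  have h4 : 22 ≤ y ^ 6 := hy.trans (le_self_pow₀ hy1 (by norm_num))
  have h5 : 22 * y ^ 18 ≤ (y ^ 12) ^ 2 := by
    calc 22 * y ^ 18 ≤ y ^ 6 * y ^ 18 := by gcongr
      _ = (y ^ 12) ^ 2 := by ring
  have h6 : 0 ≤ y ^ 12 := by positivity
  have := Real.exp_one_lt_d9
  nlinarith

theorem sixteen_mul_sqrt_le {y κ x : ℝ} (hκ : 0 < κ) (hy1 : 1 ≤ y) (hy : 32 / κ ≤ y) {n : ℕ}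
    (hn : y ^ 18 = n) (hx : 1 / y ^ 2 ≤ x) : 16 * √n ≤ κ / 2 * x ^ 2 * n := by
  have hy0 : 0 < y := by linarith
  rw [← hn, show y ^ 18 = (y ^ 9) ^ 2 by ring, Real.sqrt_sq (by positivity)]
  have h1 : (1 / y ^ 2) ^ 2 ≤ x ^ 2 := pow_le_pow_left₀ (by positivity) hx 2
  have h2 : 32 ≤ κ * y ^ 5 := by
    rw [div_le_iff₀ hκ] at hy
    have : y ≤ y ^ 5 := le_self_pow₀ hy1 (by norm_num)
    nlinarith
  calc 16 * y ^ 9 ≤ κ / 2 * y ^ 5 * y ^ 9 := by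
        have : 0 < y ^ 9 := by positivity
        nlinarith
    _ = κ / 2 * (1 / y ^ 2) ^ 2 * (y ^ 9) ^ 2 := by field_simp
    _ ≤ κ / 2 * x ^ 2 * (y ^ 9) ^ 2 := by gcongr

/-- In the matching algorithm with `m = ⌊(1−ε)n⌋`, `p = f·log n/n ≤ 1` (`f → ∞`) and
`δ = max(f^{-1/3}, 1/n)`: there is `c > 0` such that for all sufficiently large `n` and
each step `1 ≤ i+1 ≤ m`, conditioned on `H_{j+1}` having at least `L(j+1)^n·n!/n^n`
perfect matchings for every `j < i`, the probability that the `(n−i)`-regular graph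
`G_{i+1}` is not `δ^{1/3}`-pseudorandom is at most `exp(−cn)`; stated in product form
`P(B ∧ A) ≤ exp(−cn)·P(B)`. -/
theorem stmt10 (ε : ℝ) (hε : ε ∈ Set.Ioo (0 : ℝ) 1)
    (f : ℕ → ℝ) (hf : Filter.Tendsto f Filter.atTop Filter.atTop)
    (p : ℕ → ℝ) (hp : ∀ n : ℕ, p n = f n * Real.log n / n) (hp1 : ∀ n, p n ≤ 1)
    (δ : ℕ → ℝ) (hδ : ∀ n : ℕ, δ n = max ((f n) ^ (-(1 / 3 : ℝ))) (1 / n)) :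
    ∃ c > (0 : ℝ), ∃ N : ℕ, ∀ n ≥ N, ∀ i < ⌊(1 - ε) * (n : ℝ)⌋₊,
      algProb n ⌊(1 - ε) * (n : ℝ)⌋₊ (p n) (fun M ρ =>
          NoAbortBefore n ⌊(1 - ε) * (n : ℝ)⌋₊ (p n) (δ n) i M ρ ∧
          ¬ Pseudorandom ε (stepG n ⌊(1 - ε) * (n : ℝ)⌋₊ M ρ i) (n - i)
              ((δ n) ^ ((1 : ℝ) / 3)))
        ≤ Real.exp (-c * n) *
          algProb n ⌊(1 - ε) * (n : ℝ)⌋₊ (p n)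
            (NoAbortBefore n ⌊(1 - ε) * (n : ℝ)⌋₊ (p n) (δ n) i) := by
  obtain ⟨hε0, hε1⟩ := hε
  set κ : ℝ := ε ^ 3 / 200 with hκ
  have hκ0 : 0 < κ := by positivity
  have hδlim : Filter.Tendsto δ Filter.atTop (nhds 0) := by
    have h1 : Filter.Tendsto (fun n => (f n) ^ (-(1 / 3 : ℝ))) Filter.atTop (nhds 0) :=
      (tendsto_rpow_neg_atTop (by norm_num)).comp hf
    have h2 := h1.max (tendsto_one_div_atTop_nhds_zero_nat (𝕜 := ℝ))
    rw [max_self] at h2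
    exact h2.congr fun n => (hδ n).symm
  have hxlim : Filter.Tendsto (fun n => (2 + 141 / ε) * (δ n) ^ ((1 : ℝ) / 3)) Filter.atTop
      (nhds 0) := by
    have h1 := (hδlim.rpow_const (p := (1 : ℝ) / 3) (Or.inr (by norm_num))).const_mul
      (2 + 141 / ε)
    rwa [Real.zero_rpow (by norm_num), mul_zero] at h1
  have hylim : Filter.Tendsto (fun n : ℕ => (n : ℝ) ^ ((18 : ℕ) : ℝ)⁻¹) Filter.atTop Filter.atTop :=
    (tendsto_rpow_atTop (by norm_num)).comp tendsto_natCast_atTop_atTop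
  have hloglim : Filter.Tendsto (fun n : ℕ => Real.log n) Filter.atTop Filter.atTop :=
    Real.tendsto_log_atTop.comp tendsto_natCast_atTop_atTop
  have hev := (hf.eventually_ge_atTop 1).and <| (hloglim.eventually_ge_atTop 1).and <|
    (hylim.eventually_ge_atTop (max 22 (32 / κ))).and <|
    (hxlim.eventually_le_const (show 0 < κ / 2 by positivity)).and <|
    (hδlim.eventually_le_const (show 0 < min (1 / 2) ε by positivity)).and <|
    Filter.eventually_ge_atTop 1
  obtain ⟨N, hN⟩ := Filter.eventually_atTop.mp hev
  refine ⟨1, one_pos, N, fun n hn i hi => ?_⟩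
  obtain ⟨hf1, hlog1, hy, hx, hδs, hn1⟩ := hN n hn
  set m := ⌊(1 - ε) * (n : ℝ)⌋₊ with hm
  set y : ℝ := (n : ℝ) ^ ((18 : ℕ) : ℝ)⁻¹ with hydef
  have hn0 : (0 : ℝ) < n := by exact_mod_cast hn1
  have hy22 : 22 ≤ y := (le_max_left _ _).trans hy
  have hy1 : 1 ≤ y := by linarith
  have hy0 : 0 < y := by linarith
  have hyn : y ^ 18 = n := Real.rpow_inv_natCast_pow hn0.le (by norm_num)
  have hf0 : 0 < f n := by linarith
  have hpn : 0 < p n := by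
    rw [hp]
    positivity
  have hmle : (m : ℝ) ≤ (1 - ε) * n := Nat.floor_le (mul_nonneg (by linarith) hn0.le)
  have hmn : m < n := by
    have : (m : ℝ) < n := by nlinarith
    exact_mod_cast this
  have hεj : ∀ j < m, ε * n ≤ ((n - j : ℕ) : ℝ) := by
    intro j hj
    rw [Nat.cast_sub (by omega)]
    have : (j : ℝ) ≤ m := by exact_mod_cast hj.le
    linarith
  have hδ2 : δ n ≤ 1 / 2 := hδs.trans (min_le_left _ _)
  have hδε : δ n ≤ ε := hδs.trans (min_le_right _ _)
  have hδf : (f n) ^ (-(1 / 3 : ℝ)) ≤ δ n := by rw [hδ]; exact le_max_left _ _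
  have hδ0 : 0 < δ n := (Real.rpow_pos_of_pos hf0 _).trans_le hδf
  set x : ℝ := (δ n) ^ ((1 : ℝ) / 3) with hxdef
  have hx0 : 0 ≤ x := Real.rpow_nonneg hδ0.le _
  have hx3 : δ n = x ^ 3 := by
    rw [hxdef, ← Real.rpow_natCast, ← Real.rpow_mul hδ0.le]
    norm_num
  have hfn : f n ≤ n := by
    have h1 := hp1 n
    rw [hp, div_le_one hn0] at h1
    nlinarith
  have hxy : 1 / y ^ 2 ≤ x := by
    have h1 : (1 / y ^ 2) ^ 3 ≤ x ^ 3 := by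
      rw [← hx3]
      refine le_trans ?_ hδf
      refine le_trans (le_of_eq ?_) (Real.rpow_le_rpow_of_nonpos hf0 hfn (by norm_num))
      have h2 : (y ^ 18 : ℝ) ^ (-(1 / 3 : ℝ)) = (y ^ 6)⁻¹ := by
        rw [← Real.rpow_natCast y 18, ← Real.rpow_mul hy0.le, ← Real.rpow_natCast y 6,
          ← Real.rpow_neg hy0.le]
        norm_num
      rw [← hyn, h2, one_div, inv_pow, ← pow_mul]
    exact le_of_pow_le_pow_left₀ (by norm_num) hx0 h1
  have hδn : y ^ 12 ≤ δ n * n := by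
    have h1 : (1 / y ^ 2) ^ 3 ≤ x ^ 3 := pow_le_pow_left₀ (by positivity) hxy 3
    rw [hx3, ← hyn]
    calc y ^ 12 = (1 / y ^ 2) ^ 3 * y ^ 18 := by field_simp
      _ ≤ x ^ 3 * y ^ 18 := by gcongr
  have htp : (ε / δ n) ^ 2 ≤ ε * n * p n := by
    have h1 : 1 / f n ≤ δ n ^ 3 := by
      have h2 := pow_le_pow_left₀ (Real.rpow_nonneg hf0.le _) hδf 3
      rw [← Real.rpow_natCast, ← Real.rpow_mul hf0.le] at h2
      norm_num [Real.rpow_neg_one] at h2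
      rwa [one_div]
    have h3 : δ n ^ 3 ≤ δ n ^ 2 := by
      have := pow_pos hδ0 2
      nlinarith
    have h4 : 1 ≤ δ n ^ 2 * f n := by
      have := h1.trans h3
      rwa [div_le_iff₀ hf0] at this
    have h5 : ε * n * p n = ε * (f n * Real.log n) := by
      rw [hp]
      field_simp
    rw [h5, div_pow, div_le_iff₀ (pow_pos hδ0 2)]
    have h6 : f n ≤ f n * Real.log n := by nlinarith
    have h7 : 1 ≤ δ n ^ 2 * (f n * Real.log n) :=
      h4.trans (mul_le_mul_of_nonneg_left h6 (by positivity))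
    have h8 := mul_le_mul_of_nonneg_left h7 hε0.le
    nlinarith
  have hup := survivalSum_not_pseudorandom_le (i := i) hpn (hp1 n) hδ0.le hδ2 hmn hi.le hε0.le
    hx0 (hεj i hi)
  have hlow := le_survivalSum_of_le (i := i) hpn (hp1 n) hδ2 hmn hi.le hεj
    ((one_le_div hδ0).mpr hδε) htp (two_mul_exp_one_mul_le hy22 hyn hδn)
  have hcomb := upper_le_exp_neg_mul_lower hn1 hx3 hx
    (sixteen_mul_sqrt_le hκ0 hy1 ((le_max_right _ _).trans hy) hyn hxy)
  have hpow : (Real.exp (-(141 * n / (ε / δ n))) / 4) ^ n ≤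
      (Real.exp (-(141 * n / (ε / δ n))) / 4) ^ i := by
    refine pow_le_pow_of_le_one (by positivity) ?_ (by omega)
    have : Real.exp (-(141 * n / (ε / δ n))) ≤ 1 := Real.exp_le_one_iff.mpr (by
      have : 0 ≤ 141 * (n : ℝ) / (ε / δ n) := by positivity
      linarith)
    linarith
  rw [algProb_noAbort_and_eq n m (p n) (δ n) i fun G => ¬ Pseudorandom ε G (n - i) x,
    algProb_noAbort_eq, neg_one_mul]
  refine le_trans (le_of_eq ?_) (hup.trans (hcomb.trans
    (mul_le_mul_of_nonneg_left (hpow.trans hlow) (Real.exp_pos _).le)))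
  congr! 2
  congr

end
end
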